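/- Let E be an m-dimensional primitive extremal subset of X and let p ∈ E be a regular point of an admissible map f: X → ℝ^m. Then p is a good point of E, i.e., p satisfies condition (DRN). -/

import Mathlib

open Metric Set

noncomputable section

namespace Collapse

/-- The comparison angle `∠̃κ` at the vertex opposite to the side of length `c` in a triangle
with side lengths `a`, `b`, `c` in the model plane of constant curvature `κ`. -/
noncomputable def cmpAngle (κ a b c : ℝ) : ℝ :=
  if κ = 0 then Real.arccos ((a ^ 2 + b ^ 2 - c ^ 2) / (2 * a * b))
  else if 0 < κ then
    Real.arccos ((Real.cos (Real.sqrt κ * c) - Real.cos (Real.sqrt κ * a) *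
        Real.cos (Real.sqrt κ * b)) / (Real.sin (Real.sqrt κ * a) * Real.sin (Real.sqrt κ * b)))
  else
    Real.arccos ((Real.cosh (Real.sqrt (-κ) * a) * Real.cosh (Real.sqrt (-κ) * b) -
        Real.cosh (Real.sqrt (-κ) * c)) /
      (Real.sinh (Real.sqrt (-κ) * a) * Real.sinh (Real.sqrt (-κ) * b)))

/-- Alexandrov's (1+3)-point comparison: curvature bounded below by `κ`. -/
def CurvGE (X : Type) [MetricSpace X] (κ : ℝ) : Prop :=
  ∀ p a b c : X, a ≠ p → b ≠ p → c ≠ p →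
    cmpAngle κ (dist p a) (dist p b) (dist a b) +
      cmpAngle κ (dist p b) (dist p c) (dist b c) +
      cmpAngle κ (dist p c) (dist p a) (dist c a) ≤ 2 * Real.pi

/-- An `n`-dimensional Alexandrov space of curvature `≥ κ`: a proper geodesic metric space
satisfying the comparison inequality, of Hausdorff dimension `n`. -/
structure IsAlexandrovSpace (X : Type) [MetricSpace X] (n : ℕ) (κ : ℝ) : Prop where
  proper : ProperSpace X
  midpoint : ∀ x y : X, ∃ m : X, dist x m = dist x y / 2 ∧ dist m y = dist x y / 2
  curv : CurvGE X κ
  dim : dimH (Set.univ : Set X) = n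

/-- A pair of `μ`-approximations `θ : M → X`, `η : X → M` between metric spaces,
with `|θ ∘ η, id_X| < μ`. -/
structure IsApproxPair {M X : Type} [MetricSpace M] [MetricSpace X] (μ : ℝ)
    (θ : M → X) (η : X → M) : Prop where
  dist_theta : ∀ a b : M, |dist (θ a) (θ b) - dist a b| < μ
  dist_eta : ∀ x y : X, |dist (η x) (η y) - dist x y| < μ
  dense_theta : ∀ x : X, ∃ a : M, dist (θ a) x < μ
  dense_eta : ∀ a : M, ∃ x : X, dist (η x) a < μ
  comp : ∀ x : X, dist (θ (η x)) x < μ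

/-- `p` is a critical point of the distance function `dist_q`: the differential of `dist_q`
at `p` is nonpositive, i.e. every comparison angle `∠̃κ q p x` is at most `π/2`. -/
def IsCriticalPt {X : Type} [MetricSpace X] (κ : ℝ) (q p : X) : Prop :=
  ∀ x : X, x ≠ p → cmpAngle κ (dist p q) (dist p x) (dist q x) ≤ Real.pi / 2

/-- A closed subset `E` is extremal: every point of `E` that is a local minimum on `E` of a
distance function `dist_q`, `q ∉ E`, is a critical point of `dist_q`. -/
def IsExtremal {X : Type} [MetricSpace X] (κ : ℝ) (E : Set X) : Prop :=
  IsClosed E ∧ ∀ q : X, q ∉ E → ∀ p ∈ E,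
    IsLocalMinOn (fun x => dist q x) E p → IsCriticalPt κ q p

/-- `X` has no proper nonempty extremal subsets. -/
def HasNoProperExtremal (X : Type) [MetricSpace X] (κ : ℝ) : Prop :=
  ∀ E : Set X, IsExtremal κ E → E = ∅ ∨ E = Set.univ

/-- The main part of an extremal subset: the complement in `E` of all proper extremal subsets. -/
def mainPart {X : Type} [MetricSpace X] (κ : ℝ) (E : Set X) : Set X :=
  E \ ⋃₀ {F : Set X | IsExtremal κ F ∧ F ⊂ E}

/-- A primitive extremal subset: an extremal subset containing no proper extremal subset with
nonempty relative interior. -/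
def IsPrimitiveExtremal {X : Type} [MetricSpace X] (κ : ℝ) (E : Set X) : Prop :=
  IsExtremal κ E ∧ ∀ F : Set X, IsExtremal κ F → F ⊂ E →
    ∀ V : Set X, IsOpen V → V ∩ E ⊆ F → V ∩ E = ∅

/-- `E` contains no proper nonempty extremal subsets. -/
def NoProperExtremalIn {X : Type} [MetricSpace X] (κ : ℝ) (E : Set X) : Prop :=
  ∀ F : Set X, IsExtremal κ F → F ⊂ E → F = ∅

end Collapse

namespace Collapse

/-- Construction data for an admissible map in Perelman's sense: each coordinate is a sum of
smooth, increasing, concave functions of distance functions. -/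
structure AdmissibleData (X : Type) [MetricSpace X] (k : ℕ) where
  num : Fin k → ℕ
  npos : ∀ i, 0 < num i
  pt : ∀ i : Fin k, Fin (num i) → X
  φ : ∀ i : Fin k, Fin (num i) → ℝ → ℝ
  smooth : ∀ i α, ContDiff ℝ (⊤ : ℕ∞) (φ i α)
  mono : ∀ i α, StrictMono (φ i α)
  conc : ∀ i α, ConcaveOn ℝ Set.univ (φ i α)

/-- The underlying (pre-composition) map `f_i(x) = ∑_α φ_{iα}(|q_{iα} x|)`. -/
def AdmissibleData.core {X : Type} [MetricSpace X] {k : ℕ} (d : AdmissibleData X k) :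
    X → Fin k → ℝ :=
  fun x i => ∑ α : Fin (d.num i), d.φ i α (dist (d.pt i α) x)

/-- Perelman's regularity condition at a point `p`: the pairwise comparison-angle condition and
the existence of a common direction of increase (witnessed by a point `w`). -/
def AdmissibleData.RegularAt {X : Type} [MetricSpace X] {k : ℕ} (κ : ℝ)
    (d : AdmissibleData X k) (p : X) : Prop :=
  (∀ i j : Fin k, i ≠ j →
      ∑ α : Fin (d.num i), ∑ β : Fin (d.num j),
        deriv (d.φ i α) (dist (d.pt i α) p) * deriv (d.φ j β) (dist (d.pt j β) p) *
          Real.cos (cmpAngle κ (dist p (d.pt i α)) (dist p (d.pt j β))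
            (dist (d.pt i α) (d.pt j β))) < 0) ∧
    ∃ w : X, w ≠ p ∧ ∀ i : Fin k,
      ∑ α : Fin (d.num i), deriv (d.φ i α) (dist (d.pt i α) p) *
        Real.cos (cmpAngle κ (dist p (d.pt i α)) (dist p w) (dist (d.pt i α) w)) < 0

/-- The natural lift of admissible data along a map `η : X → M` (e.g. a Gromov-Hausdorff
approximation): each reference point is replaced by its lift. -/
def AdmissibleData.lift {X M : Type} [MetricSpace X] [MetricSpace M] {k : ℕ}
    (d : AdmissibleData X k) (η : X → M) : AdmissibleData M k where
  num := d.num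
  npos := d.npos
  pt := fun i α => η (d.pt i α)
  φ := d.φ
  smooth := d.smooth
  mono := d.mono
  conc := d.conc

/-- A global bi-Lipschitz self-homeomorphism of `ℝ^k` with constant `L`. -/
def IsBiLip {k : ℕ} (L : ℝ) (H : (Fin k → ℝ) → Fin k → ℝ) : Prop :=
  0 < L ∧ ∀ v w : Fin k → ℝ, dist v w ≤ L * dist (H v) (H w) ∧ dist (H v) (H w) ≤ L * dist v w

/-- `f` is an admissible map on `U`, regular at all points of `S`. -/
def IsRegAdmissibleOn {X : Type} [MetricSpace X] {k : ℕ} (κ : ℝ) (f : X → Fin k → ℝ)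
    (U S : Set X) : Prop :=
  ∃ (d : AdmissibleData X k) (H : (Fin k → ℝ) → Fin k → ℝ) (L : ℝ),
    IsBiLip L H ∧ Set.EqOn f (fun x => H (d.core x)) U ∧ ∀ x ∈ S, d.RegularAt κ x

end Collapse

namespace Collapse

/-- Fiber data on an extremal subset `E`: a point `p` of the main part of `E` and a radius
`r > 0` such that `dist_p` is regular (noncritical) on `B̄(p,r) ∖ {p}`. The regular fiber over
`E` in `M` is the lifted closed ball `B̄(p̂, r)`. -/
structure EFiberData {X : Type} [MetricSpace X] (κ : ℝ) (E : Set X) where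
  p : X
  r : ℝ
  rpos : 0 < r
  p_main : p ∈ mainPart κ E
  reg : ∀ x ∈ Metric.closedBall p r, x ≠ p → ¬ IsCriticalPt κ p x

/-- `U` admits a deformation retraction onto `A ⊆ U`. -/
def DeformRetractsOnto {Y : Type} [TopologicalSpace Y] (U A : Set Y) : Prop :=
  A ⊆ U ∧ ∃ H : C(↥U × ↥unitInterval, Y),
    (∀ x : ↥U, H (x, 0) = (x : Y)) ∧ (∀ x : ↥U, H (x, 1) ∈ A) ∧
    (∀ (x : ↥U) (t : ↥unitInterval), H (x, t) ∈ U) ∧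
    (∀ x : ↥U, (x : Y) ∈ A → H (x, 1) = (x : Y))

/-- Condition (DRN): `p ∈ E` is a good point of the extremal subset `E`. For every `R > 0`
there is `ρ > 0` such that for all `q₁, q₂ ∈ B(p,ρ) ∩ E` and all sufficiently small
`r₁, r₂ > 0`, every Alexandrov space `M` (of curvature `≥ κ`, dimension `n`) sufficiently
Gromov-Hausdorff close to `X` contains a deformation retract neighborhood `U`,
`B(p̂,ρ) ⊆ U ⊆ B(p̂,R)`, admitting deformation retractions onto both `B̄(q̂ᵢ, rᵢ)`. -/
def IsGoodPointDRN (n : ℕ) (κ : ℝ) {X : Type} [MetricSpace X] (E : Set X) (p : X) : Prop :=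
  ∀ R > (0 : ℝ), ∃ ρ > (0 : ℝ), ∀ q₁ ∈ Metric.ball p ρ ∩ E, ∀ q₂ ∈ Metric.ball p ρ ∩ E,
    ∃ r₀ > (0 : ℝ), ∀ r₁ r₂ : ℝ, 0 < r₁ → r₁ ≤ r₀ → 0 < r₂ → r₂ ≤ r₀ →
      ∃ μ₀ > (0 : ℝ), ∀ μ : ℝ, 0 < μ → μ ≤ μ₀ →
        ∀ (M : Type) (_ : MetricSpace M), IsAlexandrovSpace M n κ →
          ∀ (θ : M → X) (η : X → M), IsApproxPair μ θ η →
            ∃ U : Set M, Metric.ball (η p) ρ ⊆ U ∧ U ⊆ Metric.ball (η p) R ∧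
              DeformRetractsOnto U (Metric.closedBall (η q₁) r₁) ∧
              DeformRetractsOnto U (Metric.closedBall (η q₂) r₂)

end Collapse

namespace Collapse

def sn (κ x : ℝ) : ℝ :=
  if κ = 0 then x else if 0 < κ then Real.sin (√κ * x) / √κ
  else Real.sinh (√(-κ) * x) / √(-κ)

def cs (κ x : ℝ) : ℝ :=
  if κ = 0 then 1 else if 0 < κ then Real.cos (√κ * x)
  else Real.cosh (√(-κ) * x)

def md (κ x : ℝ) : ℝ :=
  if κ = 0 then x ^ 2 / 2 else if 0 < κ then (1 - Real.cos (√κ * x)) / κ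
  else (Real.cosh (√(-κ) * x) - 1) / (-κ)

lemma sgn_cases (κ : ℝ) : κ = 0 ∨ (∃ s : ℝ, 0 < s ∧ κ = s ^ 2) ∨ (∃ s : ℝ, 0 < s ∧ κ = -s ^ 2) := by
  rcases lt_trichotomy κ 0 with h | h | h
  · right; right
    refine ⟨√(-κ), Real.sqrt_pos.2 (by linarith), ?_⟩
    rw [Real.sq_sqrt (by linarith)]; ring
  · left; exact h
  · right; left
    refine ⟨√κ, Real.sqrt_pos.2 h, ?_⟩
    rw [Real.sq_sqrt h.le]

lemma sn_zero_k (x : ℝ) : sn 0 x = x := by simp [sn]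
lemma cs_zero_k (x : ℝ) : cs 0 x = 1 := by simp [cs]
lemma md_zero_k (x : ℝ) : md 0 x = x ^ 2 / 2 := by simp [md]
lemma sn_pos_k {s : ℝ} (hs : 0 < s) (x : ℝ) : sn (s ^ 2) x = Real.sin (s * x) / s := by
  have h1 : s ^ 2 ≠ 0 := by positivity
  have h2 : 0 < s ^ 2 := by positivity
  simp only [sn, h1, h2, if_true, if_false, Real.sqrt_sq hs.le]
lemma cs_pos_k {s : ℝ} (hs : 0 < s) (x : ℝ) : cs (s ^ 2) x = Real.cos (s * x) := by
  have h1 : s ^ 2 ≠ 0 := by positivity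
  have h2 : 0 < s ^ 2 := by positivity
  simp only [cs, h1, h2, if_true, if_false, Real.sqrt_sq hs.le]
lemma md_pos_k {s : ℝ} (hs : 0 < s) (x : ℝ) : md (s ^ 2) x = (1 - Real.cos (s * x)) / s ^ 2 := by
  have h1 : s ^ 2 ≠ 0 := by positivity
  have h2 : 0 < s ^ 2 := by positivity
  simp only [md, h1, h2, if_true, if_false, Real.sqrt_sq hs.le]
lemma sn_neg_k {s : ℝ} (hs : 0 < s) (x : ℝ) : sn (-s ^ 2) x = Real.sinh (s * x) / s := by
  have h1 : -s ^ 2 ≠ 0 := by have : 0 < s^2 := by positivity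
                             linarith
  have h2 : ¬ (0 < -s ^ 2) := by have : 0 < s^2 := by positivity
                                 linarith
  simp only [sn, h1, h2, if_false, neg_neg, Real.sqrt_sq hs.le]
lemma cs_neg_k {s : ℝ} (hs : 0 < s) (x : ℝ) : cs (-s ^ 2) x = Real.cosh (s * x) := by
  have h1 : -s ^ 2 ≠ 0 := by have : 0 < s^2 := by positivity
                             linarith
  have h2 : ¬ (0 < -s ^ 2) := by have : 0 < s^2 := by positivity
                                 linarith
  simp only [cs, h1, h2, if_false, neg_neg, Real.sqrt_sq hs.le]
lemma md_neg_k {s : ℝ} (hs : 0 < s) (x : ℝ) :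
    md (-s ^ 2) x = (Real.cosh (s * x) - 1) / s ^ 2 := by
  have h1 : -s ^ 2 ≠ 0 := by have : 0 < s^2 := by positivity
                             linarith
  have h2 : ¬ (0 < -s ^ 2) := by have : 0 < s^2 := by positivity
                                 linarith
  simp only [md, h1, h2, if_false, neg_neg, Real.sqrt_sq hs.le]

variable (κ : ℝ)

lemma cs_eq (x : ℝ) : cs κ x = 1 - κ * md κ x := by
  rcases sgn_cases κ with rfl | ⟨s, hs, rfl⟩ | ⟨s, hs, rfl⟩
  · simp [cs]
  · rw [cs_pos_k hs, md_pos_k hs]; field_simp; ring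
  · rw [cs_neg_k hs, md_neg_k hs]; field_simp; ring

lemma cs_sq (x : ℝ) : cs κ x ^ 2 + κ * sn κ x ^ 2 = 1 := by
  rcases sgn_cases κ with rfl | ⟨s, hs, rfl⟩ | ⟨s, hs, rfl⟩
  · simp [cs]
  · rw [cs_pos_k hs, sn_pos_k hs]; field_simp; exact Real.cos_sq_add_sin_sq _
  · rw [cs_neg_k hs, sn_neg_k hs]; field_simp; rw [Real.cosh_sq]; ring

lemma sn_add (x y : ℝ) : sn κ (x + y) = sn κ x * cs κ y + cs κ x * sn κ y := by
  rcases sgn_cases κ with rfl | ⟨s, hs, rfl⟩ | ⟨s, hs, rfl⟩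
  · simp [cs, sn]
  · simp only [cs_pos_k hs, sn_pos_k hs]; rw [mul_add, Real.sin_add]; field_simp
  · simp only [cs_neg_k hs, sn_neg_k hs]; rw [mul_add, Real.sinh_add]; field_simp

lemma cs_add (x y : ℝ) : cs κ (x + y) = cs κ x * cs κ y - κ * (sn κ x * sn κ y) := by
  rcases sgn_cases κ with rfl | ⟨s, hs, rfl⟩ | ⟨s, hs, rfl⟩
  · simp [cs, sn]
  · simp only [cs_pos_k hs, sn_pos_k hs]; rw [mul_add, Real.cos_add]; field_simp
  · simp only [cs_neg_k hs, sn_neg_k hs]; rw [mul_add, Real.cosh_add]; field_simp; ring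

lemma md_add (x y : ℝ) : md κ (x + y) = md κ x * cs κ y + md κ y + sn κ x * sn κ y := by
  rcases sgn_cases κ with rfl | ⟨s, hs, rfl⟩ | ⟨s, hs, rfl⟩
  · simp only [cs_zero_k, sn_zero_k, md_zero_k]; ring
  · simp only [cs_pos_k hs, sn_pos_k hs, md_pos_k hs]; rw [mul_add, Real.cos_add]; field_simp; ring
  · simp only [cs_neg_k hs, sn_neg_k hs, md_neg_k hs]; rw [mul_add, Real.cosh_add]; field_simp; ring

lemma sn_neg (x : ℝ) : sn κ (-x) = - sn κ x := by
  rcases sgn_cases κ with rfl | ⟨s, hs, rfl⟩ | ⟨s, hs, rfl⟩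
  · simp [sn]
  · simp only [sn_pos_k hs, mul_neg, Real.sin_neg]; ring
  · simp only [sn_neg_k hs, mul_neg, Real.sinh_neg]; ring

lemma md_neg (x : ℝ) : md κ (-x) = md κ x := by
  rcases sgn_cases κ with rfl | ⟨s, hs, rfl⟩ | ⟨s, hs, rfl⟩
  · simp [md]
  · simp only [md_pos_k hs, mul_neg, Real.cos_neg]
  · simp only [md_neg_k hs, mul_neg, Real.cosh_neg]

lemma cs_neg (x : ℝ) : cs κ (-x) = cs κ x := by rw [cs_eq, md_neg, ← cs_eq]

@[simp] lemma sn_zero : sn κ 0 = 0 := by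
  have := sn_neg κ 0; simp at this; linarith
@[simp] lemma md_zero : md κ 0 = 0 := by
  rcases sgn_cases κ with rfl | ⟨s, hs, rfl⟩ | ⟨s, hs, rfl⟩
  · simp [md]
  · simp [md_pos_k hs]
  · simp [md_neg_k hs]
@[simp] lemma cs_zero : cs κ 0 = 1 := by rw [cs_eq]; simp

lemma sn_sub (x y : ℝ) : sn κ (x - y) = sn κ x * cs κ y - cs κ x * sn κ y := by
  rw [sub_eq_add_neg, sn_add, sn_neg, cs_neg]; ring
lemma cs_sub (x y : ℝ) : cs κ (x - y) = cs κ x * cs κ y + κ * (sn κ x * sn κ y) := by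
  rw [sub_eq_add_neg, cs_add, sn_neg, cs_neg]; ring
lemma md_sub (x y : ℝ) : md κ (x - y) = md κ x * cs κ y + md κ y - sn κ x * sn κ y := by
  rw [sub_eq_add_neg, md_add, sn_neg, cs_neg, md_neg]; ring

lemma md_sub_md_aux (u v : ℝ) : md κ (u + v) - md κ (u - v) = 2 * sn κ u * sn κ v := by
  rw [md_add, md_sub]; ring

lemma md_sub_md (x y : ℝ) : md κ x - md κ y = 2 * sn κ ((x + y) / 2) * sn κ ((x - y) / 2) := by
  have := md_sub_md_aux κ ((x + y) / 2) ((x - y) / 2)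
  rw [← this]; congr 2 <;> ring

lemma md_eq_sq (x : ℝ) : md κ x = 2 * sn κ (x / 2) ^ 2 := by
  have := md_sub_md κ x 0
  simp at this; rw [this]; ring

lemma md_nonneg (x : ℝ) : 0 ≤ md κ x := by rw [md_eq_sq]; positivity

lemma hasDerivAt_sn (x : ℝ) : HasDerivAt (sn κ) (cs κ x) x := by
  rcases sgn_cases κ with rfl | ⟨s, hs, rfl⟩ | ⟨s, hs, rfl⟩
  · have : sn 0 = fun x => x := funext sn_zero_k
    rw [this, cs_zero_k]; exact hasDerivAt_id x
  · have : sn (s^2) = fun x => Real.sin (s * x) / s := funext (sn_pos_k hs)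
    rw [this, cs_pos_k hs]
    have h := (((hasDerivAt_id x).const_mul s).sin).div_const s
    simp only [id] at h
    refine h.congr_deriv ?_
    field_simp
  · have : sn (-s^2) = fun x => Real.sinh (s * x) / s := funext (sn_neg_k hs)
    rw [this, cs_neg_k hs]
    have h := (((hasDerivAt_id x).const_mul s).sinh).div_const s
    simp only [id] at h
    refine h.congr_deriv ?_
    field_simp

lemma continuous_sn : Continuous (sn κ) :=
  continuous_iff_continuousAt.2 fun x => (hasDerivAt_sn κ x).continuousAt

lemma continuous_md : Continuous (md κ) := by
  have : md κ = fun x => 2 * sn κ (x / 2) ^ 2 := funext (md_eq_sq κ)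
  rw [this]
  have := continuous_sn κ
  fun_prop

lemma continuous_cs : Continuous (cs κ) := by
  have : cs κ = fun x => 1 - κ * md κ x := funext (cs_eq κ)
  rw [this]
  have := continuous_md κ
  fun_prop

variable {κ}

lemma sn_nonneg {x : ℝ} (hx : 0 ≤ x) (h : κ * x ^ 2 ≤ Real.pi ^ 2) : 0 ≤ sn κ x := by
  rcases sgn_cases κ with rfl | ⟨s, hs, rfl⟩ | ⟨s, hs, rfl⟩
  · simpa [sn]
  · rw [sn_pos_k hs]
    refine div_nonneg (Real.sin_nonneg_of_nonneg_of_le_pi (by positivity) ?_) hs.le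
    rw [← mul_pow] at h
    exact le_of_sq_le_sq h Real.pi_pos.le
  · rw [sn_neg_k hs]
    exact div_nonneg (Real.sinh_nonneg_iff.2 (by positivity)) hs.le

lemma sn_pos {x : ℝ} (hx : 0 < x) (h : κ * x ^ 2 < Real.pi ^ 2) : 0 < sn κ x := by
  rcases sgn_cases κ with rfl | ⟨s, hs, rfl⟩ | ⟨s, hs, rfl⟩
  · simpa [sn]
  · rw [sn_pos_k hs]
    refine div_pos (Real.sin_pos_of_pos_of_lt_pi (by positivity) ?_) hs
    rw [← mul_pow] at h
    exact lt_of_pow_lt_pow_left₀ 2 Real.pi_pos.le h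
  · rw [sn_neg_k hs]
    exact div_pos (Real.sinh_pos_iff.2 (by positivity)) hs

/-- triangle type monotonicity -/
lemma md_le_md {x y : ℝ} (hy : 0 ≤ y) (hxy : y ≤ x) (h : κ * (x + y) ^ 2 ≤ 4 * Real.pi ^ 2) :
    md κ y ≤ md κ x := by
  have h0 := md_sub_md κ x y
  have h1 : 0 ≤ sn κ ((x + y) / 2) := sn_nonneg (by linarith) (by nlinarith)
  have h2 : 0 ≤ sn κ ((x - y) / 2) := by
    refine sn_nonneg (by linarith) ?_
    rcases le_or_gt κ 0 with hk | hk
    · have : 0 ≤ Real.pi ^ 2 := by positivity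
      nlinarith [sq_nonneg ((x - y) / 2)]
    · have : ((x - y) / 2) ^ 2 ≤ ((x + y) / 2) ^ 2 := by nlinarith
      nlinarith
  have := mul_nonneg h1 h2
  linarith

lemma md_lt_md {x y : ℝ} (hy : 0 ≤ y) (hxy : y < x) (h : κ * (x + y) ^ 2 < 4 * Real.pi ^ 2) :
    md κ y < md κ x := by
  have h0 := md_sub_md κ x y
  have h1 : 0 < sn κ ((x + y) / 2) := sn_pos (by linarith) (by nlinarith)
  have h2 : 0 < sn κ ((x - y) / 2) := by
    refine sn_pos (by linarith) ?_
    rcases le_or_gt κ 0 with hk | hk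
    · have : 0 < Real.pi ^ 2 := by positivity
      nlinarith [sq_nonneg ((x - y) / 2)]
    · have : ((x - y) / 2) ^ 2 ≤ ((x + y) / 2) ^ 2 := by nlinarith
      nlinarith
  have := mul_pos h1 h2
  linarith

variable (κ) in
lemma cmpAngle_eq (a b c : ℝ) :
    cmpAngle κ a b c = Real.arccos ((md κ a * cs κ b + md κ b - md κ c) / (sn κ a * sn κ b)) := by
  unfold cmpAngle
  rcases sgn_cases κ with rfl | ⟨s, hs, rfl⟩ | ⟨s, hs, rfl⟩
  · simp only [if_true, cs_zero_k, sn_zero_k, md_zero_k]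
    congr 1
    rw [show a ^ 2 / 2 * 1 + b ^ 2 / 2 - c ^ 2 / 2 = (a^2+b^2-c^2)/2 by ring, div_div]
    congr 1; ring
  · have h1 : s ^ 2 ≠ 0 := by positivity
    have h2 : 0 < s ^ 2 := by positivity
    simp only [h1, h2, if_true, if_false, Real.sqrt_sq hs.le, cs_pos_k hs, sn_pos_k hs, md_pos_k hs]
    congr 1
    rw [show (1 - Real.cos (s * a)) / s ^ 2 * Real.cos (s * b) + (1 - Real.cos (s * b)) / s ^ 2 -
      (1 - Real.cos (s * c)) / s ^ 2 = (Real.cos (s * c) - Real.cos (s * a) * Real.cos (s * b)) /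
        s ^ 2 by field_simp; ring,
      show Real.sin (s * a) / s * (Real.sin (s * b) / s) =
        Real.sin (s * a) * Real.sin (s * b) / s ^ 2 by field_simp]
    rw [div_div_div_cancel_right₀ h1]
  · have h0 : s ^ 2 ≠ 0 := by positivity
    have h1 : -s ^ 2 ≠ 0 := neg_ne_zero.2 h0
    have h2 : ¬ (0 < -s ^ 2) := by have : 0 < s^2 := by positivity
                                   linarith
    simp only [h1, h2, if_false, neg_neg, Real.sqrt_sq hs.le, cs_neg_k hs, sn_neg_k hs, md_neg_k hs]
    congr 1
    rw [show (Real.cosh (s * a) - 1) / s ^ 2 * Real.cosh (s * b) + (Real.cosh (s * b) - 1) / s ^ 2 -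
      (Real.cosh (s * c) - 1) / s ^ 2 = (Real.cosh (s * a) * Real.cosh (s * b) - Real.cosh (s * c)) /
        s ^ 2 by field_simp; ring,
      show Real.sinh (s * a) / s * (Real.sinh (s * b) / s) =
        Real.sinh (s * a) * Real.sinh (s * b) / s ^ 2 by field_simp]
    rw [div_div_div_cancel_right₀ h0]

lemma sinh_le_mul_cosh {x : ℝ} (hx : 0 ≤ x) : Real.sinh x ≤ x * Real.cosh x := by
  have h : MonotoneOn (fun y => y * Real.cosh y - Real.sinh y) (Set.Ici 0) := by
    refine monotoneOn_of_deriv_nonneg (convex_Ici 0) (by fun_prop) (by fun_prop) ?_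
    intro y hy
    simp at hy
    have h1 : HasDerivAt (fun y => y * Real.cosh y - Real.sinh y)
        ((1 * Real.cosh y + y * Real.sinh y) - Real.cosh y) y :=
      ((hasDerivAt_id y).mul (Real.hasDerivAt_cosh y)).sub (Real.hasDerivAt_sinh y)
    rw [h1.deriv]
    have := Real.sinh_nonneg_iff.2 hy.le
    nlinarith
  have := h (Set.mem_Ici.2 le_rfl) (Set.mem_Ici.2 hx) hx
  simp at this; linarith

lemma cosh_le_one_add {x : ℝ} (h : x ^ 2 ≤ 1) : Real.cosh x ≤ 1 + x ^ 2 := by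
  have h1 := Real.cosh_le_exp_half_sq x
  have h2 := Real.abs_exp_sub_one_sub_id_le (x := x ^ 2 / 2) (by rw [abs_of_nonneg] <;> nlinarith [sq_nonneg x])
  have h3 := (abs_le.1 h2).2
  nlinarith [sq_nonneg x]

lemma sn_bounds {u ε : ℝ} (hu : 0 ≤ u) (h : |κ| * u ^ 2 ≤ ε) (hε : ε ≤ 1) :
    (1 - ε) * u ≤ sn κ u ∧ sn κ u ≤ (1 + ε) * u := by
  rcases sgn_cases κ with rfl | ⟨s, hs, rfl⟩ | ⟨s, hs, rfl⟩
  · simp at h; rw [sn_zero_k]; constructor <;> nlinarith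
  · rw [sn_pos_k hs, le_div_iff₀ hs, div_le_iff₀ hs]
    rw [abs_of_nonneg (by positivity), ← mul_pow] at h
    have hx : 0 ≤ s * u := by positivity
    generalize hxe : s * u = x at *
    have e1 : (1 - ε) * u * s = (1 - ε) * x := by rw [← hxe]; ring
    have e2 : (1 + ε) * u * s = (1 + ε) * x := by rw [← hxe]; ring
    rw [e1, e2]
    have h1 := Real.sin_le hx
    have hx1 : x ≤ 1 := by nlinarith
    constructor
    · rcases hx.eq_or_lt with h0 | h0
      · rw [← h0]; simp
      · have := Real.sin_gt_sub_cube h0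
        nlinarith [sq_nonneg x, mul_nonneg hx (sq_nonneg x)]
    · nlinarith [sq_nonneg x]
  · rw [sn_neg_k hs, le_div_iff₀ hs, div_le_iff₀ hs]
    rw [abs_neg, abs_of_nonneg (by positivity), ← mul_pow] at h
    have hx : 0 ≤ s * u := by positivity
    generalize hxe : s * u = x at *
    have e1 : (1 - ε) * u * s = (1 - ε) * x := by rw [← hxe]; ring
    have e2 : (1 + ε) * u * s = (1 + ε) * x := by rw [← hxe]; ring
    rw [e1, e2]
    have h1 := Real.self_le_sinh_iff.2 hx
    have h2 := sinh_le_mul_cosh hx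
    have h3 := cosh_le_one_add (x := x) (by linarith)
    constructor
    · nlinarith [sq_nonneg x]
    · nlinarith [sq_nonneg x]

lemma md_bounds {u ε : ℝ} (hu : 0 ≤ u) (h : |κ| * u ^ 2 ≤ ε) (hε : ε ≤ 1) :
    (1 - ε) * (u ^ 2 / 2) ≤ md κ u ∧ md κ u ≤ (1 + ε) * (u ^ 2 / 2) := by
  have h0 : 0 ≤ ε := le_trans (by positivity) h
  have := sn_bounds (κ := κ) (u := u / 2) (ε := ε / 4) (by linarith) (by nlinarith) (by linarith)
  rw [md_eq_sq]
  obtain ⟨h1, h2⟩ := this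
  have h3 : 0 ≤ (1 - ε/4) * (u / 2) := by
    apply mul_nonneg <;> linarith
  have h4 := pow_le_pow_left₀ h3 h1 2
  have h5 := pow_le_pow_left₀ (h3.trans h1) h2 2
  have h6 := sq_nonneg u
  constructor
  · nlinarith
  · have : (1 + ε / 4) ^ 2 ≤ 1 + ε := by nlinarith
    nlinarith

lemma cs_bounds {u ε : ℝ} (hu : 0 ≤ u) (h : |κ| * u ^ 2 ≤ ε) (hε : ε ≤ 1) :
    1 - ε ≤ cs κ u ∧ cs κ u ≤ 1 + ε := by
  obtain ⟨h1, h2⟩ := md_bounds hu h hε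
  have h0 : 0 ≤ ε := le_trans (by positivity) h
  have h3 := md_nonneg κ u
  rw [cs_eq]
  have h4 : md κ u ≤ u ^ 2 := by nlinarith [sq_nonneg u]
  have h5 : |κ * md κ u| ≤ ε := by
    rw [abs_mul, abs_of_nonneg h3]
    exact (mul_le_mul_of_nonneg_left h4 (abs_nonneg κ)).trans h
  have := abs_le.1 h5
  constructor <;> linarith

lemma md_sub_bounds {x y ε : ℝ} (hy : 0 ≤ y) (hyx : y ≤ x) (h : |κ| * x ^ 2 ≤ ε) (hε : ε ≤ 1) :
    (1 - 2 * ε) * ((x ^ 2 - y ^ 2) / 2) ≤ md κ x - md κ y ∧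
      md κ x - md κ y ≤ (1 + 3 * ε) * ((x ^ 2 - y ^ 2) / 2) := by
  have h0 : 0 ≤ ε := le_trans (by positivity) h
  have hk := abs_nonneg κ
  rw [md_sub_md]
  obtain ⟨a1, a2⟩ := sn_bounds (κ := κ) (u := (x + y) / 2) (ε := ε) (by linarith)
    (le_trans (mul_le_mul_of_nonneg_left (by nlinarith) hk) h) hε
  obtain ⟨b1, b2⟩ := sn_bounds (κ := κ) (u := (x - y) / 2) (ε := ε) (by linarith)
    (le_trans (mul_le_mul_of_nonneg_left (by nlinarith) hk) h) hε
  have ha : 0 ≤ (x + y) / 2 := by linarith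
  have hb : 0 ≤ (x - y) / 2 := by linarith
  have e : (x ^ 2 - y ^ 2) / 2 = 2 * ((x + y) / 2) * ((x - y) / 2) := by ring
  rw [e]
  generalize (x + y) / 2 = u at *
  generalize (x - y) / 2 = v at *
  have huv : 0 ≤ u * v := mul_nonneg ha hb
  have c1 : 0 ≤ (1 - ε) * u := mul_nonneg (by linarith) ha
  have c2 : 0 ≤ (1 - ε) * v := mul_nonneg (by linarith) hb
  have d1 := mul_le_mul a1 b1 c2 (c1.trans a1)
  have d2 := mul_le_mul a2 b2 (c2.trans b1) (mul_nonneg (by linarith) ha)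
  constructor
  · nlinarith [mul_nonneg h0 huv, mul_nonneg (mul_nonneg h0 h0) huv]
  · have : (1 + ε) * (1 + ε) ≤ 1 + 3 * ε := by nlinarith
    nlinarith

end Collapse

namespace Collapse

variable {κ : ℝ}

lemma md_mul (κ x : ℝ) : md κ x * (1 + cs κ x) = sn κ x ^ 2 := by
  have h1 : sn κ x = 2 * sn κ (x / 2) * cs κ (x / 2) := by
    have := sn_add κ (x / 2) (x / 2)
    rw [add_halves] at this; rw [this]; ring
  have h2 := cs_sq κ (x / 2)
  rw [h1, cs_eq, md_eq_sq]
  linear_combination (-4 * sn κ (x / 2) ^ 2) * h2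

section
variable {X : Type} [MetricSpace X]

lemma exists_btw {k : ℕ} (hX : IsAlexandrovSpace X k κ) (x y : X) {A : ℝ} (hA : 0 ≤ A)
    (hA' : A ≤ dist x y) : ∃ z, dist x z = A ∧ dist z y = dist x y - A := by
  have := hX.proper
  set L := dist x y with hL
  let S : Set (X × X) := {u | dist x u.1 + dist u.1 u.2 + dist u.2 y = L ∧ dist x u.1 ≤ A ∧
    dist u.2 y ≤ L - A}
  have hSc : IsClosed S := by
    simp only [S, Set.ofPred_and]
    refine (isClosed_eq ?_ ?_).inter ((isClosed_le ?_ ?_).inter (isClosed_le ?_ ?_)) <;> fun_prop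
  have hSK : S ⊆ closedBall x L ×ˢ closedBall y L := by
    rintro ⟨u, v⟩ ⟨h1, h2, h3⟩
    simp only [mem_prod, mem_closedBall] at *
    rw [dist_comm u x]
    constructor <;> linarith
  have hK : IsCompact S :=
    ((isCompact_closedBall x L).prod (isCompact_closedBall y L)).of_isClosed_subset hSc hSK
  have hne : S.Nonempty := ⟨(x, y), by simp [S, ← hL, hA, hA']⟩
  obtain ⟨⟨u, v⟩, ⟨h1, h2, h3⟩, hmin⟩ := hK.exists_isMinOn hne
    (f := fun u => dist u.1 u.2) (by fun_prop)
  simp only at h1 h2 h3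
  by_cases huv : u = v
  · subst huv
    simp at h1
    refine ⟨u, ?_, ?_⟩ <;> linarith
  · exfalso
    have hd : 0 < dist u v := dist_pos.2 huv
    obtain ⟨m, hm1, hm2⟩ := hX.midpoint u v
    have t1 := dist_triangle x u m
    have t2 := dist_triangle m v y
    have t3 := dist_triangle x m y
    by_cases hc : dist x m ≤ A
    · have : (m, v) ∈ S := by
        refine ⟨?_, hc, h3⟩
        simp only; linarith
      have := hmin this
      simp only [mem_ofPred_eq] at this
      linarith
    · have : (u, m) ∈ S := by
        push Not at hc
        refine ⟨?_, h2, ?_⟩ <;> simp only <;> linarith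
      have := hmin this
      simp only [mem_ofPred_eq] at this
      linarith

lemma add_nonneg_of_arccos {a b : ℝ} (ha : -1 ≤ a) (ha1 : a ≤ 1) (hb : -1 ≤ b) (hb1 : b ≤ 1)
    (h : Real.arccos a + Real.arccos b ≤ Real.pi) : 0 ≤ a + b := by
  have h1 : Real.arccos a ≤ Real.arccos (-b) := by rw [Real.arccos_neg]; linarith
  have h2 := Real.strictAntiOn_arccos.le_iff_ge (a := a) (b := -b) ⟨ha, ha1⟩ ⟨by linarith, by linarith⟩
  have := h2.1 h1
  linarith

/-- bounds for the cosine expression from triangle inequalities -/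
lemma cosexp_bounds {a b c : ℝ} (ha : 0 < a) (hb : 0 < b) (hc : 0 ≤ c) (h1 : c ≤ a + b)
    (h2 : a ≤ b + c) (h3 : b ≤ a + c) (hsa : 0 < sn κ a) (hsb : 0 < sn κ b)
    (hp : κ * (a + b + c) ^ 2 ≤ 4 * Real.pi ^ 2) :
    -1 ≤ (md κ a * cs κ b + md κ b - md κ c) / (sn κ a * sn κ b) ∧
    (md κ a * cs κ b + md κ b - md κ c) / (sn κ a * sn κ b) ≤ 1 := by
  have hs : 0 < sn κ a * sn κ b := mul_pos hsa hsb
  have m1 : md κ c ≤ md κ (a + b) := md_le_md hc h1 hp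
  have m2 : md κ (a - b) ≤ md κ c := by
    have key : md κ |a - b| ≤ md κ c := by
      refine md_le_md (abs_nonneg _) (abs_sub_le_iff.2 ⟨by linarith, by linarith⟩) ?_
      rcases le_or_gt κ 0 with hk | hk
      · have : 0 ≤ Real.pi ^ 2 := by positivity
        nlinarith [sq_nonneg (c + |a - b|)]
      · refine le_trans (mul_le_mul_of_nonneg_left ?_ hk.le) hp
        apply pow_le_pow_left₀ (by positivity)
        have : |a - b| ≤ a + b := abs_sub_le_iff.2 ⟨by linarith, by linarith⟩
        linarith
    rcases abs_cases (a - b) with ⟨h, _⟩ | ⟨h, _⟩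
    · rwa [h] at key
    · rwa [h, md_neg] at key
  rw [md_add] at m1
  rw [md_sub] at m2
  rw [le_div_iff₀ hs, div_le_iff₀ hs]
  constructor <;> linarith

lemma LF (hX : CurvGE X κ) {x y z o : X} {A B : ℝ} (hA : dist x z = A)
    (hB : dist z y = B) (hAB : dist x y = A + B)
    (kA : κ * A ^ 2 < Real.pi ^ 2) (kB : κ * B ^ 2 < Real.pi ^ 2)
    (kY : κ * (dist z o) ^ 2 < Real.pi ^ 2)
    (p1 : κ * (A + dist z o + dist x o) ^ 2 ≤ 4 * Real.pi ^ 2)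
    (p2 : κ * (B + dist z o + dist y o) ^ 2 ≤ 4 * Real.pi ^ 2) :
    sn κ B * md κ (dist x o) + sn κ A * md κ (dist y o) ≤
      md κ (dist z o) * sn κ (A + B) + sn κ B * md κ A + sn κ A * md κ B := by
  have hA0 : 0 ≤ A := hA ▸ dist_nonneg
  have hB0 : 0 ≤ B := hB ▸ dist_nonneg
  rcases hA0.eq_or_lt with h | hAp
  · subst h
    have : x = z := dist_eq_zero.1 hA
    subst this
    simp; linarith
  rcases hB0.eq_or_lt with h | hBp
  · subst h
    have : z = y := dist_eq_zero.1 hB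
    subst this
    simp; linarith
  have sA := sn_pos hAp kA
  have sB := sn_pos hBp kB
  rcases (dist_nonneg (x := z) (y := o)).eq_or_lt with h | hY
  · have : z = o := dist_eq_zero.1 h.symm
    subst this
    rw [dist_self, hA, dist_comm y z, hB]; simp
  have sY := sn_pos hY kY
  have hq := hX z x o y (by rintro rfl; simp at hA; linarith) (by rintro rfl; simp at hY)
    (by rintro rfl; simp at hB; linarith)
  rw [dist_comm z x, hA, hB, dist_comm y x, hAB] at hq
  have hpi : cmpAngle κ B A (A + B) = Real.pi := by
    rw [cmpAngle_eq, add_comm A B, md_add, show (md κ B * cs κ A + md κ A -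
      (md κ B * cs κ A + md κ A + sn κ B * sn κ A)) / (sn κ B * sn κ A) = -1 by
      field_simp; ring, Real.arccos_neg_one]
  rw [hpi, cmpAngle_eq, cmpAngle_eq] at hq
  have t1 := dist_triangle x z o
  have t2 := dist_triangle z x o
  have t3 := dist_triangle x o z
  have t4 := dist_triangle z y o
  have t5 := dist_triangle y z o
  have t6 := dist_triangle y o z
  rw [dist_comm z x] at t2
  rw [dist_comm o z] at t3 t6
  rw [dist_comm y z] at t5 t6
  have c1 := cosexp_bounds (κ := κ) (a := A) (b := dist z o) (c := dist x o) hAp hY dist_nonneg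
    (by linarith) (by linarith) (by linarith) sA sY p1
  have c2 := cosexp_bounds (κ := κ) (a := dist z o) (b := B) (c := dist o y) hY hBp dist_nonneg
    (by rw [dist_comm o y]; linarith) (by rw [dist_comm o y]; linarith)
    (by rw [dist_comm o y]; linarith) sY sB
    (by rw [dist_comm o y, add_comm (dist z o) B]; exact p2)
  have key := add_nonneg_of_arccos c1.1 c1.2 c2.1 c2.2 (by linarith)
  rw [div_add_div _ _ (by positivity) (by positivity)] at key
  have key2 := mul_nonneg key (by positivity : 0 ≤ (sn κ A * sn κ (dist z o) * (sn κ (dist z o) * sn κ B)))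
  rw [div_mul_cancel₀ _ (by positivity)] at key2
  have key3 : 0 ≤ sn κ (dist z o) * (sn κ B * (md κ A * cs κ (dist z o) + md κ (dist z o) - md κ (dist x o)) +
    sn κ A * (md κ (dist z o) * cs κ B + md κ B - md κ (dist o y))) := by
      nlinarith
  have key4 := nonneg_of_mul_nonneg_right key3 sY
  rw [sn_add, cs_eq κ A, cs_eq κ B]
  rw [cs_eq κ (dist z o), cs_eq κ B, dist_comm o y] at key4
  nlinarith

/-- The inner product of directions. -/
def Q (κ : ℝ) (y a b : X) : ℝ :=
  md κ (dist y a) + md κ (dist y b) - κ * md κ (dist y a) * md κ (dist y b) - md κ (dist a b)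

lemma Q_symm (y a b : X) : Q κ y a b = Q κ y b a := by
  unfold Q; rw [dist_comm a b]; ring

lemma shrink' (hX : CurvGE X κ) {x y z o : X} {A B : ℝ} (hA : dist x z = A)
    (hB : dist z y = B) (hAB : dist x y = A + B)
    (kA : κ * A ^ 2 < Real.pi ^ 2) (kB : κ * B ^ 2 < Real.pi ^ 2)
    (kY : κ * (dist z o) ^ 2 < Real.pi ^ 2)
    (p1 : κ * (A + dist z o + dist x o) ^ 2 ≤ 4 * Real.pi ^ 2)
    (p2 : κ * (B + dist z o + dist y o) ^ 2 ≤ 4 * Real.pi ^ 2) :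
    sn κ (A + B) * Q κ x z o ≤ sn κ A * Q κ x y o := by
  have h := LF hX hA hB hAB kA kB kY p1 p2
  unfold Q
  rw [hA, hAB]
  have e1 := md_mul κ A
  have e2 := sn_sub κ (A + B) A
  rw [add_sub_cancel_left, cs_eq κ A, cs_eq κ (A + B)] at e2
  have e3 := md_add κ A B
  have e4 := sn_add κ A B
  rw [cs_eq κ A] at e1
  have e5 : sn κ (A + B) * md κ A + sn κ B * md κ A + sn κ A * md κ B = sn κ A * md κ (A + B) := by
    rw [e3, e4, cs_eq κ A]; linear_combination (sn κ B) * e1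
  have e6 : sn κ (A + B) * (κ * md κ A) * md κ (dist x o) =
    (sn κ (A+B) - sn κ B - (1 - κ * md κ (A + B)) * sn κ A) * md κ (dist x o) := by
    rw [e2]; ring
  nlinarith

variable {r : ℝ}

lemma loc_k {u : ℝ} (hr : |κ| * r ^ 2 ≤ 1 / 100) (h0 : 0 ≤ u) (hu : u ≤ 9 * r) :
    κ * u ^ 2 < Real.pi ^ 2 := by
  have h3 := Real.pi_gt_three
  have : |κ| * u ^ 2 ≤ |κ| * (9 * r) ^ 2 :=
    mul_le_mul_of_nonneg_left (pow_le_pow_left₀ h0 hu 2) (abs_nonneg κ)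
  have h2 : κ * u ^ 2 ≤ |κ| * u ^ 2 := mul_le_mul_of_nonneg_right (le_abs_self κ) (sq_nonneg u)
  nlinarith

lemma loc_e {u : ℝ} (hr : |κ| * r ^ 2 ≤ 1 / 100) (h0 : 0 ≤ u) (hu : u ≤ r) :
    |κ| * u ^ 2 ≤ 1 / 100 :=
  (mul_le_mul_of_nonneg_left (pow_le_pow_left₀ h0 hu 2) (abs_nonneg κ)).trans hr

lemma sn_loc {u : ℝ} (hr : |κ| * r ^ 2 ≤ 1 / 100) (h0 : 0 ≤ u) (hu : u ≤ r) :
    99 / 100 * u ≤ sn κ u ∧ sn κ u ≤ 101 / 100 * u := by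
  have := sn_bounds (κ := κ) h0 (loc_e hr h0 hu) (by norm_num)
  constructor <;> linarith

lemma md_loc {u : ℝ} (hr : |κ| * r ^ 2 ≤ 1 / 100) (h0 : 0 ≤ u) (hu : u ≤ r) :
    99 / 100 * (u ^ 2 / 2) ≤ md κ u ∧ md κ u ≤ 101 / 100 * (u ^ 2 / 2) := by
  have := md_bounds (κ := κ) h0 (loc_e hr h0 hu) (by norm_num)
  constructor <;> linarith

lemma cs_loc {u : ℝ} (hr : |κ| * r ^ 2 ≤ 1 / 100) (h0 : 0 ≤ u) (hu : u ≤ r) :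
    99 / 100 ≤ cs κ u ∧ cs κ u ≤ 101 / 100 := by
  have := cs_bounds (κ := κ) h0 (loc_e hr h0 hu) (by norm_num)
  constructor <;> linarith

/-- local shrink -/
lemma shrink (hX : CurvGE X κ) (hr : |κ| * r ^ 2 ≤ 1 / 100) {x y z o : X} {A : ℝ}
    (hA : dist x z = A) (hB : dist z y = dist x y - A)
    (h1 : dist x y ≤ r) (h2 : dist x o ≤ r) :
    sn κ (dist x y) * Q κ x z o ≤ sn κ A * Q κ x y o := by
  have a0 : 0 ≤ A := hA ▸ dist_nonneg
  have b0 : 0 ≤ dist x y - A := hB ▸ dist_nonneg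
  have t := dist_triangle_left z o x
  have t' := dist_triangle_left y o x
  have := dist_nonneg (x := z) (y := o)
  have := dist_nonneg (x := x) (y := o)
  have := dist_nonneg (x := y) (y := o)
  have h := shrink' hX (x := x) (y := y) (z := z) (o := o) (A := A) (B := dist x y - A) hA hB
    (by ring) (loc_k hr a0 (by linarith)) (loc_k hr b0 (by linarith))
    (loc_k hr dist_nonneg (by linarith)) ?_ ?_
  · rwa [add_sub_cancel] at h
  · have := (loc_k (κ := κ) (u := (A + dist z o + dist x o) / 2) hr (by positivity) (by linarith)).le
    nlinarith
  · have := (loc_k (κ := κ) (u := (dist x y - A + dist z o + dist y o) / 2) hr (by positivity) (by linarith)).le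
    nlinarith

/-- STEP -/
lemma step_loc (hX : CurvGE X κ) (hr : |κ| * r ^ 2 ≤ 1 / 100) {x y z o : X} {A : ℝ}
    (hA : dist x z = A) (hB : dist z y = dist x y - A)
    (h1 : dist x y ≤ r) (h2 : dist x o ≤ r) (h0 : 0 < dist x y) :
    md κ (dist x o) - sn κ A / sn κ (dist x y) * Q κ x y o ≤ md κ (dist z o) := by
  have h := shrink hX hr hA hB h1 h2
  have hs : 0 < sn κ (dist x y) := by
    have := (sn_loc (κ := κ) hr h0.le h1).1
    linarith
  have h' : Q κ x z o ≤ sn κ A / sn κ (dist x y) * Q κ x y o := by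
    rw [div_mul_eq_mul_div, le_div_iff₀ hs]; linarith
  have hc := (cs_loc (κ := κ) hr (dist_nonneg (x := x) (y := o)) h2).1
  rw [cs_eq] at hc
  have hQ : Q κ x z o = md κ A + md κ (dist x o) - κ * md κ A * md κ (dist x o) - md κ (dist z o) := by
    rw [Q, hA]
  have := md_nonneg κ A
  nlinarith

lemma md_abs (x : ℝ) : md κ |x| = md κ x := by
  rcases abs_cases x with ⟨h, _⟩ | ⟨h, _⟩ <;> rw [h]
  exact md_neg κ x

set_option maxHeartbeats 1000000 in
/-- contraction -/
lemma contr (hX : CurvGE X κ) (hr : |κ| * r ^ 2 ≤ 1 / 100) {y a b a' b' : X} {l : ℝ}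
    (hl0 : 0 ≤ l) (hl1 : l ≤ 1)
    (ha : dist y a' = l * dist y a) (ha' : dist a' a = dist y a - l * dist y a)
    (hb : dist y b' = l * dist y b) (hb' : dist b' b = dist y b - l * dist y b)
    (h1 : dist y a ≤ r) (h2 : dist y b ≤ r) (h3 : dist a b ≤ r) :
    l / 2 * dist a b ≤ dist a' b' := by
  rcases (dist_nonneg (x := y) (y := a)).eq_or_lt with h | hap
  · have e1 : y = a := dist_eq_zero.1 h.symm
    subst e1
    have e2 : y = a' := by rw [dist_self, mul_zero] at ha; exact dist_eq_zero.1 ha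
    subst e2
    rw [hb]; nlinarith [dist_nonneg (x := y) (y := b)]
  rcases (dist_nonneg (x := y) (y := b)).eq_or_lt with h | hbp
  · have e1 : y = b := dist_eq_zero.1 h.symm
    subst e1
    have e2 : y = b' := by rw [dist_self, mul_zero] at hb; exact dist_eq_zero.1 hb
    subst e2
    rw [dist_comm a' y, ha, dist_comm a y]; nlinarith [dist_nonneg (x := y) (y := a)]
  have la : l * dist y a ≤ dist y a := by nlinarith
  have lb : l * dist y b ≤ dist y b := by nlinarith
  have la0 : 0 ≤ l * dist y a := by positivity
  have lb0 : 0 ≤ l * dist y b := by positivity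
  have s1 := shrink hX hr ha ha' h1 h2
  have s2 := shrink hX hr hb hb' h2 (o := a') (by rw [ha]; linarith)
  rw [Q_symm y b' a', Q_symm y b a'] at s2
  obtain ⟨sa1, sa2⟩ := sn_loc (κ := κ) hr hap.le h1
  obtain ⟨sb1, sb2⟩ := sn_loc (κ := κ) hr hbp.le h2
  obtain ⟨la1, la2⟩ := sn_loc (κ := κ) hr la0 (by linarith)
  obtain ⟨lb1, lb2⟩ := sn_loc (κ := κ) hr lb0 (by linarith)
  have e1 : md κ (dist a' b') = md κ (l * dist y a - l * dist y b) +
      (sn κ (l * dist y a) * sn κ (l * dist y b) - Q κ y a' b') := by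
    rw [md_sub, Q, ha, hb, cs_eq]; ring
  have e2 : md κ (dist a b) = md κ (dist y a - dist y b) +
      (sn κ (dist y a) * sn κ (dist y b) - Q κ y a b) := by
    rw [md_sub, Q, cs_eq]; ring
  -- the key product inequality
  have key : sn κ (dist y a) * sn κ (dist y b) * Q κ y a' b' ≤
      sn κ (l * dist y a) * sn κ (l * dist y b) * Q κ y a b := by
    calc _ = sn κ (dist y a) * (sn κ (dist y b) * Q κ y a' b') := by ring
      _ ≤ sn κ (dist y a) * (sn κ (l * dist y b) * Q κ y a' b) :=
        mul_le_mul_of_nonneg_left s2 (by linarith)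
      _ = sn κ (l * dist y b) * (sn κ (dist y a) * Q κ y a' b) := by ring
      _ ≤ sn κ (l * dist y b) * (sn κ (l * dist y a) * Q κ y a b) :=
        mul_le_mul_of_nonneg_left s1 (by linarith)
      _ = _ := by ring
  have hd1 : |dist y a - dist y b| ≤ dist a b := by
    rw [dist_comm y a, dist_comm y b]; exact abs_dist_sub_le a b y
  have hd0 := abs_nonneg (dist y a - dist y b)
  have hm := (md_sub_bounds (κ := κ) hd0 hd1 (loc_e hr dist_nonneg h3) (by norm_num)).1
  rw [md_abs] at hm
  have hG : 0 ≤ sn κ (dist y a) * sn κ (dist y b) - Q κ y a b := by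
    have : |dist y a - dist y b| ^ 2 ≤ dist a b ^ 2 := pow_le_pow_left₀ hd0 hd1 2
    nlinarith
  have sab : 0 < sn κ (dist y a) * sn κ (dist y b) := mul_pos (by linarith) (by linarith)
  -- ratio
  have hrat : (98 / 100 * l) ^ 2 * (sn κ (dist y a) * sn κ (dist y b)) ≤
      sn κ (l * dist y a) * sn κ (l * dist y b) := by
    have q1 : 98 / 100 * l * sn κ (dist y a) ≤ sn κ (l * dist y a) := by
      have := mul_le_mul_of_nonneg_left sa2 hl0
      linarith
    have q2 : 98 / 100 * l * sn κ (dist y b) ≤ sn κ (l * dist y b) := by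
      have := mul_le_mul_of_nonneg_left sb2 hl0
      linarith
    have p1 : 0 ≤ 98 / 100 * l * sn κ (dist y b) := mul_nonneg (by positivity) (by linarith)
    have := mul_le_mul q1 q2 p1 (by linarith)
    calc _ = 98 / 100 * l * sn κ (dist y a) * (98 / 100 * l * sn κ (dist y b)) := by ring
      _ ≤ _ := this
  have hF : (98 / 100 * l) ^ 2 * (sn κ (dist y a) * sn κ (dist y b) - Q κ y a b) ≤
      sn κ (l * dist y a) * sn κ (l * dist y b) - Q κ y a' b' := by
    have : (sn κ (dist y a) * sn κ (dist y b)) * ((98 / 100 * l) ^ 2 *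
      (sn κ (dist y a) * sn κ (dist y b) - Q κ y a b)) ≤ (sn κ (dist y a) * sn κ (dist y b)) *
      (sn κ (l * dist y a) * sn κ (l * dist y b) - Q κ y a' b') := by
      have g := mul_le_mul_of_nonneg_right hrat hG
      linarith
    exact le_of_mul_le_mul_left this sab
  have hab' : dist a' b' ≤ 2 * r := by
    have := dist_triangle_left a' b' y
    linarith
  have m1 := md_bounds (κ := κ) (u := dist a' b') (ε := 4/100) dist_nonneg
    (by have := loc_e (κ := κ) (u := dist a' b' / 2) hr (by positivity) (by linarith)
        nlinarith) (by norm_num)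
  have m2 := md_loc (κ := κ) hr (dist_nonneg (x := a) (y := b)) h3
  have m3 : 98 / 100 * l ^ 2 * md κ (dist y a - dist y b) ≤ md κ (l * dist y a - l * dist y b) := by
    rw [← mul_sub, ← md_abs, ← md_abs (κ := κ) (l * _), abs_mul, abs_of_nonneg hl0]
    have g1 := md_loc (κ := κ) (u := |dist y a - dist y b|) hr hd0 (by linarith)
    have g2 := md_loc (κ := κ) (u := l * |dist y a - dist y b|) hr (by positivity) (by nlinarith)
    have g3 := mul_le_mul_of_nonneg_left g1.2 (sq_nonneg l)
    have g4 : 0 ≤ l ^ 2 * |dist y a - dist y b| ^ 2 := by positivity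
    have g5 := g2.1
    rw [mul_pow] at g5
    linarith
  have fin : (l / 2 * dist a b) ^ 2 ≤ dist a' b' ^ 2 := by
    have hl2 := sq_nonneg l
    have hm0 := md_nonneg κ (dist y a - dist y b)
    have f0 : (98 / 100 * l) ^ 2 * md κ (dist y a - dist y b) ≤ 98 / 100 * l ^ 2 * md κ (dist y a - dist y b) := by
      apply mul_le_mul_of_nonneg_right _ hm0; nlinarith
    have f1 : (98 / 100 * l) ^ 2 * md κ (dist a b) ≤ md κ (dist a' b') := by
      rw [e1, e2, mul_add]; linarith
    have f2 : (98/100 * l)^2 * (99 / 100 * (dist a b ^ 2 / 2)) ≤ (98 / 100 * l) ^ 2 * md κ (dist a b) :=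
      mul_le_mul_of_nonneg_left m2.1 (sq_nonneg _)
    have f3 := mul_nonneg hl2 (sq_nonneg (dist a b))
    have f4 := m1.2
    have f5 := sq_nonneg (dist a' b')
    calc _ = 1 / 4 * (l ^ 2 * dist a b ^ 2) := by ring
      _ ≤ _ := by linarith
  exact le_of_sq_le_sq fin dist_nonneg

/-- midpoint concavity of `md ∘ dist` -/
lemma md_mid (hX : CurvGE X κ) (hr : |κ| * r ^ 2 ≤ 1 / 100) {x y m o : X}
    (h1 : dist x m = dist x y / 2) (h2 : dist m y = dist x y / 2)
    (hx : dist x o ≤ r) (hy : dist y o ≤ r) (hm : dist m o ≤ r) :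
    (md κ (dist x o) + md κ (dist y o)) / 2 - md κ (dist x y / 2) * cs κ (dist m o) ≤
      md κ (dist m o) := by
  have hd : dist x y ≤ 2 * r := by
    have := dist_triangle_right x y o; linarith
  have hd0 := dist_nonneg (x := x) (y := y)
  rcases hd0.eq_or_lt with h | hp
  · have : x = y := dist_eq_zero.1 h.symm
    subst this
    have : x = m := by rw [dist_self] at h1; simpa using h1
    subst this
    simp
  have := dist_nonneg (x := x) (y := o)
  have := dist_nonneg (x := y) (y := o)
  have := dist_nonneg (x := m) (y := o)
  have h := LF hX (x := x) (y := y) (z := m) (o := o) h1 h2 (by ring)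
    (loc_k hr (by positivity) (by linarith)) (loc_k hr (by positivity) (by linarith))
    (loc_k hr dist_nonneg (by linarith))
    (by have := (loc_k (κ := κ) (u := (dist x y / 2 + dist m o + dist x o) / 2) hr (by positivity) (by linarith)).le
        nlinarith)
    (by have := (loc_k (κ := κ) (u := (dist x y / 2 + dist m o + dist y o) / 2) hr (by positivity) (by linarith)).le
        nlinarith)
  have hs : 0 < sn κ (dist x y / 2) := by
    have := (sn_loc (κ := κ) (u := dist x y / 2) hr (by positivity) (by linarith)).1
    linarith
  rw [sn_add] at h
  rw [cs_eq] at h ⊢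
  have : sn κ (dist x y / 2) * (md κ (dist x o) + md κ (dist y o)) ≤
    sn κ (dist x y / 2) * (2 * md κ (dist m o) * (1 - κ * md κ (dist x y / 2)) + 2 * md κ (dist x y / 2)) := by
    linarith
  have := le_of_mul_le_mul_left this hs
  linarith

lemma md_mid' (hX : CurvGE X κ) (hr : |κ| * r ^ 2 ≤ 1 / 100) {x y m o : X}
    (h1 : dist x m = dist x y / 2) (h2 : dist m y = dist x y / 2)
    (hx : dist x o ≤ r) (hy : dist y o ≤ r) (hm : dist m o ≤ r) :
    (md κ (dist x o) + md κ (dist y o)) / 2 - dist x y ^ 2 / 4 ≤ md κ (dist m o) := by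
  have h := md_mid hX hr h1 h2 hx hy hm
  have hd : dist x y ≤ 2 * r := by
    have := dist_triangle_right x y o; linarith
  have a := (md_loc (κ := κ) (u := dist x y / 2) hr (by positivity) (by linarith)).2
  have b := (cs_loc (κ := κ) hr (dist_nonneg (x := m) (y := o)) hm).2
  have c := md_nonneg κ (dist x y / 2)
  nlinarith [sq_nonneg (dist x y)]

end
end Collapse

namespace Collapse

variable {κ : ℝ} {X : Type} [MetricSpace X]

/-- antilipschitz on a set controls dimension -/
lemma le_dimH_image_of_anti {Y : Type} [MetricSpace Y] {S : Set X} {g : X → Y} {c : ℝ} (hc : 0 < c)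
    (h : ∀ a ∈ S, ∀ b ∈ S, c * dist a b ≤ dist (g a) (g b)) : dimH S ≤ dimH (g '' S) := by
  have hinj : InjOn g S := by
    intro a ha b hb hab
    have := h a ha b hb
    rw [hab, dist_self] at this
    have h2 : dist a b ≤ 0 := by nlinarith [dist_nonneg (x := a) (y := b)]
    exact dist_le_zero.1 h2
  rcases S.eq_empty_or_nonempty with rfl | hne
  · simp
  have : Nonempty X := ⟨hne.some⟩
  have hL : LipschitzOnWith (Real.toNNReal (1 / c)) (Function.invFunOn g S) (g '' S) := by
    refine LipschitzOnWith.of_dist_le_mul ?_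
    rintro _ ⟨a, ha, rfl⟩ _ ⟨b, hb, rfl⟩
    rw [hinj.leftInvOn_invFunOn ha, hinj.leftInvOn_invFunOn hb, Real.coe_toNNReal _ (by positivity)]
    rw [div_mul_eq_mul_div, one_mul, le_div_iff₀ hc]
    have := h a ha b hb
    linarith
  have := hL.dimH_image_le
  rwa [hinj.invFunOn_image subset_rfl] at this

lemma dim_transport {k : ℕ} (hX : IsAlexandrovSpace X k κ) {r : ℝ}
    (hr : |κ| * r ^ 2 ≤ 1 / 100) {x0 y : X} {s : ℝ} (hs : dist y x0 + s ≤ r) (hs2 : 2 * s ≤ r)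
    {d : ENNReal} (hd : d ≤ dimH (ball x0 s)) (ε : ℝ) (hε : 0 < ε) :
    d ≤ dimH (ball y ε) := by
  rcases le_or_gt s 0 with h0 | h0
  · rw [ball_eq_empty.2 h0] at hd
    simp at hd; simp [hd]
  have hr0 : 0 < r := by linarith
  set l := min 1 (ε / (2 * r)) with hl
  have hl0 : 0 < l := by positivity
  have hl1 : l ≤ 1 := min_le_left _ _
  have hl2 : l * (2 * r) ≤ ε := by
    have : l ≤ ε / (2 * r) := min_le_right _ _
    rwa [le_div_iff₀ (by positivity)] at this
  have hg : ∀ a, ∃ z, dist y z = l * dist y a ∧ dist z a = dist y a - l * dist y a := fun a =>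
    exists_btw hX y a (by positivity) (by nlinarith [dist_nonneg (x := y) (y := a)])
  choose g hg1 hg2 using hg
  have hya : ∀ a ∈ ball x0 s, dist y a ≤ r := by
    intro a ha
    have := dist_triangle y x0 a
    rw [mem_ball, dist_comm] at ha
    linarith
  refine hd.trans ((le_dimH_image_of_anti (g := g) (c := l / 2) (by positivity) ?_).trans
    (dimH_mono ?_))
  · intro a ha b hb
    refine contr hX.curv hr hl0.le hl1 (hg1 a) (hg2 a) (hg1 b) (hg2 b) (hya a ha) (hya b hb) ?_
    have := dist_triangle_right a b x0
    rw [mem_ball] at ha hb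
    linarith
  · rintro _ ⟨a, ha, rfl⟩
    rw [mem_ball, dist_comm, hg1]
    have := hya a ha
    nlinarith

lemma exists_loc (κ : ℝ) : ∃ r : ℝ, 0 < r ∧ |κ| * r ^ 2 ≤ 1 / 100 := by
  refine ⟨1 / (10 * (1 + |κ|)), by positivity, ?_⟩
  have h := abs_nonneg κ
  rw [div_pow, one_pow, mul_pow, mul_one_div, div_le_div_iff₀ (by positivity) (by norm_num)]
  nlinarith

lemma dim_ball [CompactSpace X] {k : ℕ} (hX : IsAlexandrovSpace X k κ) (y : X) (ε : ℝ)
    (hε : 0 < ε) : (k : ENNReal) ≤ dimH (ball y ε) := by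
  obtain ⟨r, hr0, hr⟩ := exists_loc κ
  obtain ⟨T, hT⟩ := isCompact_univ.elim_finite_subcover (fun x : X => ball x (r / 2))
    (fun _ => isOpen_ball) (fun x _ => mem_iUnion.2 ⟨x, mem_ball_self (by positivity)⟩)
  have h1 : (k : ENNReal) ≤ ⨆ x ∈ T, dimH (ball x (r / 2)) := by
    rw [← hX.dim]
    have := dimH_bUnion (X := X) (s := (T : Set X)) T.countable_toSet (fun x : X => ball x (r / 2))
    refine (dimH_mono hT).trans ?_
    have e := this.le
    simpa only [Finset.mem_coe] using e
  have h2 : ∃ x0 : X, (k : ENNReal) ≤ dimH (ball x0 (r / 2)) := by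
    by_contra hcon
    push Not at hcon
    rcases T.eq_empty_or_nonempty with h | h
    · subst h
      simp at hT
      exact hT.false y
    · obtain ⟨x, hx, hx2⟩ := T.exists_mem_eq_sup' h (fun x : X => dimH (ball x (r / 2)))
      have : (⨆ x ∈ T, dimH (ball x (r / 2))) = dimH (ball x (r / 2)) := by
        rw [← hx2, Finset.sup'_eq_sup, Finset.sup_eq_iSup]
      rw [this] at h1
      exact absurd h1 (not_le.2 (hcon x))
  obtain ⟨x0, hx0⟩ := h2
  have h3 : ∀ N : ℕ, ∀ y : X, dist x0 y ≤ N * (r / 2) → ∀ ε > 0, (k : ENNReal) ≤ dimH (ball y ε) := by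
    intro N
    induction N with
    | zero =>
      intro y hy ε hε
      have : x0 = y := by simpa using hy
      subst this
      exact dim_transport hX hr (x0 := x0) (s := r / 2) (by simp; linarith) (by linarith) hx0 ε hε
    | succ N ih =>
      intro y hy ε hε
      by_cases hc : dist x0 y ≤ N * (r / 2)
      · exact ih y hc ε hε
      · push Not at hc
        obtain ⟨z, hz1, hz2⟩ := exists_btw hX x0 y (A := N * (r / 2)) (by positivity) hc.le
        push_cast at hy
        have h4 := ih z hz1.le (r / 2) (by positivity)
        refine dim_transport hX hr (x0 := z) (s := r / 2) ?_ (by linarith) h4 ε hε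
        rw [dist_comm y z, hz2]; linarith
  obtain ⟨N, hN⟩ := exists_nat_gt (dist x0 y / (r / 2))
  rw [div_lt_iff₀ (by positivity)] at hN
  exact h3 N y hN.le ε hε

/-- sequences of nested choices: the Cantor map is separating -/
lemma cantor_map {k : ℕ} (hX : IsAlexandrovSpace X k κ) {r : ℝ} (hr : |κ| * r ^ 2 ≤ 1 / 100)
    {y : X} {ρ ε : ℝ} (hρ : 0 < ρ) (hρr : 3 * ρ ≤ r) (hε : 0 < ε) (hε1 : ε ≤ 1) {N : ℕ}
    (z : Fin N → X) (hz : ∀ i, dist y (z i) ≤ ρ) (hsep : ∀ i j, i ≠ j → ε * ρ ≤ dist (z i) (z j)) :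
    ∃ π : (ℕ → Fin N) → X, ∀ u v n, (∀ i < n, u i = v i) → u n ≠ v n →
      (ε / 32) ^ n * (ρ * ε / 4) ≤ dist (π u) (π v) := by
  have hpX := hX.proper
  set l := ε / 32 with hl
  have hl0 : 0 < l := by positivity
  have hl1 : l ≤ 1 / 32 := by rw [hl]; linarith
  have hln : ∀ n, l ^ n ≤ 1 := fun n => pow_le_one₀ hl0.le (by linarith)
  have hg : ∀ (n : ℕ) (c a : X), ∃ w, dist c w = l ^ n * dist c a ∧
      dist w a = dist c a - l ^ n * dist c a := fun n c a =>
    exists_btw hX c a (by positivity) (by nlinarith [dist_nonneg (x := c) (y := a), hln n])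
  choose g hg1 hg2 using hg
  let C : (ℕ → Fin N) → ℕ → X := fun u n => Nat.rec y (fun n c => g n c (z (u n))) n
  have C0 : ∀ u, C u 0 = y := fun u => rfl
  have CS : ∀ u n, C u (n + 1) = g n (C u n) (z (u n)) := fun u n => rfl
  have hD : ∀ u n, dist y (C u n) ≤ 2 * ρ * (1 - (1 / 2) ^ n) := by
    intro u n
    induction n with
    | zero => simp [C0]
    | succ n ih =>
      have t1 := dist_triangle y (C u n) (C u (n + 1))
      have t2 := dist_triangle_left (C u n) (z (u n)) y
      have e : dist (C u n) (C u (n + 1)) = l ^ n * dist (C u n) (z (u n)) := by rw [CS, hg1]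
      have hz' := hz (u n)
      have hq : l ^ n ≤ ((1 / 2 : ℝ) ^ n) ^ 3 := by
        rw [← pow_mul, mul_comm n 3, pow_mul]
        exact pow_le_pow_left₀ hl0.le (by norm_num; linarith) n
      set q := (1 / 2 : ℝ) ^ n with hqd
      have hq0 : 0 ≤ q := by positivity
      have hq1 : q ≤ 1 := pow_le_one₀ (by norm_num) (by norm_num)
      have h5 : l ^ n * dist (C u n) (z (u n)) ≤ q ^ 3 * (2 * ρ * (1 - q) + ρ) := by
        apply mul_le_mul hq (by linarith) dist_nonneg (by positivity)
      have h6 : q ^ 3 * (2 * ρ * (1 - q) + ρ) ≤ ρ * q := by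
        have : (3 - 2 * q) * q ^ 2 ≤ 1 := by nlinarith [mul_nonneg (sq_nonneg (1 - q)) hq0, sq_nonneg (1-q)]
        have := mul_le_mul_of_nonneg_left this (mul_nonneg hρ.le hq0)
        nlinarith
      rw [pow_succ, ← hqd]
      nlinarith
  have hD2 : ∀ u n, dist y (C u n) ≤ 2 * ρ := by
    intro u n
    have h1 : (0:ℝ) ≤ (1 / 2) ^ n := by positivity
    nlinarith [hD u n]
  have hCz : ∀ u n i, dist (C u n) (z i) ≤ 3 * ρ := by
    intro u n i
    have t2 := dist_triangle_left (C u n) (z i) y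
    linarith [hD2 u n, hz i]
  have hstep : ∀ u n, dist (C u n) (C u (n + 1)) ≤ 3 * ρ * l ^ n := by
    intro u n
    rw [CS, hg1]
    have := mul_le_mul_of_nonneg_left (hCz u n (u n)) (by positivity : 0 ≤ l ^ n)
    linarith
  have hlim : ∀ u, ∃ x, Filter.Tendsto (C u) Filter.atTop (nhds x) := fun u =>
    cauchySeq_tendsto_of_complete (cauchySeq_of_le_geometric l (3 * ρ) (by linarith) (hstep u))
  choose π hπ using hlim
  have hπd : ∀ u n, dist (C u n) (π u) ≤ 4 * ρ * l ^ n := by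
    intro u n
    have := dist_le_of_le_geometric_of_tendsto l (3 * ρ) (by linarith) (hstep u) (hπ u) n
    refine this.trans ?_
    rw [div_le_iff₀ (by linarith)]
    have h1 : 0 ≤ ρ * l ^ n := by positivity
    nlinarith
  refine ⟨π, fun u v n huv hne => ?_⟩
  have hCeq : ∀ m, m ≤ n → C u m = C v m := by
    intro m hm
    induction m with
    | zero => rfl
    | succ m ih => rw [CS, CS, ih (by omega), huv m (by omega)]
  have h1 : l ^ n / 2 * dist (z (u n)) (z (v n)) ≤ dist (C u (n + 1)) (C v (n + 1)) := by
    rw [CS, CS, ← hCeq n le_rfl]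
    refine contr hX.curv hr (y := C u n) (by positivity) (hln n) (hg1 _ _ _) (hg2 _ _ _)
      (hg1 _ _ _) (hg2 _ _ _) ?_ ?_ ?_
    · linarith [hCz u n (u n)]
    · linarith [hCz u n (v n)]
    · have := dist_triangle_left (z (u n)) (z (v n)) y
      linarith [hz (u n), hz (v n)]
  have h2 := hsep _ _ hne
  have h3 : l ^ n / 2 * (ε * ρ) ≤ l ^ n / 2 * dist (z (u n)) (z (v n)) :=
    mul_le_mul_of_nonneg_left h2 (by positivity)
  have t1 := dist_triangle4 (C u (n + 1)) (π u) (π v) (C v (n + 1))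
  have b1 := hπd u (n + 1)
  have b2 := hπd v (n + 1)
  rw [dist_comm] at b2
  have e1 : 4 * ρ * l ^ (n + 1) = l ^ n * (ρ * ε / 8) := by rw [pow_succ, hl]; ring
  rw [e1] at b1 b2
  linarith

lemma doubling {k : ℕ} (hX : IsAlexandrovSpace X k κ) {r : ℝ} (hr : |κ| * r ^ 2 ≤ 1 / 100)
    {y : X} {ρ ε : ℝ} (hρ : 0 < ρ) (hρr : 3 * ρ ≤ r) (hε : 0 < ε) (hε1 : ε ≤ 1) {ι : Type}
    [Fintype ι] (z' : ι → X) (hz' : ∀ i, dist y (z' i) ≤ ρ)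
    (hsep' : ∀ i j, i ≠ j → ε * ρ ≤ dist (z' i) (z' j)) :
    (Fintype.card ι : ℝ) ≤ (32 / ε) ^ k := by
  set N := Fintype.card ι with hN
  let e := (Fintype.equivFin ι).symm
  have hz : ∀ i, dist y ((z' ∘ e) i) ≤ ρ := fun i => hz' _
  have hsep : ∀ i j, i ≠ j → ε * ρ ≤ dist ((z' ∘ e) i) ((z' ∘ e) j) := fun i j h =>
    hsep' _ _ (fun h2 => h (e.injective h2))
  generalize z' ∘ e = z at hz hsep
  have hbig : 1 ≤ 32 / ε := by rw [le_div_iff₀ hε]; linarith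
  rcases Nat.lt_or_ge 1 N with hN1 | hN1
  swap
  · have : (N : ℝ) ≤ 1 := by exact_mod_cast hN1
    exact this.trans (one_le_pow₀ hbig)
  obtain ⟨π, hπ⟩ := cantor_map hX hr hρ hρr hε hε1 z hz hsep
  set l := ε / 32 with hl
  have hl0 : 0 < l := by positivity
  have hl1 : l < 1 := by rw [hl]; linarith
  have hNpos : (1:ℝ) < N := by exact_mod_cast hN1
  set α := Real.log N / Real.log (1 / l) with hα
  have hlog : 0 < Real.log (1 / l) := Real.log_pos (by rw [lt_div_iff₀ hl0]; linarith)
  have hα0 : 0 < α := div_pos (Real.log_pos hNpos) hlog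
  have hlα : l ^ α = 1 / N := by
    have h1 : l = Real.exp (- Real.log (1 / l)) := by
      rw [one_div, Real.log_inv, neg_neg, Real.exp_log hl0]
    rw [h1, ← Real.exp_mul, hα, neg_mul, mul_div_cancel₀ _ hlog.ne', Real.exp_neg,
      Real.exp_log (by linarith), one_div]
  set c := ρ * ε / 4 with hc
  have hc0 : 0 < c := by positivity
  have hinj : Function.Injective π := by
    intro u v huv
    by_contra hne
    have hex : ∃ n, u n ≠ v n := by
      by_contra hcon; push Not at hcon; exact hne (funext hcon)
    classical
    have := hπ u v (Nat.find hex) (fun i hi => by simpa using Nat.find_min hex hi) (Nat.find_spec hex)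
    rw [huv, dist_self] at this
    have : 0 < l ^ Nat.find hex * c := by positivity
    linarith
  have hφ : ∃ φ : X → ℝ, ∀ u, φ (π u) = Real.ofDigits u :=
    ⟨fun x => Real.ofDigits (Function.extend π id (fun _ _ => ⟨0, by omega⟩) x), fun u => by
      simp [hinj.extend_apply]⟩
  obtain ⟨φ, hφ⟩ := hφ
  have hH : HolderOnWith (Real.toNNReal ((1 / c) ^ α)) (Real.toNNReal α) φ (range π) := by
    rintro _ ⟨u, rfl⟩ _ ⟨v, rfl⟩
    by_cases hne : u = v
    · subst hne; simp
    have hex : ∃ n, u n ≠ v n := by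
      by_contra hcon; push Not at hcon; exact hne (funext hcon)
    classical
    have h1 := hπ u v (Nat.find hex) (fun i hi => by simpa using Nat.find_min hex hi) (Nat.find_spec hex)
    have h2 := Real.abs_ofDigits_sub_ofDigits_le (x := u) (y := v) (n := Nat.find hex)
      (fun i hi => by simpa using Nat.find_min hex hi)
    set n := Nat.find hex
    rw [edist_dist, edist_dist, hφ, hφ, Real.coe_toNNReal _ hα0.le,
      ENNReal.ofReal_rpow_of_nonneg dist_nonneg hα0.le]
    rw [show ((Real.toNNReal ((1 / c) ^ α) : NNReal) : ENNReal) = ENNReal.ofReal ((1 / c) ^ α) from rfl,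
      ← ENNReal.ofReal_mul (by positivity)]
    apply ENNReal.ofReal_le_ofReal
    rw [Real.dist_eq]
    refine h2.trans ?_
    have h3 : l ^ n ≤ 1 / c * dist (π u) (π v) := by
      rw [one_div, ← div_eq_inv_mul, le_div_iff₀ hc0]; exact h1
    have h4 := Real.rpow_le_rpow (by positivity) h3 hα0.le
    rw [Real.mul_rpow (by positivity) dist_nonneg] at h4
    refine le_trans (le_of_eq ?_) h4
    rw [← Real.rpow_natCast l n, ← Real.rpow_mul hl0.le, mul_comm (n:ℝ) α, Real.rpow_mul hl0.le, hlα,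
      Real.rpow_natCast]
    simp [hN]
  have h5 := hH.dimH_image_le (by simpa using hα0)
  have h6 : Icc (0:ℝ) 1 ⊆ φ '' range π := by
    intro t ht
    obtain ⟨u, -, hu⟩ := Real.ofDigits_SurjOn hN1 ht
    exact ⟨π u, ⟨u, rfl⟩, by rw [hφ, hu]⟩
  have h7 : dimH (Icc (0:ℝ) 1) = 1 := by
    rw [Real.dimH_of_nonempty_interior (E := ℝ) (by rw [interior_Icc]; exact ⟨1/2, by norm_num⟩)]
    simp
  have h8 : (1 : ENNReal) ≤ dimH (range π) / (Real.toNNReal α : ENNReal) := by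
    rw [← h7]; exact (dimH_mono h6).trans h5
  have h9 : (Real.toNNReal α : ENNReal) ≤ k := by
    rw [ENNReal.le_div_iff_mul_le (Or.inl (by simpa using hα0)) (Or.inl (by simp)), one_mul] at h8
    refine h8.trans ?_
    rw [← hX.dim]; exact dimH_mono (subset_univ _)
  have h10 : α ≤ k := by
    have : Real.toNNReal α ≤ (k : NNReal) := by exact_mod_cast h9
    rw [Real.toNNReal_le_iff_le_coe] at this
    simpa using this
  rw [hα, div_le_iff₀ hlog] at h10
  have h11 : Real.log N ≤ Real.log ((1 / l) ^ k) := by rw [Real.log_pow]; exact h10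
  have h12 := (Real.log_le_log_iff (by linarith) (by positivity)).1 h11
  rw [hl, one_div_div] at h12
  exact h12

lemma exists_separated {S : Set X} {d : NNReal} (h : (d : ENNReal) < dimH S) (ε0 : ℝ) (hε0 : 0 < ε0) :
    ∃ ε, 0 < ε ∧ ε ≤ ε0 ∧ ∃ T : Finset X, (T : Set X) ⊆ S ∧
      (∀ a ∈ T, ∀ b ∈ T, a ≠ b → ε ≤ dist a b) ∧ (1 / ε) ^ (d : ℝ) ≤ T.card := by
  by_contra hcon
  push Not at hcon
  borelize X
  have hmax : ∀ ε, 0 < ε → ε ≤ ε0 → ∃ T : Finset X, (T.card : ℝ) ≤ (1 / ε) ^ (d : ℝ) ∧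
      S ⊆ ⋃ x : T, closedBall (x : X) ε := by
    intro ε h0 h1
    let P : ℕ → Prop := fun n => ∃ T : Finset X, (T : Set X) ⊆ S ∧
      (∀ a ∈ T, ∀ b ∈ T, a ≠ b → ε ≤ dist a b) ∧ T.card = n
    have hP0 : P 0 := ⟨∅, by simp, by simp, rfl⟩
    have hPb : ∀ n, P n → n ≤ ⌈(1 / ε) ^ (d : ℝ)⌉₊ := by
      rintro n ⟨T, h1', h2, h3⟩
      have := hcon ε h0 h1 T h1' h2
      rw [h3] at this
      exact_mod_cast this.le.trans (Nat.le_ceil _)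
    classical
    obtain ⟨T, hT1, hT2, hT3⟩ := Nat.findGreatest_spec (P := P) (Nat.zero_le ⌈(1 / ε) ^ (d : ℝ)⌉₊) hP0
    refine ⟨T, (hcon ε h0 h1 T hT1 hT2).le, ?_⟩
    intro x hx
    by_contra hxn
    simp only [mem_iUnion, mem_closedBall, not_exists, not_le] at hxn
    have hxT : x ∉ T := fun hxT => by
      have := hxn ⟨x, hxT⟩
      simp at this; linarith
    have : P (T.card + 1) := by
      refine ⟨insert x T, ?_, ?_, by rw [Finset.card_insert_of_notMem hxT]⟩
      · intro a ha
        simp at ha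
        rcases ha with rfl | ha
        · exact hx
        · exact hT1 ha
      · intro a ha b hb hab
        rw [Finset.mem_insert] at ha hb
        rcases ha with rfl | ha <;> rcases hb with rfl | hb
        · exact absurd rfl hab
        · exact (hxn ⟨b, hb⟩).le
        · rw [dist_comm]; exact (hxn ⟨a, ha⟩).le
        · exact hT2 a ha b hb hab
    have h5 := Nat.le_findGreatest (hPb _ this) this
    rw [hT3] at h5
    omega
  have hmax' : ∀ j : ℕ, ∃ T : Finset X, (T.card : ℝ) ≤ (1 / (ε0 / (j + 1))) ^ (d : ℝ) ∧
      S ⊆ ⋃ x : T, closedBall (x : X) (ε0 / (j + 1)) := fun j =>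
    hmax _ (by positivity) (div_le_self hε0.le (by linarith [(Nat.cast_nonneg j : (0:ℝ) ≤ j)]))
  choose T hT1 hT2 using hmax'
  have hdiam : ∀ (j : ℕ) (x : X), ediam (closedBall x (ε0 / (j + 1))) ≤
      ENNReal.ofReal (2 * (ε0 / (j + 1))) := by
    intro j x
    refine Metric.ediam_le ?_
    intro a ha b hb
    rw [edist_dist]
    apply ENNReal.ofReal_le_ofReal
    have := dist_triangle_right a b x
    rw [mem_closedBall] at ha hb
    linarith
  have hm := MeasureTheory.Measure.hausdorffMeasure_le_liminf_sum (d : ℝ) S (l := Filter.atTop)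
    (fun j : ℕ => ENNReal.ofReal (2 * (ε0 / (j + 1)))) (by
      rw [← ENNReal.ofReal_zero]
      apply ENNReal.tendsto_ofReal
      have := (tendsto_const_div_atTop_nhds_zero_nat ε0).comp (Filter.tendsto_add_atTop_nat 1)
      have := this.const_mul 2
      simpa [Function.comp_def] using this)
    (fun j (x : T j) => closedBall (x : X) (ε0 / (j + 1)))
    (Filter.Eventually.of_forall fun j x => hdiam j x)
    (Filter.Eventually.of_forall fun j => hT2 j)
  have hb : ∀ j : ℕ, ∑ x : T j, ediam (closedBall (x : X) (ε0 / (j + 1))) ^ (d : ℝ) ≤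
      ENNReal.ofReal (2 ^ (d : ℝ)) := by
    intro j
    have hp : (0:ℝ) < ε0 / (j + 1) := by positivity
    calc _ ≤ ∑ x : T j, ENNReal.ofReal (2 * (ε0 / (j + 1))) ^ (d : ℝ) :=
          Finset.sum_le_sum fun x _ => ENNReal.rpow_le_rpow (hdiam j x) (NNReal.coe_nonneg d)
      _ = ENNReal.ofReal ((T j).card * (2 * (ε0 / (j + 1))) ^ (d : ℝ)) := by
          rw [Finset.sum_const, ENNReal.ofReal_rpow_of_nonneg (by positivity) (NNReal.coe_nonneg d),
            ENNReal.ofReal_mul (by positivity), nsmul_eq_mul]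
          simp
      _ ≤ _ := by
          apply ENNReal.ofReal_le_ofReal
          have := mul_le_mul_of_nonneg_right (hT1 j) (by positivity : 0 ≤ (2 * (ε0 / (j + 1))) ^ (d : ℝ))
          refine this.trans (le_of_eq ?_)
          rw [← Real.mul_rpow (by positivity) (by positivity)]
          congr 1; field_simp
  have hfin : MeasureTheory.Measure.hausdorffMeasure (d : ℝ) S ≤ ENNReal.ofReal (2 ^ (d : ℝ)) := by
    refine hm.trans ?_
    refine (Filter.liminf_le_liminf (Filter.Eventually.of_forall hb)).trans ?_
    simp
  have := hausdorffMeasure_of_lt_dimH h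
  rw [this] at hfin
  simp at hfin

end Collapse

namespace Collapse

variable {κ : ℝ} {X : Type} [MetricSpace X] {r : ℝ}

lemma md_lip (hr : |κ| * r ^ 2 ≤ 1 / 100) {u v : ℝ} (hu : 0 ≤ u) (hv : 0 ≤ v) (hur : u ≤ r)
    (hvr : v ≤ r) : |md κ u - md κ v| ≤ 11 / 10 * r * |u - v| := by
  wlog h : v ≤ u generalizing u v
  · have := this hv hu hvr hur (by linarith)
    rwa [abs_sub_comm, abs_sub_comm u v]
  have hb := md_sub_bounds (κ := κ) hv h (loc_e hr hu hur) (by norm_num)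
  have h1 : 0 ≤ u ^ 2 - v ^ 2 := by nlinarith
  rw [abs_of_nonneg (by linarith), abs_of_nonneg (by linarith)]
  nlinarith [mul_nonneg (sub_nonneg.2 h) (sub_nonneg.2 hur), mul_nonneg (sub_nonneg.2 h) (sub_nonneg.2 hvr),
    mul_nonneg (sub_nonneg.2 h) (hu.trans hur)]

lemma Q_lip (hr : |κ| * r ^ 2 ≤ 1 / 100) {y y1 a b : X} (h1 : dist y a ≤ r) (h2 : dist y b ≤ r)
    (h3 : dist y1 a ≤ r) (h4 : dist y1 b ≤ r) :
    |Q κ y1 a b - Q κ y a b| ≤ 4 * r * dist y y1 := by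
  have r0 : 0 ≤ r := dist_nonneg.trans h1
  have da : |dist y1 a - dist y a| ≤ dist y y1 := by rw [dist_comm y y1]; exact abs_dist_sub_le _ _ _
  have db : |dist y1 b - dist y b| ≤ dist y y1 := by rw [dist_comm y y1]; exact abs_dist_sub_le _ _ _
  have ma := md_lip hr dist_nonneg dist_nonneg h3 h1
  have mb := md_lip hr dist_nonneg dist_nonneg h4 h2
  have ma' := ma.trans (mul_le_mul_of_nonneg_left da (by positivity))
  have mb' := mb.trans (mul_le_mul_of_nonneg_left db (by positivity))
  have c1 := (cs_loc (κ := κ) hr dist_nonneg h4)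
  have c2 := (cs_loc (κ := κ) hr dist_nonneg h1)
  have e : Q κ y1 a b - Q κ y a b = (md κ (dist y1 a) - md κ (dist y a)) * cs κ (dist y1 b) +
      (md κ (dist y1 b) - md κ (dist y b)) * cs κ (dist y a) := by
    unfold Q; rw [cs_eq, cs_eq]; ring
  rw [e]
  refine (abs_add_le _ _).trans ?_
  rw [abs_mul, abs_mul, abs_of_nonneg (by linarith : 0 ≤ cs κ (dist y1 b)),
    abs_of_nonneg (by linarith : 0 ≤ cs κ (dist y a))]
  have k1 := mul_le_mul ma' c1.2 (by linarith) (by positivity)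
  have k2 := mul_le_mul mb' c2.2 (by linarith) (by positivity)
  have : 0 ≤ r * dist y y1 := by positivity
  linarith

/-- single extremal move -/
lemma emove1 {k : ℕ} (hX : IsAlexandrovSpace X k κ) (hr : |κ| * r ^ 2 ≤ 1 / 100) {E : Set X}
    (hE : IsExtremal κ E) {y a : X} (hy : y ∈ E) (ha : y ≠ a) (har : dist y a ≤ r / 2) {τ : ℝ}
    (hτ : 0 < τ) (hτ1 : τ ≤ 1 / 10) :
    ∃ z ∈ E, dist y z ≤ 2 * r * τ ∧ ∀ b, dist y b ≤ r / 2 →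
      md κ (dist y b) - τ * Q κ y a b - 2 * r ^ 2 * τ ^ 2 ≤ md κ (dist z b) := by
  have hpX := hX.proper
  set L := dist y a with hL
  have hL0 : 0 < L := dist_pos.2 ha
  have hr0 : 0 < r := by linarith
  obtain ⟨sL1, sL2⟩ := sn_loc (κ := κ) hr hL0.le (by linarith)
  obtain ⟨s, ⟨hs0, hsL⟩, hs⟩ := intermediate_value_Icc hL0.le (continuous_sn κ).continuousOn
    (show τ * sn κ L ∈ Icc (sn κ 0) (sn κ L) by
      rw [sn_zero]; constructor <;> nlinarith)
  have hs1 := (sn_loc (κ := κ) hr hs0 (by linarith)).1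
  have hsτ : s ≤ 11 / 10 * τ * L := by nlinarith
  have hsτr : s ≤ 11 / 20 * τ * r := by nlinarith
  obtain ⟨y', hy1, hy2⟩ := exists_btw hX y a hs0 hsL
  obtain ⟨z, hzE, hz⟩ := hE.1.exists_infDist_eq_dist ⟨y, hy⟩ y'
  have hzm : ∀ w ∈ E, dist y' z ≤ dist y' w := fun w hw => hz ▸ infDist_le_dist_of_mem hw
  have hzs : dist y' z ≤ s := by
    have := hzm y hy; rwa [dist_comm y' y, hy1] at this
  have hyz : dist y z ≤ 2 * s := by
    have := dist_triangle y y' z; linarith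
  refine ⟨z, hzE, by nlinarith, fun b hb => ?_⟩
  have hst := step_loc hX.curv hr hy1 hy2 (o := b) (by linarith) (by linarith) hL0
  rw [hs, ← hL, mul_div_assoc, div_self (by linarith), mul_one] at hst
  have hzb : dist z b ≤ r := by
    have := dist_triangle_left z b y
    nlinarith
  have hmz := (md_loc (κ := κ) (u := dist y' z) hr dist_nonneg (by nlinarith)).2
  have hm0 := md_nonneg κ (dist y' z)
  have hsq : dist y' z ^ 2 ≤ (11 / 20 * τ * r) ^ 2 := pow_le_pow_left₀ dist_nonneg (hzs.trans hsτr) 2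
  have key : md κ (dist y' b) ≤ md κ (dist z b) + 2 * md κ (dist y' z) := by
    by_cases hyE : y' ∈ E
    · have : y' = z := by
        have := hzm y' hyE; rw [dist_self] at this
        exact dist_le_zero.1 this
      rw [this]; simp
    by_cases hbz : b = z
    · subst hbz; simp; linarith
    have hcr := hE.2 y' hyE z hzE (by
      filter_upwards [self_mem_nhdsWithin] with w hw using hzm w hw) b hbz
    rw [cmpAngle_eq, Real.arccos_le_pi_div_two] at hcr
    have p1 : 0 < dist z y' := dist_pos.2 (fun h => hyE (h ▸ hzE))
    have p2 : 0 < dist z b := dist_pos.2 (Ne.symm hbz)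
    have s1 := (sn_loc (κ := κ) (u := dist z y') hr p1.le (by rw [dist_comm]; nlinarith)).1
    have s2 := (sn_loc (κ := κ) (u := dist z b) hr p2.le hzb).1
    have hQ : 0 ≤ md κ (dist z y') * cs κ (dist z b) + md κ (dist z b) - md κ (dist y' b) := by
      by_contra hn
      push Not at hn
      have : (md κ (dist z y') * cs κ (dist z b) + md κ (dist z b) - md κ (dist y' b)) /
        (sn κ (dist z y') * sn κ (dist z b)) < 0 := div_neg_of_neg_of_pos hn (mul_pos (by linarith) (by linarith))
      linarith
    have hc := (cs_loc (κ := κ) hr dist_nonneg hzb).2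
    rw [dist_comm z y'] at hQ
    nlinarith
  have : 0 ≤ r ^ 2 * τ ^ 2 := by positivity
  nlinarith

def nu (W : List (ℝ × X)) : ℝ := (W.map fun w => w.1).sum
def QL (κ : ℝ) (y : X) (W : List (ℝ × X)) (b : X) : ℝ := (W.map fun w => w.1 * Q κ y w.2 b).sum
def Gam (κ : ℝ) (y : X) (W V : List (ℝ × X)) : ℝ := (V.map fun v => v.1 * QL κ y W v.2).sum
def fL (κ : ℝ) (W : List (ℝ × X)) (z : X) : ℝ := (W.map fun w => w.1 * md κ (dist z w.2)).sum

lemma nu_cons (w : ℝ × X) (W : List (ℝ × X)) : nu (w :: W) = w.1 + nu W := by simp [nu]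
lemma QL_cons (y : X) (w : ℝ × X) (W : List (ℝ × X)) (b : X) :
    QL κ y (w :: W) b = w.1 * Q κ y w.2 b + QL κ y W b := by simp [QL]
lemma Gam_cons (y : X) (v : ℝ × X) (W V : List (ℝ × X)) :
    Gam κ y W (v :: V) = v.1 * QL κ y W v.2 + Gam κ y W V := by simp [Gam]
lemma fL_cons (w : ℝ × X) (W : List (ℝ × X)) (z : X) :
    fL κ (w :: W) z = w.1 * md κ (dist z w.2) + fL κ W z := by simp [fL]

lemma nu_nonneg {W : List (ℝ × X)} (h : ∀ w ∈ W, 0 < w.1) : 0 ≤ nu W := by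
  refine List.sum_nonneg ?_
  intro x hx
  obtain ⟨w, hw, rfl⟩ := List.mem_map.1 hx
  exact (h w hw).le

lemma Gam_cons_left (y : X) (w : ℝ × X) (W V : List (ℝ × X)) :
    Gam κ y (w :: W) V = w.1 * QL κ y V w.2 + Gam κ y W V := by
  induction V with
  | nil => simp [Gam, QL]
  | cons v V ih => rw [Gam_cons, Gam_cons, ih, QL_cons, QL_cons, Q_symm y v.2]; ring

lemma Gam_symm (y : X) (W V : List (ℝ × X)) : Gam κ y W V = Gam κ y V W := by
  induction V with
  | nil =>
    induction W with
    | nil => rfl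
    | cons w W ih => rw [Gam_cons_left, ih, Gam_cons]
  | cons v V ih => rw [Gam_cons_left, Gam_cons, ih]

lemma continuous_Q (a b : X) : Continuous fun y => Q κ y a b := by
  unfold Q
  have := continuous_md κ
  fun_prop

lemma continuous_QL (W : List (ℝ × X)) (b : X) : Continuous fun y => QL κ y W b := by
  induction W with
  | nil => simpa [QL] using continuous_const
  | cons w W ih =>
    simp only [QL_cons]
    exact (continuous_const.mul (continuous_Q _ _)).add ih

lemma continuous_Gam (W V : List (ℝ × X)) : Continuous fun y => Gam κ y W V := by
  induction V with
  | nil => simpa [Gam] using continuous_const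
  | cons v V ih =>
    simp only [Gam_cons]
    exact (continuous_const.mul (continuous_QL _ _)).add ih

lemma continuous_fL (W : List (ℝ × X)) : Continuous fun y => fL κ W y := by
  induction W with
  | nil => simpa [fL] using continuous_const
  | cons w W ih =>
    simp only [fL_cons]
    have := continuous_md κ
    fun_prop

/-- extremal move along a list -/
lemma emove {k : ℕ} (hX : IsAlexandrovSpace X k κ) (hr : |κ| * r ^ 2 ≤ 1 / 100) (hr0 : 0 < r)
    {E : Set X} (hE : IsExtremal κ E) {y : X} (hy : y ∈ E) (W : List (ℝ × X))
    (hW : ∀ w ∈ W, 0 < w.1 ∧ y ≠ w.2 ∧ dist y w.2 ≤ r / 4) :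
    ∃ t0 > 0, ∃ C ≥ 0, ∀ t, 0 < t → t ≤ t0 → ∃ z ∈ E, dist y z ≤ 2 * r * nu W * t ∧
      ∀ b, dist y b ≤ r / 4 → md κ (dist y b) - t * QL κ y W b - C * t ^ 2 ≤ md κ (dist z b) := by
  induction W with
  | nil =>
    refine ⟨1, one_pos, 0, le_rfl, fun t _ _ => ⟨y, hy, by simp [nu], fun b _ => by simp [QL]⟩⟩
  | cons w W ih =>
    obtain ⟨t0, ht0, C, hC, ih⟩ := ih (fun w hw => hW w (List.mem_cons_of_mem _ hw))
    obtain ⟨hν, hya, har⟩ := hW w List.mem_cons_self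
    have hnu : 0 ≤ nu W := nu_nonneg (fun w hw => (hW w (List.mem_cons_of_mem _ hw)).1)
    have hda : 0 < dist y w.2 := dist_pos.2 hya
    set D := min (dist y w.2) (r / 4) with hD
    have hD0 : 0 < D := lt_min hda (by positivity)
    refine ⟨min t0 (min (1 / (10 * w.1)) (D / (4 * r * (nu W + 1)))), by positivity,
      C + 8 * r ^ 2 * nu W * w.1 + 2 * r ^ 2 * w.1 ^ 2, by positivity, fun t htp ht => ?_⟩
    simp only [le_min_iff] at ht
    obtain ⟨ht1, ht2, ht3⟩ := ht
    rw [le_div_iff₀ (by positivity)] at ht2 ht3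
    obtain ⟨y1, hy1E, hy1, hb1⟩ := ih t htp ht1
    have hyy1 : dist y y1 < D := by
      have : 0 < r * t := by positivity
      nlinarith [mul_nonneg hnu this.le]
    have hDa : D ≤ dist y w.2 := min_le_left _ _
    have hDr : D ≤ r / 4 := min_le_right _ _
    have hy1a : dist y1 w.2 ≤ r / 2 := by
      have := dist_triangle_left y1 w.2 y; linarith
    have hne : y1 ≠ w.2 := by rintro h; rw [h] at hyy1; linarith
    obtain ⟨z, hzE, hz1, hz2⟩ := emove1 hX hr hE hy1E hne hy1a (τ := t * w.1) (by positivity)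
      (by linarith)
    refine ⟨z, hzE, ?_, fun b hb => ?_⟩
    · have := dist_triangle y y1 z
      rw [nu_cons]; linarith
    · have hy1b : dist y1 b ≤ r / 2 := by
        have := dist_triangle_left y1 b y; linarith
      have k1 := hz2 b hy1b
      have k2 := hb1 b hb
      have k3 := Q_lip (κ := κ) hr (y := y) (y1 := y1) (a := w.2) (b := b) (by linarith) (by linarith)
        (by linarith) (by linarith)
      have k4 := (abs_le.1 k3).2
      have k5 : 4 * r * dist y y1 ≤ 4 * r * (2 * r * nu W * t) :=
        mul_le_mul_of_nonneg_left hy1 (by positivity)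
      have k6 : t * w.1 * Q κ y1 w.2 b ≤ t * w.1 * (Q κ y w.2 b + 4 * r * (2 * r * nu W * t)) :=
        mul_le_mul_of_nonneg_left (by linarith) (by positivity)
      rw [QL_cons]
      nlinarith

lemma emove_f {k : ℕ} (hX : IsAlexandrovSpace X k κ) (hr : |κ| * r ^ 2 ≤ 1 / 100) (hr0 : 0 < r)
    {E : Set X} (hE : IsExtremal κ E) {y : X} (hy : y ∈ E) (W : List (ℝ × X))
    (hW : ∀ w ∈ W, 0 < w.1 ∧ y ≠ w.2 ∧ dist y w.2 ≤ r / 4) :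
    ∃ t0 > 0, ∃ C ≥ 0, ∀ t, 0 < t → t ≤ t0 → ∃ z ∈ E, dist y z ≤ 2 * r * nu W * t ∧
      ∀ V : List (ℝ × X), (∀ w ∈ V, 0 < w.1 ∧ dist y w.2 ≤ r / 4) →
      fL κ V y - t * Gam κ y W V - nu V * C * t ^ 2 ≤ fL κ V z := by
  obtain ⟨t0, ht0, C, hC, h⟩ := emove hX hr hr0 hE hy W hW
  refine ⟨t0, ht0, C, hC, fun t h1 h2 => ?_⟩
  obtain ⟨z, hz, hz1, hz2⟩ := h t h1 h2
  refine ⟨z, hz, hz1, fun V hV => ?_⟩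
  induction V with
  | nil => simp [fL, Gam, nu]
  | cons v V ih =>
    have a := ih (fun w hw => hV w (List.mem_cons_of_mem _ hw))
    obtain ⟨b1, b2⟩ := hV v List.mem_cons_self
    have c := mul_le_mul_of_nonneg_left (hz2 v.2 b2) b1.le
    rw [fL_cons, fL_cons, Gam_cons, nu_cons]
    nlinarith

/-- `f` is Lipschitz locally -/
lemma fL_lip (hr : |κ| * r ^ 2 ≤ 1 / 100) {y z : X} (V : List (ℝ × X))
    (hV : ∀ w ∈ V, 0 < w.1 ∧ dist y w.2 ≤ r ∧ dist z w.2 ≤ r) :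
    |fL κ V y - fL κ V z| ≤ 2 * r * nu V * dist y z := by
  induction V with
  | nil => simp [fL, nu]
  | cons v V ih =>
    have a := ih (fun w hw => hV w (List.mem_cons_of_mem _ hw))
    obtain ⟨b1, b2, b3⟩ := hV v List.mem_cons_self
    have r0 : 0 ≤ r := dist_nonneg.trans b2
    have c := md_lip (κ := κ) hr dist_nonneg dist_nonneg b2 b3
    have d : |dist y v.2 - dist z v.2| ≤ dist y z := abs_dist_sub_le _ _ _
    have c' := c.trans (mul_le_mul_of_nonneg_left d (by positivity))
    have e := mul_le_mul_of_nonneg_left c' b1.le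
    rw [fL_cons, fL_cons, nu_cons]
    rw [show v.1 * md κ (dist y v.2) + fL κ V y - (v.1 * md κ (dist z v.2) + fL κ V z) =
      v.1 * (md κ (dist y v.2) - md κ (dist z v.2)) + (fL κ V y - fL κ V z) by ring]
    refine (abs_add_le _ _).trans ?_
    rw [abs_mul, abs_of_pos b1]
    have : 0 ≤ v.1 * (r * dist y z) := by positivity
    nlinarith

structure IsSys (κ r : ℝ) (y : X) {N : ℕ} (S : Fin N → List (ℝ × X)) : Prop where
  pts : ∀ i, ∀ w ∈ S i, 0 < w.1 ∧ y ≠ w.2 ∧ dist y w.2 ≤ r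
  neg : ∀ i j, i ≠ j → Gam κ y (S i) (S j) < 0

end Collapse

namespace Collapse

variable {κ : ℝ} {X : Type} [MetricSpace X] {r : ℝ}

lemma sys_nhd {y0 : X} {N : ℕ} {S : Fin N → List (ℝ × X)} (hS : IsSys κ (r / 8) y0 S) (hr0 : 0 < r) :
    ∃ s0 > 0, s0 ≤ r / 8 ∧ ∃ δ > 0, ∀ y, dist y y0 ≤ s0 →
      (∀ i j, i ≠ j → Gam κ y (S i) (S j) ≤ -δ) ∧
      ∀ i, ∀ w ∈ S i, 0 < w.1 ∧ y ≠ w.2 ∧ dist y w.2 ≤ r / 4 := by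
  have h1 : ∃ δ > 0, ∀ i j, i ≠ j → Gam κ y0 (S i) (S j) < -δ := by
    have : ∀ᶠ δ in nhdsWithin (0 : ℝ) (Ioi 0), ∀ i j, i ≠ j → Gam κ y0 (S i) (S j) < -δ := by
      rw [Filter.eventually_all]; intro i
      rw [Filter.eventually_all]; intro j
      by_cases hij : i = j
      · exact Filter.Eventually.of_forall fun _ h => absurd hij h
      · have h := hS.neg i j hij
        have h2 : ∀ᶠ δ in nhds (0 : ℝ), Gam κ y0 (S i) (S j) < -δ := by
          have : Continuous fun δ : ℝ => -δ := continuous_neg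
          exact this.continuousAt.eventually_const_lt (by simpa using h)
        filter_upwards [nhdsWithin_le_nhds h2] with δ hδ _ using hδ
    obtain ⟨δ, h1, h2⟩ := (this.and self_mem_nhdsWithin).exists
    exact ⟨δ, h2, h1⟩
  obtain ⟨δ, hδ, h1⟩ := h1
  have h2 : ∀ᶠ y in nhds y0, ∀ i j, i ≠ j → Gam κ y (S i) (S j) < -δ := by
    rw [Filter.eventually_all]; intro i
    rw [Filter.eventually_all]; intro j
    by_cases hij : i = j
    · exact Filter.Eventually.of_forall fun _ h => absurd hij h
    · filter_upwards [(continuous_Gam (κ := κ) (S i) (S j)).continuousAt.eventually_lt_const (h1 i j hij)]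
        with y hy _ using hy
  have h3 : ∀ᶠ y in nhds y0, ∀ i, ∀ w ∈ S i, y ≠ w.2 := by
    rw [Filter.eventually_all]; intro i
    have h := fun w hw => (hS.pts i w hw).2.1
    revert h
    generalize S i = W
    intro h
    induction W with
    | nil => simp
    | cons w W ih =>
      have a := ih (fun w hw => h w (List.mem_cons_of_mem _ hw))
      have b := isOpen_ne.mem_nhds (h w List.mem_cons_self)
      filter_upwards [a, b] with y ha hb
      intro v hv
      rcases List.mem_cons.1 hv with rfl | hv
      · exact hb
      · exact ha v hv
  obtain ⟨e, he, h4⟩ := Metric.eventually_nhds_iff.1 (h2.and h3)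
  refine ⟨min (e / 2) (r / 8), by positivity, min_le_right _ _, δ, hδ, fun y hy => ?_⟩
  have a1 := hy.trans (min_le_left _ _)
  have a2 := hy.trans (min_le_right _ _)
  obtain ⟨a3, a4⟩ := h4 (show dist y y0 < e by linarith)
  refine ⟨fun i j hij => (a3 i j hij).le, fun i w hw => ⟨(hS.pts i w hw).1, a4 i w hw, ?_⟩⟩
  have := dist_triangle y y0 w.2
  have := (hS.pts i w hw).2.2
  linarith

lemma caseA [CompactSpace X] {k : ℕ} (hX : IsAlexandrovSpace X k κ) (hr : |κ| * r ^ 2 ≤ 1 / 100)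
    (hr0 : 0 < r) {E : Set X} (hE : IsExtremal κ E) {y0 : X} (hy0 : y0 ∈ E) {N : ℕ}
    {S : Fin (N + 1) → List (ℝ × X)} {s δ Λ ε : ℝ} (hs : 0 < s) (hδ : 0 < δ) (hε : 0 < ε)
    (hsr : s ≤ r / 8)
    (hN : ∀ y, dist y y0 ≤ s → (∀ i j, i ≠ j → Gam κ y (S i) (S j) ≤ -δ) ∧
      ∀ i, ∀ w ∈ S i, 0 < w.1 ∧ y ≠ w.2 ∧ dist y w.2 ≤ r / 4)
    (hΛ : ∀ i, nu (S i) ≤ Λ) (hεΛ : ε * (2 * r * Λ) ≤ δ / 2)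
    (hA : ∀ z ∈ E, dist z y0 = s → ∃ i, fL κ (S i) z - fL κ (S i) y0 < ε * s) :
    (N : ENNReal) ≤ dimH E := by
  have hnu : ∀ i, 0 ≤ nu (S i) := fun i =>
    nu_nonneg fun w hw => ((hN y0 (by simpa using hs.le)).2 i w hw).1
  have hΛ0 : 0 ≤ Λ := (hnu 0).trans (hΛ 0)
  have hne : (Finset.univ : Finset (Fin (N + 1))).Nonempty := Finset.univ_nonempty
  let g : (Fin (N + 1) → ℝ) → X → ℝ := fun c z =>
    Finset.univ.inf' hne (fun i => fL κ (S i) z - fL κ (S i) y0 - c i) - ε * dist z y0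
  have hg : ∀ c, Continuous (g c) := by
    intro c
    refine Continuous.sub ?_ (by fun_prop)
    refine Continuous.finset_inf'_apply hne fun i _ => ?_
    have := continuous_fL (κ := κ) (S i)
    fun_prop
  -- gamma
  have hγ : ∃ γ > 0, ∀ z ∈ E, dist z y0 = s → g 0 z ≤ -γ := by
    have hneg : ∀ z ∈ E, dist z y0 = s → g 0 z < 0 := by
      intro z hz hzs
      obtain ⟨i, hi⟩ := hA z hz hzs
      have := Finset.inf'_le (f := fun i => fL κ (S i) z - fL κ (S i) y0 - (0 : Fin (N + 1) → ℝ) i) (Finset.mem_univ i)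
      simp only [g, hzs]
      simp only [Pi.zero_apply, sub_zero] at this ⊢
      linarith
    have hc : IsCompact (E ∩ sphere y0 s) := (hE.1.inter isClosed_sphere).isCompact
    rcases (E ∩ sphere y0 s).eq_empty_or_nonempty with h | h
    · refine ⟨1, one_pos, fun z hz hzs => ?_⟩
      have : z ∈ E ∩ sphere y0 s := ⟨hz, hzs⟩
      rw [h] at this; exact absurd this (by simp)
    · obtain ⟨z, hz, hm⟩ := hc.exists_isMaxOn h (hg 0).continuousOn
      refine ⟨-g 0 z, by have := hneg z hz.1 hz.2; linarith, fun z' h1 h2 => ?_⟩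
      have := hm (show z' ∈ E ∩ sphere y0 s from ⟨h1, h2⟩)
      simpa using this
  obtain ⟨γ, hγ, hγs⟩ := hγ
  let Ψ : X → Fin N → ℝ := fun z i => fL κ (S i.succ) z - fL κ (S 0) z
  have hsub : ball (Ψ y0) (γ / 2) ⊆ Ψ '' (E ∩ closedBall y0 s) := by
    intro v hv
    let c : Fin (N + 1) → ℝ := Fin.cons 0 (fun i => v i - Ψ y0 i)
    have hc : ∀ i, |c i| < γ / 2 := by
      intro i
      refine Fin.cases ?_ (fun i => ?_) i
      · simp [c]; positivity
      · simp only [c, Fin.cons_succ]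
        have := (dist_le_pi_dist v (Ψ y0) i).trans_lt hv
        rwa [Real.dist_eq] at this
    have hcomp : IsCompact (E ∩ closedBall y0 s) := (hE.1.inter isClosed_closedBall).isCompact
    obtain ⟨z, ⟨hzE, hzs⟩, hmax⟩ := hcomp.exists_isMaxOn ⟨y0, hy0, by simpa using hs.le⟩ (hg c).continuousOn
    have hzs' : dist z y0 ≤ s := hzs
    have hmax' : ∀ w ∈ E, dist w y0 ≤ s → g c w ≤ g c z := fun w h1 h2 => by
      simpa using hmax (show w ∈ E ∩ closedBall y0 s from ⟨h1, h2⟩)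
    have hgy : -(γ / 2) < g c y0 := by
      simp only [g, dist_self, mul_zero, sub_zero, sub_self, zero_sub]
      rw [Finset.lt_inf'_iff]
      intro i _
      have := (abs_lt.1 (hc i)).2; linarith
    have hlt : dist z y0 < s := by
      refine lt_of_le_of_ne hzs' fun h => ?_
      have h1 := hγs z hzE h
      have h2 := hmax' y0 hy0 (by simpa using hs.le)
      have h3 : g c z ≤ g 0 z + γ / 2 := by
        obtain ⟨i, _, hi⟩ := Finset.exists_mem_eq_inf' hne (fun i => fL κ (S i) z - fL κ (S i) y0 - (0 : Fin (N + 1) → ℝ) i)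
        have h4 := Finset.inf'_le (f := fun i => fL κ (S i) z - fL κ (S i) y0 - c i) (Finset.mem_univ i)
        simp only [g]
        rw [hi]
        have := (abs_lt.1 (hc i)).1
        simp only [Pi.zero_apply] at *
        linarith
      linarith
    set m := Finset.univ.inf' hne (fun i => fL κ (S i) z - fL κ (S i) y0 - c i) with hm
    have hmle : ∀ i, m ≤ fL κ (S i) z - fL κ (S i) y0 - c i := fun i =>
      Finset.inf'_le (f := fun i => fL κ (S i) z - fL κ (S i) y0 - c i) (Finset.mem_univ i)
    obtain ⟨hG, hP⟩ := hN z hzs'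
    have heq : ∀ j, fL κ (S j) z - fL κ (S j) y0 - c j = m := by
      intro j
      by_contra hj
      have hj' : m < fL κ (S j) z - fL κ (S j) y0 - c j := lt_of_le_of_ne (hmle j) (Ne.symm hj)
      set D := fL κ (S j) z - fL κ (S j) y0 - c j - m with hD
      have hD0 : 0 < D := by linarith
      obtain ⟨t0, ht0, C, hC, hem⟩ := emove_f hX hr hr0 hE hzE (S j) (hP j)
      -- choose t
      have hev : ∀ᶠ t in nhdsWithin (0 : ℝ) (Ioi 0), t < t0 ∧ 2 * r * Λ * t < s - dist z y0 ∧
          2 * r * Λ * (2 * r * Λ * t) + t * δ < D ∧ Λ * C * t < δ / 2 := by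
        refine nhdsWithin_le_nhds ?_
        refine Filter.Eventually.and ?_ (Filter.Eventually.and ?_ (Filter.Eventually.and ?_ ?_))
        · exact continuousAt_id.eventually_lt_const ht0
        · have : Continuous fun t : ℝ => 2 * r * Λ * t := by fun_prop
          exact this.continuousAt.eventually_lt_const (by simpa using hlt)
        · have : Continuous fun t : ℝ => 2 * r * Λ * (2 * r * Λ * t) + t * δ := by fun_prop
          exact this.continuousAt.eventually_lt_const (by simpa using hD0)
        · have : Continuous fun t : ℝ => Λ * C * t := by fun_prop
          exact this.continuousAt.eventually_lt_const (by simpa using hδ)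
      obtain ⟨t, ⟨k1, k2, k3, k4⟩, htp⟩ := (hev.and self_mem_nhdsWithin).exists
      have htp' : 0 < t := htp
      obtain ⟨z', hz'E, hz'd, hz'⟩ := hem t htp' k1.le
      have hd : dist z z' ≤ 2 * r * Λ * t := hz'd.trans
        (mul_le_mul_of_nonneg_right (mul_le_mul_of_nonneg_left (hΛ j) (by positivity)) htp'.le)
      have hz's : dist z' y0 ≤ dist z y0 + 2 * r * Λ * t := by
        have := dist_triangle_left z' y0 z; linarith
      have hlt2 : g c z' ≤ g c z := hmax' z' hz'E (by linarith)
      have hstep : m + t * δ - Λ * C * t ^ 2 ≤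
          Finset.univ.inf' hne (fun i => fL κ (S i) z' - fL κ (S i) y0 - c i) := by
        rw [Finset.le_inf'_iff]
        intro i _
        by_cases hij : i = j
        · subst hij
          have a := fL_lip (κ := κ) hr (y := z) (z := z') (S i) (fun w hw => by
            have a1 := hP i w hw
            have a2 := (hN z' (by linarith)).2 i w hw
            exact ⟨a1.1, by linarith [a1.2.2], by linarith [a2.2.2]⟩)
          have b := (abs_le.1 a).2
          have e1 : 2 * r * nu (S i) * dist z z' ≤ 2 * r * Λ * (2 * r * Λ * t) :=
            mul_le_mul (mul_le_mul_of_nonneg_left (hΛ i) (by positivity)) hd dist_nonneg (by positivity)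
          have e2 : 0 ≤ Λ * C * t ^ 2 := by positivity
          linarith
        · have a := hz' (S i) (fun w hw => ⟨(hP i w hw).1, (hP i w hw).2.2⟩)
          have b := mul_le_mul_of_nonneg_left (hG j i (Ne.symm hij)) htp'.le
          have e1 : nu (S i) * C * t ^ 2 ≤ Λ * C * t ^ 2 := by
            have := hΛ i; gcongr
          have := hmle i
          linarith
      have hgz : g c z = m - ε * dist z y0 := rfl
      have hgz' : g c z' = Finset.univ.inf' hne (fun i => fL κ (S i) z' - fL κ (S i) y0 - c i) - ε * dist z' y0 := rfl
      have e3 : ε * dist z' y0 ≤ ε * dist z y0 + δ / 2 * t := by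
        have := mul_le_mul_of_nonneg_left hz's hε.le
        have := mul_le_mul_of_nonneg_right hεΛ htp'.le
        linarith
      have e4 : Λ * C * t ^ 2 < δ / 2 * t := by
        have := mul_lt_mul_of_pos_right k4 htp'
        linarith
      rw [hgz, hgz'] at hlt2
      linarith
    refine ⟨z, ⟨hzE, hzs⟩, ?_⟩
    ext i
    have a := heq i.succ
    have b := heq 0
    simp only [c, Fin.cons_succ, Fin.cons_zero] at a b
    simp only [Ψ] at a ⊢
    linarith
  have hlip : LipschitzOnWith (Real.toNNReal (4 * r * Λ)) Ψ (E ∩ closedBall y0 s) := by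
    refine LipschitzOnWith.of_dist_le_mul fun x hx y hy => ?_
    rw [Real.coe_toNNReal _ (by positivity)]
    rw [dist_pi_le_iff (by positivity)]
    intro i
    have key : ∀ i, |fL κ (S i) x - fL κ (S i) y| ≤ 2 * r * Λ * dist x y := fun i => by
      refine (fL_lip (κ := κ) hr (y := x) (z := y) (S i) (fun w hw => ?_)).trans
        (mul_le_mul_of_nonneg_right (mul_le_mul_of_nonneg_left (hΛ i) (by positivity)) dist_nonneg)
      have a1 := (hN x hx.2).2 i w hw
      have a2 := (hN y hy.2).2 i w hw
      exact ⟨a1.1, by linarith [a1.2.2], by linarith [a2.2.2]⟩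
    rw [Real.dist_eq]
    have a := abs_le.1 (key i.succ)
    have b := abs_le.1 (key 0)
    simp only [Ψ]
    rw [abs_le]; constructor <;> linarith
  calc (N : ENNReal) = dimH (ball (Ψ y0) (γ / 2)) := by
        rw [Real.dimH_ball_pi_fin _ (by positivity)]
    _ ≤ dimH (Ψ '' (E ∩ closedBall y0 s)) := dimH_mono hsub
    _ ≤ dimH (E ∩ closedBall y0 s) := hlip.dimH_image_le
    _ ≤ dimH E := dimH_mono inter_subset_left

lemma QL_eq (y z : X) (W : List (ℝ × X)) :
    QL κ y W z = fL κ W y * cs κ (dist y z) + nu W * md κ (dist y z) - fL κ W z := by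
  induction W with
  | nil => simp [QL, fL, nu]
  | cons w W ih =>
    rw [QL_cons, fL_cons, fL_cons, nu_cons, ih]
    unfold Q; rw [cs_eq, dist_comm w.2 z]; ring

lemma fL_bd (hr : |κ| * r ^ 2 ≤ 1 / 100) {y : X} (V : List (ℝ × X))
    (hV : ∀ w ∈ V, 0 < w.1 ∧ dist y w.2 ≤ r) : 0 ≤ fL κ V y ∧ fL κ V y ≤ r ^ 2 * nu V := by
  induction V with
  | nil => simp [fL, nu]
  | cons v V ih =>
    have a := ih (fun w hw => hV w (List.mem_cons_of_mem _ hw))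
    obtain ⟨b1, b2⟩ := hV v List.mem_cons_self
    have c := (md_loc (κ := κ) hr dist_nonneg b2).2
    have c0 := md_nonneg κ (dist y v.2)
    have d : dist y v.2 ^ 2 ≤ r ^ 2 := pow_le_pow_left₀ dist_nonneg b2 2
    have e := mul_le_mul_of_nonneg_left (show md κ (dist y v.2) ≤ r ^ 2 by nlinarith) b1.le
    rw [fL_cons, nu_cons]
    constructor
    · have := mul_nonneg b1.le c0; linarith
    · linarith

lemma caseB (hr : |κ| * r ^ 2 ≤ 1 / 100) {y z : X} (V : List (ℝ × X)) {s ε Λ : ℝ}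
    (hV : ∀ w ∈ V, 0 < w.1 ∧ dist y w.2 ≤ r) (hs : dist y z = s) (hs0 : 0 < s) (hsr : s ≤ r)
    (hΛ : nu V ≤ Λ) (hΛ0 : 0 < Λ) (hsm : 4 * Λ * s < ε) (h : ε * s ≤ fL κ V z - fL κ V y) : QL κ y V z < 0 := by
  rw [QL_eq, hs]
  have b := fL_bd (κ := κ) hr V hV
  have c := md_loc (κ := κ) hr hs0.le hsr
  have hk : |κ * fL κ V y| ≤ Λ := by
    rw [abs_mul, abs_of_nonneg b.1]
    have h1 : |κ| * fL κ V y ≤ |κ| * (r ^ 2 * nu V) := mul_le_mul_of_nonneg_left b.2 (abs_nonneg _)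
    have h2 : (|κ| * r ^ 2) * nu V ≤ 1 / 100 * nu V := mul_le_mul_of_nonneg_right hr
      (nu_nonneg fun w hw => (hV w hw).1)
    nlinarith [nu_nonneg fun w hw => (hV w hw).1]
  have hk2 := (abs_le.1 hk).1
  have hm0 := md_nonneg κ s
  have e1 : -(κ * fL κ V y) * md κ s ≤ Λ * md κ s := mul_le_mul_of_nonneg_right (by linarith) hm0
  have e2 : nu V * md κ s ≤ Λ * md κ s := mul_le_mul_of_nonneg_right hΛ hm0
  have e3 : Λ * md κ s ≤ Λ * s ^ 2 := mul_le_mul_of_nonneg_left (by nlinarith) hΛ0.le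
  have e4 : 4 * Λ * s * s < ε * s := mul_lt_mul_of_pos_right hsm hs0
  have e5 : 0 ≤ Λ * s ^ 2 := by positivity
  rw [cs_eq]
  nlinarith

lemma sys_or [CompactSpace X] {k : ℕ} (hX : IsAlexandrovSpace X k κ) (hr : |κ| * r ^ 2 ≤ 1 / 100)
    (hr0 : 0 < r) {E : Set X} (hE : IsExtremal κ E) {y0 : X} (hy0 : y0 ∈ E) {N : ℕ}
    {S : Fin (N + 1) → List (ℝ × X)} (hS : IsSys κ (r / 8) y0 S) :
    (N : ENNReal) ≤ dimH E ∨ ∃ z, y0 ≠ z ∧ dist y0 z ≤ r / 8 ∧ ∀ i, QL κ y0 (S i) z < 0 := by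
  obtain ⟨s0, hs0, hs0r, δ, hδ, hN⟩ := sys_nhd hS hr0
  have hnu : ∀ i, 0 ≤ nu (S i) := fun i => nu_nonneg fun w hw => (hS.pts i w hw).1
  let Λ := 1 + ∑ i, nu (S i)
  have hΛ : ∀ i, nu (S i) ≤ Λ := fun i => by
    have := Finset.single_le_sum (f := fun i => nu (S i)) (fun i _ => hnu i) (Finset.mem_univ i)
    simp only [Λ]; linarith
  have hΛ0 : 0 < Λ := by
    have := Finset.sum_nonneg (s := Finset.univ) (fun i _ => hnu i)
    simp only [Λ]; linarith
  let ε := δ / (4 * r * Λ)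
  have hε : 0 < ε := by positivity
  have hεΛ : ε * (2 * r * Λ) ≤ δ / 2 := by
    apply le_of_eq; simp only [ε]; field_simp; norm_num
  let s := min s0 (ε / (8 * Λ))
  have hs : 0 < s := by positivity
  have hs1 : s ≤ s0 := min_le_left _ _
  have hs2 : 4 * Λ * s < ε := by
    have : s ≤ ε / (8 * Λ) := min_le_right _ _
    rw [le_div_iff₀ (by positivity)] at this
    linarith
  by_cases hA : ∀ z ∈ E, dist z y0 = s → ∃ i, fL κ (S i) z - fL κ (S i) y0 < ε * s
  · left
    exact caseA hX hr hr0 hE hy0 hs hδ hε (hs1.trans hs0r) (fun y hy => hN y (hy.trans hs1)) hΛ hεΛ hA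
  · right
    push Not at hA
    obtain ⟨z, hz, hzs, h⟩ := hA
    rw [dist_comm] at hzs
    refine ⟨z, ?_, by linarith, fun i => ?_⟩
    · rintro rfl; simp at hzs; linarith
    · refine caseB hr (S i) (fun w hw => ⟨(hS.pts i w hw).1, ?_⟩) hzs hs (by linarith) (hΛ i) hΛ0 hs2 (h i)
      linarith [(hS.pts i w hw).2.2]

lemma Gam_single (y z : X) (W : List (ℝ × X)) : Gam κ y W [(1, z)] = QL κ y W z := by
  simp [Gam]

lemma sys_snoc {y0 : X} {N : ℕ} {S : Fin N → List (ℝ × X)} (hS : IsSys κ r y0 S) {z : X}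
    (h1 : y0 ≠ z) (h2 : dist y0 z ≤ r) (h3 : ∀ i, QL κ y0 (S i) z < 0) :
    IsSys κ r y0 (Fin.snoc S [(1, z)] : Fin (N + 1) → List (ℝ × X)) := by
  constructor
  · intro i
    refine Fin.lastCases ?_ (fun i => ?_) i
    · intro w hw
      rw [Fin.snoc_last] at hw
      simp only [List.mem_singleton] at hw
      subst hw
      exact ⟨one_pos, h1, h2⟩
    · rw [Fin.snoc_castSucc]; exact hS.pts i
  · intro i j
    refine Fin.lastCases ?_ (fun i => ?_) i <;> refine Fin.lastCases ?_ (fun j => ?_) j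
    · intro h; exact absurd rfl h
    · intro _; rw [Fin.snoc_castSucc, Fin.snoc_last, Gam_symm, Gam_single]; exact h3 j
    · intro _; rw [Fin.snoc_castSucc, Fin.snoc_last, Gam_single]; exact h3 i
    · intro h; rw [Fin.snoc_castSucc, Fin.snoc_castSucc]
      exact hS.neg i j (fun h' => h (by rw [h']))

lemma obtuse_bound {k : ℕ} (hX : IsAlexandrovSpace X k κ) (hr : |κ| * r ^ 2 ≤ 1 / 100) (hr0 : 0 < r)
    {y : X} {P : ℕ} (z : Fin P → X) (h1 : ∀ i, y ≠ z i) (h2 : ∀ i, dist y (z i) ≤ r)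
    (h3 : ∀ i j, i ≠ j → Q κ y (z i) (z j) < 0) : (P : ℝ) ≤ 32 ^ k := by
  have hρ : ∃ ρ > 0, 3 * ρ ≤ r ∧ ∀ i, ρ ≤ dist y (z i) := by
    have : ∀ᶠ ρ in nhdsWithin (0 : ℝ) (Ioi 0), 3 * ρ ≤ r ∧ ∀ i, ρ ≤ dist y (z i) := by
      refine Filter.Eventually.and ?_ ?_
      · have : ∀ᶠ ρ in nhds (0 : ℝ), ρ < r / 3 := continuousAt_id.eventually_lt_const (by simpa using hr0)
        filter_upwards [nhdsWithin_le_nhds this] with ρ h; linarith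
      · rw [Filter.eventually_all]; intro i
        have : ∀ᶠ ρ in nhds (0 : ℝ), ρ < dist y (z i) :=
          continuousAt_id.eventually_lt_const (by simpa using h1 i)
        filter_upwards [nhdsWithin_le_nhds this] with ρ h using h.le
    obtain ⟨ρ, h, h'⟩ := (this.and self_mem_nhdsWithin).exists
    exact ⟨ρ, h', h⟩
  obtain ⟨ρ, hρ, hρr, hρz⟩ := hρ
  have hb : ∀ i, ∃ b, dist y b = ρ ∧ dist b (z i) = dist y (z i) - ρ := fun i =>
    exists_btw hX y (z i) hρ.le (hρz i)
  choose b hb1 hb2 using hb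
  have sρ := (sn_loc (κ := κ) hr hρ.le (by linarith)).1
  have := doubling hX hr (y := y) (ε := 1) hρ hρr one_pos le_rfl b (fun i => (hb1 i).le) (by
    intro i j hij
    have si := (sn_loc (κ := κ) hr dist_nonneg (h2 i)).1
    have sj := (sn_loc (κ := κ) hr dist_nonneg (h2 j)).1
    have di := hρz i
    have dj := hρz j
    have q1 := shrink hX.curv hr (hb1 i) (hb2 i) (o := z j) (h2 i) (h2 j)
    have q2 : Q κ y (b i) (z j) < 0 := by
      have : sn κ ρ * Q κ y (z i) (z j) < 0 := mul_neg_of_pos_of_neg (by linarith) (h3 i j hij)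
      by_contra hn; push Not at hn
      have := mul_nonneg (show 0 ≤ sn κ (dist y (z i)) by linarith) hn
      linarith
    have q3 := shrink hX.curv hr (hb1 j) (hb2 j) (o := b i) (h2 j) (by rw [hb1]; linarith)
    rw [Q_symm y (z j)] at q3
    have q4 : Q κ y (b j) (b i) < 0 := by
      have : sn κ ρ * Q κ y (b i) (z j) < 0 := mul_neg_of_pos_of_neg (by linarith) q2
      by_contra hn; push Not at hn
      have := mul_nonneg (show 0 ≤ sn κ (dist y (z j)) by linarith) hn
      linarith
    by_contra hd; push Not at hd
    rw [one_mul] at hd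
    have hm := md_le_md (κ := κ) dist_nonneg hd.le (by
      have := loc_k (κ := κ) (u := ρ + dist (b i) (b j)) hr (by positivity) (by linarith)
      nlinarith [Real.pi_pos])
    unfold Q at q4
    rw [hb1, hb1, dist_comm (b j)] at q4
    have c := (cs_loc (κ := κ) (u := ρ) hr hρ.le (by linarith)).1
    rw [cs_eq] at c
    have m0 := md_nonneg κ ρ
    have := mul_nonneg m0 (show 0 ≤ 1 - κ * md κ ρ by linarith)
    linarith)
  simpa using this

/-- dimension lemma -/
lemma dim_lemma [CompactSpace X] {k : ℕ} (hX : IsAlexandrovSpace X k κ) (hr : |κ| * r ^ 2 ≤ 1 / 100)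
    (hr0 : 0 < r) {E : Set X} (hE : IsExtremal κ E) {y0 : X} (hy0 : y0 ∈ E) {N : ℕ}
    {S : Fin (N + 1) → List (ℝ × X)} (hS : IsSys κ (r / 8) y0 S) : (N : ENNReal) ≤ dimH E := by
  by_contra hlt
  have key : ∀ P : ℕ, ∃ z : Fin P → X, IsSys κ (r / 8) y0 (Fin.append S fun i => [((1 : ℝ), z i)]) := by
    intro P
    induction P with
    | zero =>
      refine ⟨fun i => y0, ?_⟩
      rw [Fin.append_right_nil _ _ rfl]
      exact hS
    | succ P ih =>
      obtain ⟨z, hz⟩ := ih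
      have hz' : IsSys κ (r / 8) y0 ((Fin.append S fun i => [((1 : ℝ), z i)]) ∘ Fin.cast (show (N + P) + 1 = N + 1 + P by omega)) :=
        ⟨fun i => hz.pts _, fun i j hij => hz.neg _ _ (fun h => hij (by simpa using h))⟩
      rcases sys_or hX hr hr0 hE hy0 hz' with h | ⟨w, h1, h2, h3⟩
      · exfalso; apply hlt
        refine le_trans ?_ h
        exact_mod_cast Nat.le_add_right _ _
      · have h3' : ∀ i, QL κ y0 ((Fin.append S fun i => [((1 : ℝ), z i)]) i) w < 0 := by
          intro i
          have := h3 (Fin.cast (show N + 1 + P = (N + P) + 1 by omega) i)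
          simpa using this
        have := sys_snoc hz h1 h2 h3'
        refine ⟨Fin.snoc z w, ?_⟩
        rw [← Fin.append_snoc] at this
        have e : (fun i => [((1 : ℝ), (Fin.snoc z w : Fin (P + 1) → X) i)]) =
            (Fin.snoc (fun i => [((1 : ℝ), z i)]) [((1 : ℝ), w)] : Fin (P + 1) → List (ℝ × X)) := by
          funext i
          refine Fin.lastCases ?_ (fun i => ?_) i
          · rw [Fin.snoc_last, Fin.snoc_last]
          · rw [Fin.snoc_castSucc, Fin.snoc_castSucc]
        rw [e]
        exact this
  obtain ⟨P, hP⟩ := exists_nat_gt ((32 : ℝ) ^ k)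
  obtain ⟨z, hz⟩ := key P
  have := obtuse_bound hX hr hr0 (y := y0) z
    (fun i => by
      have := hz.pts (Fin.natAdd _ i) (1, z i) (by simp)
      exact this.2.1)
    (fun i => by
      have := hz.pts (Fin.natAdd _ i) (1, z i) (by simp)
      linarith [this.2.2])
    (fun i j hij => by
      have := hz.neg (Fin.natAdd _ i) (Fin.natAdd _ j) (fun h => hij (by simpa using h))
      simpa [Gam, QL] using this)
  linarith

end Collapse

namespace Collapse

variable {κ : ℝ} {X : Type} [MetricSpace X] {r : ℝ}

lemma cl_dist (hr : |κ| * r ^ 2 ≤ 1 / 100) {q b x : X} {s : ℝ} (hq : 0 < dist q x) (hqr : dist q x ≤ r / 4)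
    (hs : 0 < s) (hs1 : s ≤ 1 / 100) (hb : dist q b ≤ 2 * s * dist q x)
    (h0 : 0 ≤ Q κ q b x) (h1 : Q κ q b x ≤ s ^ 2 * dist q x ^ 2) :
    |dist x b - dist q x| ≤ 5 * s ^ 2 * dist q x := by
  set l := dist q x with hl
  have hbr : dist q b ≤ r := by nlinarith
  have mb := (md_loc (κ := κ) hr dist_nonneg hbr)
  have cl := (cs_loc (κ := κ) hr hq.le (show l ≤ r by linarith))
  have hb2 : dist q b ^ 2 ≤ (2 * s * l) ^ 2 := pow_le_pow_left₀ dist_nonneg hb 2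
  have hxb : dist x b ≤ r := by
    have := dist_triangle_left x b q; nlinarith
  unfold Q at h0 h1
  rw [← hl] at h0 h1
  rw [cs_eq] at cl
  rw [dist_comm b x] at h0 h1
  have hsl : 0 < s ^ 2 * l ^ 2 := by positivity
  have e1 : md κ (dist q b) * (1 - κ * md κ l) ≤ 2.1 * (s ^ 2 * l ^ 2) := by
    have := mul_le_mul (show md κ (dist q b) ≤ 2.03 * (s ^ 2 * l ^ 2) by nlinarith) cl.2 (by linarith) (by positivity)
    nlinarith
  have e0 : 0 ≤ md κ (dist q b) * (1 - κ * md κ l) := mul_nonneg (md_nonneg _ _) (by linarith)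
  have f1 : md κ (dist x b) - md κ l ≤ 2.1 * (s ^ 2 * l ^ 2) := by nlinarith
  have f2 : md κ l - md κ (dist x b) ≤ s ^ 2 * l ^ 2 := by nlinarith
  rcases le_total l (dist x b) with h | h
  · have g := (md_sub_bounds (κ := κ) hq.le h (loc_e hr dist_nonneg hxb) (by norm_num)).1
    rw [abs_of_nonneg (by linarith)]
    have g2 : (dist x b - l) * l ≤ (5 * s ^ 2 * l) * l := by
      nlinarith [mul_nonneg (sub_nonneg.2 h) (sub_nonneg.2 h)]
    exact le_of_mul_le_mul_right g2 hq
  · have g := (md_sub_bounds (κ := κ) dist_nonneg h (loc_e hr hq.le (by linarith)) (by norm_num)).1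
    rw [abs_sub_comm, abs_of_nonneg (by linarith)]
    have g2 : (l - dist x b) * l ≤ (5 * s ^ 2 * l) * l := by
      have : 0 ≤ (l - dist x b) * dist x b := mul_nonneg (by linarith) dist_nonneg
      nlinarith
    exact le_of_mul_le_mul_right g2 hq

lemma cl_eps {k : ℕ} (R : ℝ) (hR : 0 < R) : ∃ ε0 > 0, ∀ ε, 0 < ε → ε ≤ ε0 →
    (32 / (5 / 2 * (ε / (80 * R)))) ^ k < (1 / ε) ^ ((k : ℝ) - 1 / 2) * (1 / (40 * (ε / (80 * R)))) := by
  set K := (1024 * R) ^ k / (2 * R) with hK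
  have hK0 : 0 < K := by positivity
  refine ⟨1 / (K + 1) ^ 2, by positivity, fun ε h0 h1 => ?_⟩
  have e1 : (K + 1) ≤ (1 / ε) ^ (1 / 2 : ℝ) := by
    rw [← Real.sqrt_eq_rpow]
    apply Real.le_sqrt_of_sq_le
    rw [le_div_iff₀ (by positivity)] at h1
    rw [le_div_iff₀ h0]; linarith
  have e2 : (32 / (5 / 2 * (ε / (80 * R)))) = (1024 * R) * (1 / ε) := by field_simp; norm_num
  have e3 : (1 / (40 * (ε / (80 * R)))) = 2 * R * (1 / ε) := by field_simp; norm_num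
  rw [e2, e3, mul_pow]
  have e4 : (1 / ε) ^ ((k : ℝ) - 1 / 2) * (1 / ε) = (1 / ε) ^ (1 / 2 : ℝ) * (1 / ε) ^ k := by
    have hp : 0 < 1 / ε := by positivity
    rw [← Real.rpow_natCast (1 / ε) k, ← Real.rpow_add hp]
    conv_lhs => rw [← Real.rpow_one (1 / ε), Real.rpow_one, ← Real.rpow_add_one hp.ne']
    congr 1; ring
  have e5 : (1024 * R) ^ k = K * (2 * R) := by rw [hK]; field_simp
  rw [e5]
  have hp : 0 < 2 * R * (1 / ε) ^ k := by positivity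
  have := mul_lt_mul_of_pos_left (show K < (1 / ε) ^ (1 / 2 : ℝ) by linarith) hp
  calc _ = 2 * R * (1 / ε) ^ k * K := by ring
    _ < _ := this
    _ = 2 * R * ((1 / ε) ^ (1 / 2 : ℝ) * (1 / ε) ^ k) := by ring
    _ = _ := by rw [← e4]; ring

lemma cl_Q (hX : CurvGE X κ) (hr : |κ| * r ^ 2 ≤ 1 / 100) {q a b x : X} {s τ c l : ℝ}
    (hl : dist q x = l) (hl0 : 0 < l) (hlr : l ≤ r) (hl2 : l ≤ 2 * c) (hqa : 0 < dist q a)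
    (hqar : dist q a ≤ r) (hb1 : dist q b = τ * dist q a) (hb2 : dist b a = dist q a - τ * dist q a)
    (hτ0 : 0 < τ) (hτ1 : τ ≤ 1) (t5 : τ * c ≤ s * l * s / 6)
    (hno : -(c * dist x q) < md κ (dist a x) - md κ (dist a q)) (hQ0 : 0 ≤ Q κ q b x) :
    Q κ q b x ≤ s ^ 2 * l ^ 2 := by
  have hc : 0 < c := by linarith
  have qa : Q κ q a x ≤ 2.1 * c * l := by
    rw [dist_comm x q, hl, dist_comm _ q] at hno
    have m := (md_loc (κ := κ) hr hl0.le hlr).2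
    have cc := cs_loc (κ := κ) (u := dist q a) hr dist_nonneg hqar
    rw [cs_eq] at cc
    have h1 := mul_le_mul m cc.2 (by linarith [cc.1]) (by positivity)
    unfold Q
    rw [hl]
    have : l * l ≤ 2 * c * l := mul_le_mul_of_nonneg_right hl2 hl0.le
    have : 0 < c * l := by positivity
    linarith
  have hτa : τ * dist q a ≤ dist q a := by nlinarith
  have hτa0 : 0 < τ * dist q a := by positivity
  have sh := shrink hX hr hb1 hb2 (o := x) hqar (by linarith)
  have s1 := (sn_loc (κ := κ) (u := dist q a) hr dist_nonneg hqar).1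
  obtain ⟨s2', s2⟩ := sn_loc (κ := κ) (u := τ * dist q a) hr hτa0.le (by linarith)
  have t1 : 99 / 100 * dist q a * Q κ q b x ≤ sn κ (dist q a) * Q κ q b x :=
    mul_le_mul_of_nonneg_right s1 hQ0
  have t2 : sn κ (τ * dist q a) * Q κ q a x ≤ (101 / 100 * (τ * dist q a)) * (2.1 * c * l) :=
    (mul_le_mul_of_nonneg_left qa (by linarith)).trans (mul_le_mul_of_nonneg_right s2 (by positivity))
  have t3 : dist q a * (99 / 100 * Q κ q b x) ≤ dist q a * (101 / 100 * τ * (2.1 * c * l)) := by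
    linarith
  have t4 := le_of_mul_le_mul_left t3 hqa
  have t6 := mul_le_mul_of_nonneg_right t5 hl0.le
  have t7 : 0 ≤ s ^ 2 * l ^ 2 := by positivity
  linarith

set_option maxHeartbeats 1000000 in
lemma cluster1 [CompactSpace X] {k : ℕ} (hX : IsAlexandrovSpace X k κ) (hk : 1 ≤ k)
    (hr : |κ| * r ^ 2 ≤ 1 / 100) (hr0 : 0 < r) {p a : X} (hpa : p ≠ a) (hpar : dist p a ≤ r / 32)
    (σ : ℝ) (hσ : 0 < σ) : ∃ T : Finset X, (∀ a' ∈ T, dist a' a < σ) ∧ ∃ c0 > 0, ∀ c, 0 < c → c ≤ c0 →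
      ∀ q x, dist q p ≤ c → dist x p ≤ c → q ≠ x →
      (∀ a' ∈ T, -(c * dist x q) < md κ (dist a' x) - md κ (dist a' q)) →
      ∃ a' ∈ T, ∃ b, q ≠ b ∧ dist b a' = dist q a' - dist q b ∧ Q κ q b x < 0 := by
  classical
  set R := dist p a with hRdef
  have hR : 0 < R := dist_pos.2 hpa
  obtain ⟨ε0, hε0, hε0'⟩ := cl_eps (k := k) R hR
  have hσ' : 0 < min σ (R / 4) := by positivity
  have hd : (((k : ℝ) - 1 / 2).toNNReal : ENNReal) < dimH (ball a (min σ (R / 4))) := by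
    refine lt_of_lt_of_le ?_ (dim_ball hX a _ hσ')
    have : ((k : ℝ) - 1 / 2).toNNReal < (k : NNReal) := by
      rw [Real.toNNReal_lt_iff_lt_coe]
      · simp
      · have : (1 : ℝ) ≤ k := by exact_mod_cast hk
        linarith
    exact_mod_cast this
  obtain ⟨ε, hε, hε1, T, hT1, hT2, hT3⟩ := exists_separated hd (min ε0 (R / 2)) (by positivity)
  have hεR : ε ≤ R / 2 := hε1.trans (min_le_right _ _)
  rw [Real.coe_toNNReal _ (by have : (1 : ℝ) ≤ k := by exact_mod_cast hk
                              linarith)] at hT3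
  set s := ε / (80 * R) with hs
  have hs0 : 0 < s := by positivity
  have hεs : ε = 80 * s * R := by rw [hs]; field_simp
  have hs1 : s ≤ 1 / 100 := by rw [hs, div_le_iff₀ (by positivity)]; linarith
  have hcard := hε0' ε hε (hε1.trans (min_le_left _ _))
  rw [← hs] at hcard
  refine ⟨T, fun a' h => (mem_ball.1 (hT1 h)).trans_le (min_le_left _ _), min (R / 4) (s * R / 6), by positivity,
    fun c hc hcc q x hq hx hqx hno => ?_⟩
  have hc1 : c ≤ R / 4 := hcc.trans (min_le_left _ _)
  have hc2 : c ≤ s * R / 6 := hcc.trans (min_le_right _ _)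
  by_contra hcon
  push Not at hcon
  set l := dist q x with hl
  have hl0 : 0 < l := dist_pos.2 hqx
  have hl2 : l ≤ 2 * c := by
    have := dist_triangle_right q x p; linarith
  have hTR : ∀ a' ∈ T, R / 2 ≤ dist q a' ∧ dist q a' ≤ 2 * R := by
    intro a' h
    have h1 := (mem_ball.1 (hT1 h)).trans_le (min_le_right _ _)
    have h2 := dist_triangle4 p q a' a
    have h3 := dist_triangle4 q p a a'
    rw [dist_comm p q] at h2
    rw [dist_comm a a'] at h3
    constructor <;> linarith
  set τ := s * l / R with hτ
  have hτ0 : 0 < τ := by positivity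
  have hτR : τ * R = s * l := by rw [hτ]; field_simp
  have hτ1 : τ ≤ 1 := by rw [hτ, div_le_one hR]; nlinarith
  have hb : ∀ a' : T, ∃ b, dist q b = τ * dist q a' ∧ dist b a' = dist q a' - τ * dist q a' := fun a' =>
    exists_btw hX q a' (by positivity) (by nlinarith [dist_nonneg (x := q) (y := (a' : X))])
  choose b hb1 hb2 using hb
  have hβ : ∀ a' : T, dist q (b a') ≤ 2 * s * l ∧ 0 < dist q (b a') := by
    intro a'
    obtain ⟨h1, h2⟩ := hTR a' a'.2
    rw [hb1]
    constructor
    · have := mul_le_mul_of_nonneg_left h2 hτ0.le; linarith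
    · have := mul_le_mul_of_nonneg_left h1 hτ0.le
      have : 0 < τ * R := by positivity
      linarith
  have hsl : s * l ≤ l / 100 := by nlinarith
  have hlr : l ≤ r / 64 := by linarith
  have hxb : ∀ a' : T, |dist x (b a') - l| ≤ 5 * s ^ 2 * l := by
    intro a'
    obtain ⟨h1, h2⟩ := hTR a' a'.2
    obtain ⟨k1, k2⟩ := hβ a'
    have hQ0 := hcon a' a'.2 (b a') (dist_pos.1 k2) (by rw [hb2, hb1])
    have t5 : τ * c ≤ s * l * s / 6 := by
      have := mul_le_mul_of_nonneg_left hc2 hτ0.le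
      calc τ * c ≤ τ * (s * R / 6) := this
        _ = (τ * R) * s / 6 := by ring
        _ = _ := by rw [hτR]
    have bound : Q κ q (b a') x ≤ s ^ 2 * l ^ 2 := cl_Q hX.curv hr hl.symm hl0 (by linarith) hl2 (by linarith)
      (by linarith) (hb1 a') (hb2 a') hτ0 hτ1 t5 (hno a' a'.2) hQ0
    exact cl_dist hr hl0 (by linarith) hs0 hs1 k1 hQ0 bound
  set N := ⌊1 / (40 * s)⌋₊ + 1 with hN
  have hNr : 1 / (40 * s) ≤ (N : ℝ) := by
    rw [hN]; push_cast; exact (Nat.lt_floor_add_one _).le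
  have hi : ∀ i : Fin N, 40 * s ^ 2 * (i : ℝ) ≤ s := by
    intro i
    have h1 : ((i : ℕ) : ℝ) ≤ 1 / (40 * s) := by
      have : (i : ℕ) ≤ ⌊1 / (40 * s)⌋₊ := by have := i.2; omega
      exact (Nat.le_floor_iff (by positivity)).1 this
    rw [le_div_iff₀ (by positivity)] at h1
    have := mul_le_mul_of_nonneg_right h1 hs0.le
    nlinarith
  have hl' : ∀ i : Fin N, 0 ≤ 40 * s ^ 2 * (i : ℝ) := fun i => by positivity
  have hc' : ∀ u : T × Fin N, ∃ z, dist x z = (1 - 40 * s ^ 2 * (u.2 : ℝ)) * dist x (b u.1) ∧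
      dist z (b u.1) = dist x (b u.1) - (1 - 40 * s ^ 2 * (u.2 : ℝ)) * dist x (b u.1) := fun u =>
    exists_btw hX x (b u.1) (by
      have := hi u.2; exact mul_nonneg (by linarith) dist_nonneg) (by
      have := mul_nonneg (hl' u.2) (dist_nonneg (x := x) (y := b u.1)); linarith)
  choose z hz1 hz2 using hc'
  have hs2l : s ^ 2 * l ≤ s * l / 100 := by
    have := mul_le_mul_of_nonneg_right hs1 (show 0 ≤ s * l by positivity); nlinarith
  have hs2l0 : 0 < s ^ 2 * l := by positivity
  have hxbl : ∀ a' : T, dist x (b a') ≤ 2 * l ∧ 99 / 100 * l ≤ dist x (b a') := fun a' => by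
    have := abs_le.1 (hxb a'); constructor <;> linarith [this.1, this.2]
  have hbsep : ∀ a1 a2 : T, a1 ≠ a2 → 40 * s ^ 2 * l ≤ dist (b a1) (b a2) := by
    intro a1 a2 h12
    have h := hT2 a1 a1.2 a2 a2.2 (fun h => h12 (Subtype.ext h))
    have d1 := (hTR a1 a1.2).2
    have d2 := (hTR a2 a2.2).2
    have dd : dist (a1 : X) a2 ≤ 4 * R := by
      have := dist_triangle_left (a1 : X) a2 q; linarith
    have := contr hX.curv hr hτ0.le hτ1 (hb1 a1) (hb2 a1) (hb1 a2) (hb2 a2) (by linarith) (by linarith) (by linarith)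
    have h' := mul_le_mul_of_nonneg_left h (show 0 ≤ τ / 2 by positivity)
    have : τ / 2 * ε = 40 * s ^ 2 * l := by
      rw [hεs]; calc τ / 2 * (80 * s * R) = 40 * s * (τ * R) := by ring
        _ = _ := by rw [hτR]; ring
    linarith
  have hdb := doubling hX hr (y := q) (ρ := 4 * s * l) (ε := 5 / 2 * s) (by positivity) (by linarith)
    (by positivity) (by linarith) z (by
      intro u
      have h1 := dist_triangle q (b u.1) (z u)
      have h2 := (hβ u.1).1
      have h3 := hz2 u
      rw [dist_comm] at h3
      have h4 := mul_le_mul (hi u.2) (hxbl u.1).1 dist_nonneg hs0.le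
      nlinarith) (by
      intro u v huv
      have e : 5 / 2 * s * (4 * s * l) = 10 * (s ^ 2 * l) := by ring
      rw [e]
      by_cases h2 : u.2 = v.2
      · have h1 : u.1 ≠ v.1 := fun h => huv (Prod.ext h h2)
        have hd := hbsep _ _ h1
        have hv1 := hz1 v
        have hv2 := hz2 v
        rw [← h2] at hv1 hv2
        have hii := hi u.2
        have dd : dist (b u.1) (b v.1) ≤ 4 * l := by
          have := dist_triangle_left (b u.1) (b v.1) x
          linarith [(hxbl u.1).1, (hxbl v.1).1]
        have := contr hX.curv hr (by linarith) (by linarith [hl' u.2]) (hz1 u) (hz2 u) hv1 hv2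
          (by linarith [(hxbl u.1).1]) (by linarith [(hxbl v.1).1]) (by linarith)
        have h5 := mul_le_mul (show (1 / 4 : ℝ) ≤ (1 - 40 * s ^ 2 * (u.2 : ℝ)) / 2 by linarith) hd (by positivity) (by linarith)
        linarith
      · -- different levels
        have hgen : ∀ u v : T × Fin N, (u.2 : ℕ) < (v.2 : ℕ) → 10 * (s ^ 2 * l) ≤ dist (z u) (z v) := by
          intro u v hlt
          have h1 : ((u.2 : ℕ) : ℝ) + 1 ≤ ((v.2 : ℕ) : ℝ) := by exact_mod_cast hlt
          have h3 := dist_triangle x (z v) (z u)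
          rw [dist_comm (z v), hz1, hz1] at h3
          have du := (abs_le.1 (hxb u.1)).1
          have dv := (abs_le.1 (hxb v.1)).2
          have h4 := mul_le_mul_of_nonneg_left h1 (show 0 ≤ 40 * s ^ 2 by positivity)
          have h5 := mul_le_mul_of_nonneg_right (show 1 - 40 * s ^ 2 * (v.2 : ℝ) ≤ 1 - 40 * s ^ 2 * (u.2 : ℝ) - 40 * s ^ 2 by linarith) (dist_nonneg (x := x) (y := b v.1))
          have h6 := hi u.2
          have h7 : (1 - 40 * s ^ 2 * (u.2 : ℝ)) * (dist x (b v.1) - dist x (b u.1)) ≤ 10 * (s ^ 2 * l) := by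
            have t0 : dist x (b v.1) - dist x (b u.1) ≤ 10 * (s ^ 2 * l) := by linarith
            have t1 : 0 ≤ 1 - 40 * s ^ 2 * (u.2 : ℝ) := by linarith
            have t2 := mul_le_mul_of_nonneg_left t0 t1
            have t3 := mul_nonneg (hl' u.2) (show 0 ≤ 10 * (s ^ 2 * l) by positivity)
            linarith
          have h8 := mul_le_mul_of_nonneg_left (hxbl v.1).2 (show 0 ≤ 40 * s ^ 2 by positivity)
          linarith
        rcases lt_or_gt_of_ne (fun h => h2 (Fin.ext h) : (u.2 : ℕ) ≠ (v.2 : ℕ)) with h | h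
        · exact hgen u v h
        · rw [dist_comm]; exact hgen v u h)
  rw [Fintype.card_prod, Fintype.card_coe, Fintype.card_fin] at hdb
  push_cast at hdb
  have hmul : (1 / ε) ^ ((k : ℝ) - 1 / 2) * (1 / (40 * s)) ≤ (T.card : ℝ) * (N : ℝ) :=
    mul_le_mul hT3 hNr (one_div_nonneg.2 (mul_nonneg (by norm_num) hs0.le)) (Nat.cast_nonneg _)
  linarith

end Collapse

namespace Collapse

variable {κ : ℝ} {X : Type} [MetricSpace X] {r : ℝ}

lemma Q_lip_a (hr : |κ| * r ^ 2 ≤ 1 / 100) {y a a' b : X} (h1 : dist y a ≤ r) (h2 : dist y b ≤ r)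
    (h3 : dist y a' ≤ r) (h4 : dist a b ≤ r) (h5 : dist a' b ≤ r) :
    |Q κ y a' b - Q κ y a b| ≤ 4 * r * dist a a' := by
  have r0 : 0 ≤ r := dist_nonneg.trans h1
  have ma := md_lip (κ := κ) hr dist_nonneg dist_nonneg h3 h1
  have mb := md_lip (κ := κ) hr dist_nonneg dist_nonneg h5 h4
  have da : |dist y a' - dist y a| ≤ dist a a' := by
    have := abs_dist_sub_le a' a y
    rw [dist_comm a a', dist_comm y, dist_comm y]; exact this
  have db : |dist a' b - dist a b| ≤ dist a a' := by rw [dist_comm a a']; exact abs_dist_sub_le _ _ _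
  have ma' := ma.trans (mul_le_mul_of_nonneg_left da (by positivity))
  have mb' := mb.trans (mul_le_mul_of_nonneg_left db (by positivity))
  have c1 := (cs_loc (κ := κ) hr dist_nonneg h2)
  have e : Q κ y a' b - Q κ y a b = (md κ (dist y a') - md κ (dist y a)) * cs κ (dist y b) -
      (md κ (dist a' b) - md κ (dist a b)) := by
    unfold Q; rw [cs_eq]; ring
  rw [e]
  refine (abs_sub _ _).trans ?_
  rw [abs_mul, abs_of_nonneg (by linarith : 0 ≤ cs κ (dist y b))]
  have k1 := mul_le_mul ma' c1.2 (by linarith) (by positivity)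
  have : 0 ≤ r * dist a a' := by positivity
  linarith

lemma Gam_map_le {p q : X} (G : ℝ × X → ℝ × X) {e : ℝ} (W V : List (ℝ × X))
    (h : ∀ w ∈ W, ∀ v ∈ V, (G w).1 * (G v).1 * Q κ q (G w).2 (G v).2 ≤ w.1 * v.1 * (Q κ p w.2 v.2 + e)) :
    Gam κ q (W.map G) (V.map G) ≤ Gam κ p W V + e * nu W * nu V := by
  induction V with
  | nil => simp [Gam, nu]
  | cons v V ih =>
    have a := ih (fun w hw v hv => h w hw v (List.mem_cons_of_mem _ hv))
    have b : (G v).1 * QL κ q (W.map G) (G v).2 ≤ v.1 * QL κ p W v.2 + e * nu W * v.1 := by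
      have hv : ∀ w ∈ W, (G w).1 * (G v).1 * Q κ q (G w).2 (G v).2 ≤ w.1 * v.1 * (Q κ p w.2 v.2 + e) :=
        fun w hw => h w hw v List.mem_cons_self
      clear ih a h
      induction W with
      | nil => simp [QL, nu]
      | cons w W ih =>
        have c := ih (fun w hw => hv w (List.mem_cons_of_mem _ hw))
        have d := hv w List.mem_cons_self
        rw [List.map_cons, QL_cons, QL_cons, nu_cons]
        nlinarith
    rw [List.map_cons, Gam_cons, Gam_cons, nu_cons]
    nlinarith

lemma QL_neg {q x : X} (W : List (ℝ × X)) (hne : W ≠ []) (h : ∀ w ∈ W, w.1 * Q κ q w.2 x < 0) :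
    QL κ q W x < 0 := by
  induction W with
  | nil => exact absurd rfl hne
  | cons w W ih =>
    rw [QL_cons]
    have a := h w List.mem_cons_self
    rcases W.eq_nil_or_concat with rfl | _
    · simpa [QL] using a
    · rcases eq_or_ne W [] with rfl | hW
      · simpa [QL] using a
      · have := ih hW (fun w hw => h w (List.mem_cons_of_mem _ hw)); linarith

lemma sn_mul_Q_le (hX : CurvGE X κ) (hr : |κ| * r ^ 2 ≤ 1 / 100) {q a b o : X} (hqb : q ≠ b)
    (hb : dist b a = dist q a - dist q b) (ha : dist q a ≤ r) (ho : dist q o ≤ r) :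
    0 < sn κ (dist q a) / sn κ (dist q b) ∧
    sn κ (dist q a) / sn κ (dist q b) * Q κ q b o ≤ Q κ q a o := by
  have h0 : 0 < dist q b := dist_pos.2 hqb
  have h1 : dist q b ≤ dist q a := by have := dist_nonneg (x := b) (y := a); linarith
  have s1 := (sn_loc (κ := κ) hr h0.le (h1.trans ha)).1
  have s2 := (sn_loc (κ := κ) hr dist_nonneg ha).1
  have sp : 0 < sn κ (dist q b) := by linarith
  refine ⟨div_pos (by linarith) sp, ?_⟩
  have := shrink hX hr (o := o) rfl hb ha ho
  rw [div_mul_eq_mul_div, div_le_iff₀ sp]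
  linarith

set_option maxHeartbeats 1000000 in
lemma key_A [CompactSpace X] {k m : ℕ} (hX : IsAlexandrovSpace X k κ) (hk : 1 ≤ k)
    (hr : |κ| * r ^ 2 ≤ 1 / 100) (hr0 : 0 < r) {E : Set X} (hE : IsExtremal κ E) (hdim : dimH E = m)
    {p : X} {S : Fin (m + 1) → List (ℝ × X)} (hS : IsSys κ (r / 32) p S) (hne : ∀ i, S i ≠ []) :
    ∃ A : Finset X, A.Nonempty ∧ (∀ a ∈ A, dist p a ≤ r / 16) ∧ ∃ c > 0, ∀ q ∈ E, ∀ x, dist q p ≤ c → dist x p ≤ c →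
      ∃ a ∈ A, md κ (dist a x) - md κ (dist a q) ≤ -(c * dist x q) := by
  classical
  have he : ∃ e > 0, ∀ i j, i ≠ j → Gam κ p (S i) (S j) + e * nu (S i) * nu (S j) < 0 := by
    have : ∀ᶠ e in nhdsWithin (0 : ℝ) (Ioi 0), ∀ i j, i ≠ j → Gam κ p (S i) (S j) + e * nu (S i) * nu (S j) < 0 := by
      rw [Filter.eventually_all]; intro i
      rw [Filter.eventually_all]; intro j
      by_cases hij : i = j
      · exact Filter.Eventually.of_forall fun _ h => absurd hij h
      · have h := hS.neg i j hij
        have h2 : ∀ᶠ e in nhds (0 : ℝ), Gam κ p (S i) (S j) + e * nu (S i) * nu (S j) < 0 := by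
          have : Continuous fun e : ℝ => Gam κ p (S i) (S j) + e * nu (S i) * nu (S j) := by fun_prop
          exact this.continuousAt.eventually_lt_const (by simpa using h)
        filter_upwards [nhdsWithin_le_nhds h2] with δ hδ _ using hδ
    obtain ⟨δ, h1, h2⟩ := (this.and self_mem_nhdsWithin).exists
    exact ⟨δ, h2, h1⟩
  obtain ⟨e, he0, he⟩ := he
  let σ := min (e / (12 * r)) (r / 32)
  have hσ0 : 0 < σ := by positivity
  have hσr : σ ≤ r / 32 := min_le_right _ _
  have hσe : 12 * r * σ ≤ e := by
    have : σ ≤ e / (12 * r) := min_le_left _ _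
    rw [le_div_iff₀ (by positivity)] at this; linarith
  have hT : ∀ a : X, ∃ T : Finset X, (∀ a' ∈ T, dist a' a < σ) ∧ ∃ c0 > 0, p ≠ a → dist p a ≤ r / 32 → ∀ c, 0 < c → c ≤ c0 →
      ∀ q x, dist q p ≤ c → dist x p ≤ c → q ≠ x →
      (∀ a' ∈ T, -(c * dist x q) < md κ (dist a' x) - md κ (dist a' q)) →
      ∃ a' ∈ T, ∃ b, q ≠ b ∧ dist b a' = dist q a' - dist q b ∧ Q κ q b x < 0 := by
    intro a
    by_cases h : p ≠ a ∧ dist p a ≤ r / 32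
    · obtain ⟨T, h1, c0, h2, h3⟩ := cluster1 hX hk hr hr0 h.1 h.2 σ hσ0
      exact ⟨T, h1, c0, h2, fun _ _ => h3⟩
    · exact ⟨∅, by simp, 1, one_pos, fun h1 h2 => absurd ⟨h1, h2⟩ h⟩
  choose T hTσ c0 hc0 hT using hT
  let F : Finset X := Finset.univ.biUnion fun i => ((S i).map Prod.snd).toFinset
  have hFmem : ∀ i, ∀ w ∈ S i, w.2 ∈ F := by
    intro i w hw
    simp only [F, Finset.mem_biUnion, Finset.mem_univ, true_and, List.mem_toFinset]
    exact ⟨i, List.mem_map_of_mem hw⟩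
  have hFp : ∀ a ∈ F, p ≠ a ∧ dist p a ≤ r / 32 := by
    intro a ha
    simp only [F, Finset.mem_biUnion, Finset.mem_univ, true_and, List.mem_toFinset] at ha
    obtain ⟨i, hi⟩ := ha
    obtain ⟨w, hw, rfl⟩ := List.mem_map.1 hi
    exact ⟨(hS.pts i w hw).2.1, (hS.pts i w hw).2.2⟩
  have hFne : F.Nonempty := by
    obtain ⟨w, hw⟩ := List.exists_mem_of_ne_nil _ (hne 0)
    exact ⟨w.2, hFmem 0 w hw⟩
  have hc : ∃ c > 0, c ≤ σ ∧ ∀ a ∈ F, c ≤ c0 a := by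
    refine ⟨min σ (F.inf' hFne c0), lt_min hσ0 ((Finset.lt_inf'_iff _).2 fun a _ => hc0 a), min_le_left _ _, fun a ha => ?_⟩
    exact (min_le_right _ _).trans (Finset.inf'_le _ ha)
  obtain ⟨c, hc, hcσ, hcF⟩ := hc
  have hTd : ∀ a ∈ F, ∀ a' ∈ T a, dist p a' ≤ r / 16 := fun a ha a' ha' => by
    have h1 := (hFp a ha).2
    have h2 := hTσ a a' ha'
    have := dist_triangle_right p a' a
    linarith
  refine ⟨F ∪ F.biUnion T, hFne.mono Finset.subset_union_left, ?_, c, hc, fun q hqE x hq hx => ?_⟩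
  · intro a ha
    rcases Finset.mem_union.1 ha with ha | ha
    · linarith [(hFp a ha).2]
    · obtain ⟨a0, h0, h1⟩ := Finset.mem_biUnion.1 ha
      exact hTd a0 h0 a h1
  by_contra hcon
  push Not at hcon
  have hqx : q ≠ x := by
    rintro rfl
    obtain ⟨a, ha⟩ := hFne
    have := hcon a (Finset.mem_union_left _ ha)
    simp at this
  have hg : ∀ a : X, ∃ g : X × X, a ∈ F → g.1 ∈ T a ∧ q ≠ g.2 ∧ dist g.2 g.1 = dist q g.1 - dist q g.2 ∧ Q κ q g.2 x < 0 := by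
    intro a
    by_cases ha : a ∈ F
    · obtain ⟨a', h1, b, h2, h3, h4⟩ := hT a (hFp a ha).1 (hFp a ha).2 c hc (hcF a ha) q x hq hx hqx
        (fun a' ha' => hcon a' (Finset.mem_union_right _ (Finset.mem_biUnion.2 ⟨a, ha, ha'⟩)))
      exact ⟨(a', b), fun _ => ⟨h1, h2, h3, h4⟩⟩
    · exact ⟨(a, a), fun h => absurd h ha⟩
  choose g hg using hg
  have hqa : ∀ a ∈ F, dist q (g a).1 ≤ r / 8 := fun a ha => by
    have := hTd a ha _ (hg a ha).1
    have := dist_triangle q p (g a).1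
    linarith
  have hqb : ∀ a ∈ F, dist q (g a).2 ≤ r / 8 := fun a ha => by
    have := (hg a ha).2.2.1
    have := hqa a ha
    linarith [dist_nonneg (x := (g a).2) (y := (g a).1)]
  have hqxr : dist q x ≤ r / 8 := by
    have := dist_triangle_right q x p; linarith
  let G : ℝ × X → ℝ × X := fun w => (w.1 * (sn κ (dist q (g w.2).1) / sn κ (dist q (g w.2).2)), (g w.2).2)
  have hGs : ∀ a ∈ F, ∀ o, dist q o ≤ r → 0 < sn κ (dist q (g a).1) / sn κ (dist q (g a).2) ∧
      sn κ (dist q (g a).1) / sn κ (dist q (g a).2) * Q κ q (g a).2 o ≤ Q κ q (g a).1 o := fun a ha o ho =>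
    sn_mul_Q_le hX.curv hr (hg a ha).2.1 (hg a ha).2.2.1 (by linarith [hqa a ha]) ho
  have hsys : IsSys κ (r / 8) q (fun i => (S i).map G) := by
    constructor
    · intro i w hw
      obtain ⟨v, hv, rfl⟩ := List.mem_map.1 hw
      have hvF := hFmem i v hv
      exact ⟨mul_pos (hS.pts i v hv).1 (hGs _ hvF q (by simp; linarith)).1, (hg _ hvF).2.1, hqb _ hvF⟩
    · intro i j hij
      refine lt_of_le_of_lt (Gam_map_le (p := p) (e := e) G (S i) (S j) ?_) (he i j hij)
      intro w hw v hv
      have hwF := hFmem i w hw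
      have hvF := hFmem j v hv
      have hw0 := (hS.pts i w hw).1
      have hv0 := (hS.pts j v hv).1
      have qa := hqa _ hwF
      have qa' := hqa _ hvF
      have qb := hqb _ hwF
      have qb' := hqb _ hvF
      obtain ⟨p1, i1⟩ := hGs _ hwF (g v.2).2 (by linarith)
      obtain ⟨p2, i2⟩ := hGs _ hvF (g w.2).1 (by linarith)
      have i3 := mul_le_mul_of_nonneg_left i1 p2.le
      rw [Q_symm q (g v.2).2] at i2
      rw [Q_symm q (g v.2).1] at i2
      -- perturbation
      have dw := hTσ _ _ (hg _ hwF).1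
      have dv := hTσ _ _ (hg _ hvF).1
      have pw := (hFp _ hwF).2
      have pv := (hFp _ hvF).2
      have paw := hTd _ hwF _ (hg _ hwF).1
      have pav := hTd _ hvF _ (hg _ hvF).1
      have L1 := (abs_le.1 (Q_lip (κ := κ) hr (y := p) (y1 := q) (a := (g w.2).1) (b := (g v.2).1) (by linarith) (by linarith) (by linarith) (by linarith))).2
      have t1 := dist_triangle_left (g w.2).1 (g v.2).1 p
      have t2 := dist_triangle_left w.2 (g v.2).1 p
      have t3 := dist_triangle_left v.2 w.2 p
      have L2 := (abs_le.1 (Q_lip_a (κ := κ) hr (y := p) (a := w.2) (a' := (g w.2).1) (b := (g v.2).1) (by linarith) (by linarith) (by linarith) (by linarith) (by linarith))).2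
      have L3 := (abs_le.1 (Q_lip_a (κ := κ) hr (y := p) (a := v.2) (a' := (g v.2).1) (b := w.2) (by linarith) (by linarith) (by linarith) (by linarith) (by
        rw [dist_comm]; linarith))).2
      rw [Q_symm p (g v.2).1, Q_symm p v.2] at L3
      rw [dist_comm _ w.2] at dw
      rw [dist_comm _ v.2] at dv
      rw [dist_comm p q] at L1
      have m1 := mul_le_mul_of_nonneg_left (hq.trans hcσ) (show 0 ≤ 4 * r by positivity)
      have m2 := mul_le_mul_of_nonneg_left dw.le (show 0 ≤ 4 * r by positivity)
      have m3 := mul_le_mul_of_nonneg_left dv.le (show 0 ≤ 4 * r by positivity)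
      have fin : Q κ q (g w.2).1 (g v.2).1 ≤ Q κ p w.2 v.2 + e := by linarith
      simp only [G]
      have := mul_le_mul_of_nonneg_left ((i3.trans i2).trans fin) (mul_pos hw0 hv0).le
      linarith
  have hsys2 := sys_snoc hsys hqx hqxr (fun i => by
    refine QL_neg _ (by simpa using hne i) ?_
    intro w hw
    obtain ⟨v, hv, rfl⟩ := List.mem_map.1 hw
    have hvF := hFmem i v hv
    exact mul_neg_of_pos_of_neg (mul_pos (hS.pts i v hv).1 (hGs _ hvF q (by simp; linarith)).1) (hg _ hvF).2.2.2)
  have := dim_lemma hX hr hr0 hE hqE hsys2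
  rw [hdim] at this
  have h2 : m + 1 ≤ m := by exact_mod_cast this
  omega

end Collapse

namespace Collapse

/-- discrete gradient-curve relation -/
structure Rel {M : Type} [MetricSpace M] (f : M → ℝ) (L C ε : ℝ) (z : M) (h : ℝ) (z' : M) : Prop where
  d : dist z z' ≤ L * h
  e : ∀ y, dist z' y ^ 2 ≤ dist z y ^ 2 + 2 * h * (f z - f y + dist z y ^ 2 + ε) + C * h ^ 2

section flow
variable {M : Type} [MetricSpace M] {f : M → ℝ} {L C ε D : ℝ}

lemma Rel.refl (z : M) : Rel f L C ε z 0 z := ⟨by simp, fun y => by simp⟩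

lemma Rel.trans (hL : 0 ≤ L) (hD : ∀ x y : M, dist x y ≤ D) (hf : ∀ x y, |f x - f y| ≤ L * dist x y)
    (hC : C = L ^ 2 + 2 * D * L) {z z' z'' : M} {h1 h2 : ℝ} (h10 : 0 ≤ h1) (h20 : 0 ≤ h2)
    (a : Rel f L C ε z h1 z') (b : Rel f L C ε z' h2 z'') : Rel f L C ε z (h1 + h2) z'' := by
  constructor
  · have := dist_triangle z z' z''; linarith [a.d, b.d]
  · intro y
    have e1 := a.e y
    have e2 := b.e y
    have h3 : f z' ≤ f z + L * (L * h1) := by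
      have := (abs_le.1 (hf z z')).1
      have := mul_le_mul_of_nonneg_left a.d hL; linarith
    have h4 : dist z' y ^ 2 ≤ dist z y ^ 2 + 2 * D * (L * h1) := by
      have t := dist_triangle_left z' y z
      have t1 : dist z' y - dist z y ≤ L * h1 := by linarith [a.d]
      have t2 : 0 ≤ dist z' y + dist z y := by positivity
      have t3 : dist z' y + dist z y ≤ 2 * D := by linarith [hD z' y, hD z y]
      have t4 : (dist z' y - dist z y) * (dist z' y + dist z y) ≤ (L * h1) * (dist z' y + dist z y) :=
        mul_le_mul_of_nonneg_right t1 t2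
      have t5 := mul_le_mul_of_nonneg_left t3 (show 0 ≤ L * h1 by positivity)
      nlinarith
    have h5 : 2 * h2 * (f z' - f y + dist z' y ^ 2 + ε) ≤
        2 * h2 * (f z - f y + dist z y ^ 2 + ε + (L ^ 2 + 2 * D * L) * h1) :=
      mul_le_mul_of_nonneg_left (by nlinarith) (by positivity)
    rw [← hC] at h5
    nlinarith

lemma Rel.lim {ι : Type} {l : Filter ι} [l.NeBot] (hf : Continuous f) {e h : ι → ℝ} {z z' : ι → M}
    {e0 h0 : ℝ} {z0 z0' : M} (he : Filter.Tendsto e l (nhds e0)) (hh : Filter.Tendsto h l (nhds h0))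
    (hz : Filter.Tendsto z l (nhds z0)) (hz' : Filter.Tendsto z' l (nhds z0'))
    (hR : ∀ i, Rel f L C (e i) (z i) (h i) (z' i)) : Rel f L C e0 z0 h0 z0' := by
  constructor
  · exact le_of_tendsto_of_tendsto' (hz.dist hz') (hh.const_mul L) (fun i => (hR i).d)
  · intro y
    refine le_of_tendsto_of_tendsto' ((hz'.dist tendsto_const_nhds).pow 2) ?_ (fun i => (hR i).e y)
    have hfz := (hf.tendsto z0).comp hz
    have hd := (hz.dist (tendsto_const_nhds (x := y))).pow 2
    exact (hd.add (((hh.const_mul 2)).mul (((hfz.sub_const _).add hd).add he))).add ((hh.pow 2).const_mul C)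

lemma exact_step [CompactSpace M] (hL : 0 ≤ L) (hD : ∀ x y : M, dist x y ≤ D)
    (hf : ∀ x y, |f x - f y| ≤ L * dist x y) (hfc : Continuous f)
    (hC : C = L ^ 2 + 2 * D * L)
    (hstep : ∀ z, ∀ h0 > 0, ∃ h, 0 < h ∧ h ≤ h0 ∧ ∃ z', Rel f L C ε z h z') (z : M) {T : ℝ} (hT : 0 ≤ T) :
    ∃ z', Rel f L C ε z T z' := by
  let K : Set (ℝ × M) := {u | u.1 ∈ Icc 0 T ∧ Rel f L C ε z u.1 u.2}
  have hKc : IsCompact K := by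
    have : IsCompact (Icc 0 T ×ˢ (univ : Set M)) := isCompact_Icc.prod isCompact_univ
    refine this.of_isClosed_subset ?_ (fun u hu => ⟨hu.1, mem_univ _⟩)
    rw [← isSeqClosed_iff_isClosed]
    intro u u0 hu hlim
    have h1 : Filter.Tendsto (fun n => (u n).1) Filter.atTop (nhds u0.1) :=
      (continuous_fst.tendsto u0).comp hlim
    have h2 : Filter.Tendsto (fun n => (u n).2) Filter.atTop (nhds u0.2) :=
      (continuous_snd.tendsto u0).comp hlim
    exact ⟨isClosed_Icc.mem_of_tendsto h1 (Filter.Eventually.of_forall fun n => (hu n).1),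
      Rel.lim hfc tendsto_const_nhds h1 tendsto_const_nhds h2 (fun n => (hu n).2)⟩
  obtain ⟨⟨h, z1⟩, ⟨hh, hR⟩, hmax⟩ := hKc.exists_isMaxOn ⟨(0, z), ⟨le_rfl, hT⟩, Rel.refl z⟩ continuous_fst.continuousOn
  simp only at hh hR
  rcases hh.2.eq_or_lt with h1 | h1
  · exact ⟨z1, h1 ▸ hR⟩
  · obtain ⟨h2, h20, h2T, z2, hz2⟩ := hstep z1 (T - h) (by linarith)
    have := hmax (show (h + h2, z2) ∈ K from ⟨⟨by linarith [hh.1], by simp only; linarith⟩,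
      hR.trans hL hD hf hC hh.1 h20.le hz2⟩)
    simp at this
    linarith

lemma zero_step [CompactSpace M] (hL : 0 ≤ L) (hD : ∀ x y : M, dist x y ≤ D)
    (hf : ∀ x y, |f x - f y| ≤ L * dist x y) (hfc : Continuous f)
    (hC : C = L ^ 2 + 2 * D * L)
    (hstep : ∀ ε > 0, ∀ z, ∀ h0 > 0, ∃ h, 0 < h ∧ h ≤ h0 ∧ ∃ z', Rel f L C ε z h z') (z : M) {T : ℝ} (hT : 0 ≤ T) :
    ∃ z', Rel f L C 0 z T z' := by
  have : ∀ n : ℕ, ∃ z', Rel f L C (1 / ((n : ℝ) + 1)) z T z' := fun n =>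
    exact_step hL hD hf hfc hC (hstep _ (by positivity)) z hT
  choose w hw using this
  obtain ⟨w0, -, φ, hφ, hlim⟩ := isCompact_univ.tendsto_subseq (fun n => mem_univ (w n))
  refine ⟨w0, Rel.lim hfc (tendsto_one_div_add_atTop_nhds_zero_nat.comp hφ.tendsto_atTop)
    tendsto_const_nhds tendsto_const_nhds hlim (fun n => hw (φ n))⟩

lemma exists_curve [CompactSpace M] (hL : 0 ≤ L) (hD : ∀ x y : M, dist x y ≤ D)
    (hf : ∀ x y, |f x - f y| ≤ L * dist x y) (hfc : Continuous f)
    (hC : C = L ^ 2 + 2 * D * L)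
    (hstep : ∀ z, ∀ T : ℝ, 0 ≤ T → ∃ z', Rel f L C 0 z T z') (x : M) :
    ∃ γ : ℝ → M, γ 0 = x ∧ ∀ s t, 0 ≤ s → s ≤ t → Rel f L C 0 (γ s) (t - s) (γ t) := by
  choose! st hst using hstep
  have hit : ∀ h : ℝ, 0 ≤ h → ∀ (j : ℕ) (z : M), Rel f L C 0 z (j * h) ((fun z => st z h)^[j] z) := by
    intro h hh j
    induction j with
    | zero => intro z; simpa using Rel.refl z
    | succ j ih =>
      intro z
      rw [Function.iterate_succ_apply']
      have := (ih z).trans hL hD hf hC (by positivity) hh (hst _ h hh)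
      convert this using 1
      push_cast; ring
  let g : ℕ → ℝ → M := fun N t => (fun z => st z (1 / ((N : ℝ) + 1)))^[⌊t * ((N : ℝ) + 1)⌋₊] x
  have hlim : ∀ t, ∃ y, Filter.Tendsto (fun N => g N t) (Filter.hyperfilter ℕ : Filter ℕ) (nhds y) := by
    intro t
    obtain ⟨y, -, hy⟩ := isCompact_univ.ultrafilter_le_nhds (Ultrafilter.map (fun N => g N t) (Filter.hyperfilter ℕ)) (by simp)
    exact ⟨y, hy⟩
  choose γ hγ using hlim
  refine ⟨γ, ?_, fun s t hs hst' => ?_⟩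
  · have : (fun N => g N 0) = fun _ => x := by
      funext N; simp [g]
    have h := hγ 0
    rw [this] at h
    exact tendsto_nhds_unique h tendsto_const_nhds
  · have hle : (Filter.hyperfilter ℕ : Filter ℕ) ≤ Filter.atTop := by
      rw [← Nat.cofinite_eq_atTop]; exact Filter.hyperfilter_le_cofinite
    have hfl : ∀ t : ℝ, 0 ≤ t → Filter.Tendsto (fun N : ℕ => (⌊t * ((N : ℝ) + 1)⌋₊ : ℝ) / ((N : ℝ) + 1))
        (Filter.hyperfilter ℕ : Filter ℕ) (nhds t) := by
      intro t ht
      have h1 : Filter.Tendsto (fun N : ℕ => (N : ℝ) + 1) Filter.atTop Filter.atTop :=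
        Filter.tendsto_atTop_add_const_right _ _ tendsto_natCast_atTop_atTop
      exact ((tendsto_nat_floor_mul_div_atTop ht).comp h1).mono_left hle
    refine Rel.lim (l := (Filter.hyperfilter ℕ : Filter ℕ)) hfc (e := fun _ => 0)
      (h := fun N => (⌊t * ((N : ℝ) + 1)⌋₊ : ℝ) / ((N : ℝ) + 1) - (⌊s * ((N : ℝ) + 1)⌋₊ : ℝ) / ((N : ℝ) + 1))
      tendsto_const_nhds ((hfl t (hs.trans hst')).sub (hfl s hs)) (hγ s) (hγ t) (fun N => ?_)
    have hmono : ⌊s * ((N : ℝ) + 1)⌋₊ ≤ ⌊t * ((N : ℝ) + 1)⌋₊ :=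
      Nat.floor_le_floor (mul_le_mul_of_nonneg_right hst' (by positivity))
    obtain ⟨j, hj⟩ := Nat.exists_eq_add_of_le hmono
    have := hit (1 / ((N : ℝ) + 1)) (by positivity) j (g N s)
    simp only [g]
    rw [hj, add_comm (⌊s * ((N : ℝ) + 1)⌋₊) j, Function.iterate_add_apply]
    convert this using 1
    push_cast; ring

lemma contract_step (hL : 0 ≤ L) (hD : ∀ x y : M, dist x y ≤ D)
    (hf : ∀ x y, |f x - f y| ≤ L * dist x y)
    {z z' w w' : M} {h : ℝ} (hh : 0 ≤ h)
    (a : Rel f L C 0 z h z') (b : Rel f L C 0 w h w') :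
    dist z' w' ^ 2 ≤ (1 + 4 * h) * dist z w ^ 2 + (2 * C + 2 * L ^ 2 + 4 * D * L) * h ^ 2 := by
  have e1 := a.e w'
  have e2 := b.e z
  rw [dist_comm w' z, dist_comm w z] at e2
  have h1 : f w - f w' ≤ L * (L * h) := by
    have := (abs_le.1 (hf w w')).2
    have := mul_le_mul_of_nonneg_left b.d hL; linarith
  have h4 : dist z w' ^ 2 ≤ dist z w ^ 2 + 2 * D * (L * h) := by
    have t := dist_triangle z w w'
    have t1 : dist z w' - dist z w ≤ L * h := by linarith [b.d]
    have t2 : 0 ≤ dist z w' + dist z w := by positivity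
    have t3 : dist z w' + dist z w ≤ 2 * D := by linarith [hD z w', hD z w]
    have t4 : (dist z w' - dist z w) * (dist z w' + dist z w) ≤ (L * h) * (dist z w' + dist z w) :=
      mul_le_mul_of_nonneg_right t1 t2
    have t5 := mul_le_mul_of_nonneg_left t3 (show 0 ≤ L * h by positivity)
    nlinarith
  have h5 := mul_le_mul_of_nonneg_left (show f z - f w' + dist z w' ^ 2 + 0 + (f w - f z + dist z w ^ 2 + 0) ≤
    2 * dist z w ^ 2 + (L ^ 2 + 2 * D * L) * h by nlinarith) (show 0 ≤ 2 * h by positivity)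
  nlinarith

lemma curve_contract (hL : 0 ≤ L) (hD : ∀ x y : M, dist x y ≤ D)
    (hf : ∀ x y, |f x - f y| ≤ L * dist x y) (hC : 0 ≤ C) (hD0 : 0 ≤ D)
    {γ δ : ℝ → M} (hγ : ∀ s t, 0 ≤ s → s ≤ t → Rel f L C 0 (γ s) (t - s) (γ t))
    (hδ : ∀ s t, 0 ≤ s → s ≤ t → Rel f L C 0 (δ s) (t - s) (δ t)) {t : ℝ} (ht : 0 ≤ t) :
    dist (γ t) (δ t) ≤ Real.exp (2 * t) * dist (γ 0) (δ 0) := by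
  set K := 2 * C + 2 * L ^ 2 + 4 * D * L with hK
  have hK0 : 0 ≤ K := by positivity
  have key : ∀ n : ℕ, dist (γ t) (δ t) ^ 2 ≤ Real.exp (4 * t) * (dist (γ 0) (δ 0) ^ 2 + K * t ^ 2 * (1 / ((n : ℝ) + 1))) := by
    intro n
    set h := t / ((n : ℝ) + 1) with hh
    have hh0 : 0 ≤ h := by positivity
    have ind : ∀ j : ℕ, dist (γ (j * h)) (δ (j * h)) ^ 2 ≤ (1 + 4 * h) ^ j * (dist (γ 0) (δ 0) ^ 2 + j * (K * h ^ 2)) := by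
      intro j
      induction j with
      | zero => simp
      | succ j ih =>
        have a := hγ (j * h) ((j + 1 : ℕ) * h) (by positivity) (by push_cast; linarith)
        have b := hδ (j * h) ((j + 1 : ℕ) * h) (by positivity) (by push_cast; linarith)
        have e : ((j + 1 : ℕ) * h) - j * h = h := by push_cast; ring
        rw [e] at a b
        have c := contract_step hL hD hf hh0 a b
        rw [← hK] at c
        have p1 : (1 : ℝ) ≤ (1 + 4 * h) ^ (j + 1) := one_le_pow₀ (by linarith)
        have i2 := mul_le_mul_of_nonneg_left ih (show 0 ≤ 1 + 4 * h by linarith)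
        have i3 := mul_le_mul_of_nonneg_right p1 (show 0 ≤ K * h ^ 2 by positivity)
        rw [one_mul] at i3
        have i4 : (1 + 4 * h) ^ (j + 1) * (dist (γ 0) (δ 0) ^ 2 + ((j + 1 : ℕ) : ℝ) * (K * h ^ 2)) =
          (1 + 4 * h) * ((1 + 4 * h) ^ j * (dist (γ 0) (δ 0) ^ 2 + j * (K * h ^ 2))) + (1 + 4 * h) ^ (j + 1) * (K * h ^ 2) := by
          push_cast; ring
        rw [i4]
        linarith
    have h1 := ind (n + 1)
    have e1 : ((n + 1 : ℕ) : ℝ) * h = t := by rw [hh]; push_cast; field_simp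
    have e2 : ((n + 1 : ℕ) : ℝ) * (K * h ^ 2) = K * t ^ 2 * (1 / ((n : ℝ) + 1)) := by
      rw [hh]; push_cast; field_simp
    rw [e1, e2] at h1
    refine h1.trans (mul_le_mul_of_nonneg_right ?_ (by positivity))
    have e3 : 1 + 4 * h ≤ Real.exp (4 * h) := by have := Real.add_one_le_exp (4 * h); linarith
    refine (pow_le_pow_left₀ (by linarith) e3 _).trans ?_
    rw [← Real.exp_nat_mul]
    apply le_of_eq; congr 1
    rw [← e1]; ring
  have hl : dist (γ t) (δ t) ^ 2 ≤ Real.exp (4 * t) * (dist (γ 0) (δ 0) ^ 2 + K * t ^ 2 * 0) := by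
    refine ge_of_tendsto' (x := Filter.atTop) ?_ key
    exact ((tendsto_one_div_add_atTop_nhds_zero_nat.const_mul _).const_add _).const_mul _
  have e4 : Real.exp (4 * t) = Real.exp (2 * t) ^ 2 := by rw [← Real.exp_nat_mul]; congr 1; push_cast; ring
  rw [e4, mul_zero, add_zero, ← mul_pow] at hl
  exact le_of_sq_le_sq hl (by positivity)

lemma exists_flow [CompactSpace M] (hL : 0 ≤ L) (hD : ∀ x y : M, dist x y ≤ D) (hD0 : 0 ≤ D)
    (hf : ∀ x y, |f x - f y| ≤ L * dist x y)
    (hC : C = L ^ 2 + 2 * D * L)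
    (hstep : ∀ ε > 0, ∀ z, ∀ h0 > 0, ∃ h, 0 < h ∧ h ≤ h0 ∧ ∃ z', Rel f L C ε z h z') :
    ∃ Φ : M × ℝ → M, Continuous Φ ∧ (∀ x, Φ (x, 0) = x) ∧ ∀ x t, 0 ≤ t → Rel f L C 0 x t (Φ (x, t)) := by
  have hfc : Continuous f := by
    refine (LipschitzWith.of_dist_le_mul (K := L.toNNReal) fun x y => ?_).continuous
    rw [Real.coe_toNNReal _ hL, Real.dist_eq]; exact hf x y
  choose γ hγ0 hγ using exists_curve hL hD hf hfc hC (fun z T hT => zero_step hL hD hf hfc hC hstep z hT)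
  refine ⟨fun u => γ u.1 (max u.2 0), ?_, fun x => by simp [hγ0], fun x t ht => ?_⟩
  · rw [continuous_iff_continuousAt]
    rintro ⟨x, s⟩
    rw [ContinuousAt, tendsto_iff_dist_tendsto_zero]
    have bound : ∀ u : M × ℝ, dist (γ u.1 (max u.2 0)) (γ x (max s 0)) ≤
        Real.exp (2 * max u.2 0) * dist u.1 x + L * |max u.2 0 - max s 0| := by
      intro u
      have a := curve_contract hL hD hf (by rw [hC]; positivity) hD0 (hγ u.1) (hγ x) (t := max u.2 0) (le_max_right _ _)
      rw [hγ0, hγ0] at a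
      have b : dist (γ x (max u.2 0)) (γ x (max s 0)) ≤ L * |max u.2 0 - max s 0| := by
        rcases le_total (max u.2 0) (max s 0) with h | h
        · have := (hγ x _ _ (le_max_right _ _) h).d
          rwa [abs_sub_comm, abs_of_nonneg (by linarith)]
        · have := (hγ x _ _ (le_max_right _ _) h).d
          rw [dist_comm]
          rwa [abs_of_nonneg (by linarith)]
      linarith [dist_triangle (γ u.1 (max u.2 0)) (γ x (max u.2 0)) (γ x (max s 0))]
    refine squeeze_zero (fun _ => dist_nonneg) bound ?_
    have hc : Continuous fun u : M × ℝ => Real.exp (2 * max u.2 0) * dist u.1 x + L * |max u.2 0 - max s 0| := by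
      fun_prop
    have := hc.tendsto (x, s)
    simpa using this
  · have := hγ x 0 t le_rfl ht
    rw [hγ0, sub_zero] at this
    simpa [max_eq_left ht] using this

end flow
end Collapse

namespace Collapse
section gstep
variable {κ : ℝ} {X : Type} [MetricSpace X] {e : ℝ}

lemma md_diff_flat {s t d : ℝ} (hs : 0 ≤ s) (ht : 0 ≤ t) (hd : 0 ≤ d) (h1 : d ≤ s + t) (h2 : t ≤ s + d)
    (he : |κ| * (s + t) ^ 2 ≤ e) (he1 : e ≤ 1 / 100) :
    |d ^ 2 - t ^ 2 - 2 * (md κ d - md κ t)| ≤ 6 * e * (s * (s + t)) := by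
  have e0 : 0 ≤ e := le_trans (by positivity) he
  have mono : ∀ u, 0 ≤ u → u ≤ s + t → |κ| * u ^ 2 ≤ e := fun u hu hu' =>
    (mul_le_mul_of_nonneg_left (pow_le_pow_left₀ hu hu' 2) (abs_nonneg κ)).trans he
  rcases le_total t d with h | h
  · obtain ⟨a, b⟩ := md_sub_bounds (κ := κ) ht h (mono d hd h1) (by linarith)
    have hb : d ^ 2 - t ^ 2 ≤ 2 * (s * (s + t)) := by nlinarith
    have hb0 : 0 ≤ d ^ 2 - t ^ 2 := by nlinarith
    have := mul_le_mul_of_nonneg_left hb e0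
    rw [abs_le]; constructor <;> nlinarith
  · obtain ⟨a, b⟩ := md_sub_bounds (κ := κ) hd h (mono t ht (by linarith)) (by linarith)
    have hb : t ^ 2 - d ^ 2 ≤ 2 * (s * (s + t)) := by nlinarith
    have hb0 : 0 ≤ t ^ 2 - d ^ 2 := by nlinarith
    have := mul_le_mul_of_nonneg_left hb e0
    rw [abs_le]; constructor <;> nlinarith

lemma prod_flat {s t : ℝ} (hs : 0 ≤ s) (ht : 0 ≤ t)
    (he : |κ| * (s + t) ^ 2 ≤ e) (he1 : e ≤ 1 / 100) :
    |sn κ s * sn κ t - s * t| ≤ 3 * e * (s * t) ∧ |md κ s * cs κ t - s ^ 2 / 2| ≤ 3 * e * (s * s) := by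
  have e0 : 0 ≤ e := le_trans (by positivity) he
  have mono : ∀ u, 0 ≤ u → u ≤ s + t → |κ| * u ^ 2 ≤ e := fun u hu hu' =>
    (mul_le_mul_of_nonneg_left (pow_le_pow_left₀ hu hu' 2) (abs_nonneg κ)).trans he
  obtain ⟨a1, a2⟩ := sn_bounds (κ := κ) hs (mono s hs (by linarith)) (by linarith)
  obtain ⟨b1, b2⟩ := sn_bounds (κ := κ) ht (mono t ht (by linarith)) (by linarith)
  obtain ⟨c1, c2⟩ := md_bounds (κ := κ) hs (mono s hs (by linarith)) (by linarith)
  obtain ⟨d1, d2⟩ := cs_bounds (κ := κ) ht (mono t ht (by linarith)) (by linarith)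
  have hee : e * e ≤ e / 100 := by nlinarith
  have hst : 0 ≤ s * t := by positivity
  have q1 : 0 ≤ (1 - e) * s := by nlinarith
  have q2 : 0 ≤ (1 - e) * t := by nlinarith
  have l1 := mul_le_mul a1 b1 q2 (q1.trans a1)
  have l2 := mul_le_mul a2 b2 (q2.trans b1) (by positivity)
  have q3 : 0 ≤ (1 - e) * (s ^ 2 / 2) := by nlinarith [sq_nonneg s]
  have l3 := mul_le_mul c1 d1 (by linarith) (q3.trans c1)
  have l4 := mul_le_mul c2 d2 (by linarith) (by positivity)
  have r1 := mul_le_mul_of_nonneg_right hee hst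
  have r2 := mul_le_mul_of_nonneg_right hee (sq_nonneg s)
  have r3 := mul_nonneg e0 hst
  have r4 := mul_nonneg e0 (sq_nonneg s)
  have r5 := mul_nonneg (mul_nonneg e0 e0) hst
  have r6 := mul_nonneg (mul_nonneg e0 e0) (sq_nonneg s)
  refine ⟨abs_le.2 ⟨?_, ?_⟩, abs_le.2 ⟨?_, ?_⟩⟩ <;> nlinarith

lemma Q_eq (z w y : X) : Q κ z w y = md κ (dist z w) * cs κ (dist z y) + md κ (dist z y) - md κ (dist w y) := by
  unfold Q; rw [cs_eq]; ring

lemma flat_Q (z w y : X) (he : |κ| * (dist z w + dist z y) ^ 2 ≤ e) (he1 : e ≤ 1 / 100) :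
    |dist w y ^ 2 - (dist z y ^ 2 + dist z w ^ 2 - 2 * Q κ z w y)| ≤ 12 * e * (dist z w * (dist z w + dist z y)) := by
  have a := md_diff_flat (κ := κ) (e := e) dist_nonneg dist_nonneg dist_nonneg (dist_triangle_left w y z) (dist_triangle z w y) he he1
  have b := (prod_flat (κ := κ) (e := e) dist_nonneg dist_nonneg he he1).2
  rw [Q_eq]
  have e0 : 0 ≤ e := le_trans (by positivity) he
  have h1 : 0 ≤ e * (dist z w * dist z y) := by positivity
  rw [abs_le] at a b ⊢
  constructor <;> nlinarith [a.1, a.2, b.1, b.2]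

lemma flat_up {z w y : X} {c : ℝ} (he : |κ| * (dist z w + dist z y) ^ 2 ≤ e) (he1 : e ≤ 1 / 100) (hc : |c| ≤ 1)
    (h : c * (sn κ (dist z w) * sn κ (dist z y)) ≤ Q κ z w y) :
    dist w y ^ 2 ≤ dist z y ^ 2 + dist z w ^ 2 - 2 * c * (dist z w * dist z y) + 20 * e * (dist z w * (dist z w + dist z y)) := by
  have a := (abs_le.1 (flat_Q z w y he he1)).2
  have b := (prod_flat (κ := κ) (e := e) dist_nonneg dist_nonneg he he1).1
  have e0 : 0 ≤ e := le_trans (by positivity) he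
  have c1 : |c * (sn κ (dist z w) * sn κ (dist z y) - dist z w * dist z y)| ≤ 3 * e * (dist z w * dist z y) := by
    rw [abs_mul]; calc _ ≤ 1 * _ := mul_le_mul_of_nonneg_right hc (abs_nonneg _)
      _ ≤ _ := by rw [one_mul]; exact b
  have h1 : 0 ≤ e * (dist z w * dist z y) := by positivity
  have h2 : 0 ≤ e * (dist z w * dist z w) := by positivity
  have := (abs_le.1 c1).1
  nlinarith

lemma flat_down {z w y : X} {c : ℝ} (he : |κ| * (dist z w + dist z y) ^ 2 ≤ e) (he1 : e ≤ 1 / 100) (hc : |c| ≤ 2)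
    (h : Q κ z w y ≤ c * (sn κ (dist z w) * sn κ (dist z y))) :
    dist z y ^ 2 + dist z w ^ 2 - 2 * c * (dist z w * dist z y) - 30 * e * (dist z w * (dist z w + dist z y)) ≤ dist w y ^ 2 := by
  have a := (abs_le.1 (flat_Q z w y he he1)).1
  have b := (prod_flat (κ := κ) (e := e) dist_nonneg dist_nonneg he he1).1
  have e0 : 0 ≤ e := le_trans (by positivity) he
  have c1 : |c * (sn κ (dist z w) * sn κ (dist z y) - dist z w * dist z y)| ≤ 6 * e * (dist z w * dist z y) := by
    rw [abs_mul]; calc _ ≤ 2 * _ := mul_le_mul_of_nonneg_right hc (abs_nonneg _)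
      _ ≤ _ := by linarith
  have h1 : 0 ≤ e * (dist z w * dist z y) := by positivity
  have h2 : 0 ≤ e * (dist z w * dist z w) := by positivity
  have := (abs_le.1 c1).2
  nlinarith

/-- midpoint, flat version -/
lemma mid_flat (hX : CurvGE X κ) {x y m o : X} {ρ : ℝ} (he : |κ| * ρ ^ 2 ≤ e) (he1 : e ≤ 1 / 100)
    (h1 : dist x m = dist x y / 2) (h2 : dist m y = dist x y / 2)
    (hx : dist x o ≤ ρ) (hy : dist y o ≤ ρ) (hm : dist m o ≤ ρ) :
    (dist x o ^ 2 + dist y o ^ 2) / 2 - dist x y ^ 2 / 4 - 4 * e * ρ ^ 2 ≤ dist m o ^ 2 := by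
  have e0 : 0 ≤ e := le_trans (by positivity) he
  have ρ0 : 0 ≤ ρ := dist_nonneg.trans hx
  have h := md_mid hX (r := ρ) (he.trans he1) h1 h2 hx hy hm
  have hd : dist x y ≤ 2 * ρ := by have := dist_triangle_right x y o; linarith
  have mono : ∀ u, 0 ≤ u → u ≤ ρ → |κ| * u ^ 2 ≤ e := fun u hu hu' =>
    (mul_le_mul_of_nonneg_left (pow_le_pow_left₀ hu hu' 2) (abs_nonneg κ)).trans he
  have a1 := (md_bounds (κ := κ) dist_nonneg (mono _ dist_nonneg hx) (by linarith)).1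
  have a2 := (md_bounds (κ := κ) dist_nonneg (mono _ dist_nonneg hy) (by linarith)).1
  have a3 := (md_bounds (κ := κ) dist_nonneg (mono _ dist_nonneg hm) (by linarith)).2
  have hd2 : 0 ≤ dist x y / 2 := by positivity
  have a4 := (md_bounds (κ := κ) hd2 (mono _ hd2 (by linarith)) (by linarith)).2
  have a5 := cs_bounds (κ := κ) dist_nonneg (mono _ dist_nonneg hm) (by linarith)
  have l := mul_le_mul a4 a5.2 (by linarith) (by positivity)
  have p1 : e * dist x o ^ 2 ≤ e * ρ ^ 2 := mul_le_mul_of_nonneg_left (pow_le_pow_left₀ dist_nonneg hx 2) e0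
  have p2 : e * dist y o ^ 2 ≤ e * ρ ^ 2 := mul_le_mul_of_nonneg_left (pow_le_pow_left₀ dist_nonneg hy 2) e0
  have p3 : e * dist m o ^ 2 ≤ e * ρ ^ 2 := mul_le_mul_of_nonneg_left (pow_le_pow_left₀ dist_nonneg hm 2) e0
  have p4 : e * (dist x y / 2) ^ 2 ≤ e * ρ ^ 2 := mul_le_mul_of_nonneg_left (pow_le_pow_left₀ hd2 (by linarith) 2) e0
  have p5 : e * (e * (dist x y / 2) ^ 2) ≤ e * ρ ^ 2 / 100 := by nlinarith [mul_nonneg e0 (sq_nonneg ρ)]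
  nlinarith

end gstep
end Collapse

namespace Collapse
section gstep
variable {κ r : ℝ} {X : Type} [MetricSpace X] {e : ℝ} {k : ℕ}

def Dy (z : X) (y : ℕ → X) : Prop :=
  ∀ j, dist z (y (j + 1)) = dist z (y j) / 2 ∧ dist (y (j + 1)) (y j) = dist z (y j) / 2

lemma exists_Dy (hX : IsAlexandrovSpace X k κ) (z y0 : X) : ∃ y : ℕ → X, y 0 = y0 ∧ Dy z y := by
  choose m hm using fun x => hX.midpoint z x
  refine ⟨fun j => m^[j] y0, rfl, fun j => ?_⟩
  simp only [Function.iterate_succ_apply']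
  exact hm _

lemma Dy.dist {z : X} {y : ℕ → X} (h : Dy z y) (j : ℕ) : dist z (y j) = dist z (y 0) / 2 ^ j := by
  induction j with
  | zero => simp
  | succ j ih => rw [(h j).1, ih, pow_succ]; field_simp

lemma Dy.shift {z : X} {y : ℕ → X} (h : Dy z y) (i : ℕ) : Dy z (fun j => y (i + j)) := fun j => h (i + j)

lemma Dy.dist0 {z : X} {y : ℕ → X} (h : Dy z y) (j : ℕ) : Dist.dist (y j) (y 0) ≤ Dist.dist z (y 0) - Dist.dist z (y j) := by
  induction j with
  | zero => simp
  | succ j ih => have := dist_triangle (y (j+1)) (y j) (y 0); linarith [(h j).1, (h j).2]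

lemma Dy.le {z : X} {y : ℕ → X} (h : Dy z y) (j : ℕ) : Dist.dist z (y j) ≤ Dist.dist z (y 0) := by
  have := h.dist0 j; have := dist_nonneg (x := y j) (y := y 0); linarith

lemma Dy.tendsto {z : X} {y : ℕ → X} (h : Dy z y) : Filter.Tendsto (fun j => Dist.dist z (y j)) Filter.atTop (nhds 0) := by
  have : (fun j => Dist.dist z (y j)) = fun j => Dist.dist z (y 0) * (1 / 2 : ℝ) ^ j := by
    funext j; rw [h.dist j]; simp [div_eq_mul_inv]
  rw [this]
  simpa using (tendsto_pow_atTop_nhds_zero_of_lt_one (by norm_num : (0:ℝ) ≤ 1 / 2) (by norm_num)).const_mul (Dist.dist z (y 0))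

lemma Dy.pos {z : X} {y : ℕ → X} (h : Dy z y) (h0 : 0 < Dist.dist z (y 0)) (j : ℕ) : 0 < Dist.dist z (y j) := by
  rw [h.dist j]; positivity

lemma Dy.find {z : X} {y : ℕ → X} (h : Dy z y) {θ : ℝ} (hθ : 0 < θ) (h0 : θ < Dist.dist z (y 0)) :
    ∃ j, Dist.dist z (y j) ≤ θ ∧ θ / 2 < Dist.dist z (y j) := by
  have hex : ∃ j, Dist.dist z (y j) ≤ θ := by
    obtain ⟨j, hj⟩ := ((h.tendsto).eventually (gt_mem_nhds hθ)).exists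
    exact ⟨j, hj.le⟩
  classical
  refine ⟨Nat.find hex, Nat.find_spec hex, ?_⟩
  rcases hj : Nat.find hex with _ | j
  · have := Nat.find_spec hex; rw [hj] at this; linarith
  · have := Nat.find_min hex (m := j) (by omega)
    push Not at this
    rw [(h j).1]; linarith

lemma Q_abs (hr : |κ| * r ^ 2 ≤ 1 / 100) (z w y : X) (hw : dist z w ≤ r) (hy : dist z y ≤ r) :
    |Q κ z w y| ≤ sn κ (dist z w) * sn κ (dist z y) := by
  have t1 := dist_triangle_left w y z
  have t2 := dist_triangle z w y
  have t3 := dist_triangle z y w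
  rw [dist_comm y w] at t3
  have n1 := dist_nonneg (x := z) (y := w)
  have n2 := dist_nonneg (x := z) (y := y)
  have n3 := dist_nonneg (x := w) (y := y)
  have kk : ∀ u, 0 ≤ u → u ≤ 9 * r → κ * u ^ 2 ≤ 4 * Real.pi ^ 2 := fun u hu hu' => by
    have := loc_k hr hu hu'; have := sq_nonneg Real.pi; linarith
  rw [Q_eq, abs_le]
  constructor
  · have := md_le_md (κ := κ) n3 t1 (kk _ (by positivity) (by linarith))
    rw [md_add] at this; linarith
  · have h1 : |dist z w - dist z y| ≤ dist w y := abs_le.2 ⟨by linarith, by linarith⟩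
    have := md_le_md (κ := κ) (abs_nonneg _) h1 (kk _ (by positivity) (by linarith [abs_nonneg (dist z w - dist z y)]))
    rw [md_abs, md_sub] at this; linarith

lemma mid_step (hX : CurvGE X κ) {z w w' y m : X} {s t c ε' : ℝ} (hs : dist z w = s) (hs2 : dist z w' = 2 * s)
    (hs3 : dist w w' = s) (ht : dist z y = t) (hts : t ≤ s)
    (hm1 : dist w m = dist w y / 2) (hm2 : dist m y = dist w y / 2)
    (he : |κ| * (3 * s) ^ 2 ≤ e) (he1 : e ≤ 1 / 100) (hc : |c| ≤ 1) (hε0 : 0 ≤ ε') (hε1 : ε' ≤ 1)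
    (h1 : c * (sn κ (dist z w) * sn κ (dist z y)) ≤ Q κ z w y)
    (h2 : Q κ z w' y ≤ (c + ε') * (sn κ (dist z w') * sn κ (dist z y))) :
    dist z m ^ 2 ≤ s ^ 2 / 4 + t ^ 2 / 4 + c * s * t / 2 + 2 * ε' * s * t + 228 * e * s ^ 2 := by
  have s0 : 0 ≤ s := hs ▸ dist_nonneg
  have t0 : 0 ≤ t := ht ▸ dist_nonneg
  have e0 : 0 ≤ e := le_trans (by positivity) he
  have mono : ∀ u, 0 ≤ u → u ≤ 3 * s → |κ| * u ^ 2 ≤ e := fun u hu hu' =>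
    (mul_le_mul_of_nonneg_left (pow_le_pow_left₀ hu hu' 2) (abs_nonneg κ)).trans he
  have hwy := dist_triangle_left w y z
  have hwy0 := dist_nonneg (x := w) (y := y)
  have u1 := dist_triangle z y m
  rw [dist_comm y m] at u1
  have u2 := dist_triangle w' w m
  rw [dist_comm w' w] at u2
  have u3 := dist_triangle y z w'
  rw [dist_comm y z] at u3
  have A := mid_flat hX (x := z) (y := w') (m := w) (o := m) he he1 (by rw [hs2, hs]; ring) (by rw [hs2, hs3]; ring)
    (by linarith) (by linarith) (by linarith)
  have B := mid_flat hX (x := w) (y := y) (m := m) (o := w') he he1 hm1 hm2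
    (by linarith) (by linarith) (by rw [dist_comm]; linarith)
  have F1 := flat_up (by rw [hs, ht]; exact mono _ (by linarith) (by linarith)) he1 hc h1
  have F2 := flat_down (by rw [hs2, ht]; exact mono _ (by linarith) (by linarith)) he1
    (by rw [abs_le] at hc ⊢; constructor <;> linarith [hc.1, hc.2]) h2
  rw [hs2, hm1, dist_comm w' m] at A
  rw [hs3, dist_comm y w'] at B
  rw [hs, ht] at F1
  rw [hs2, ht] at F2
  have p1 : e * (s * (s + t)) ≤ e * (s * (s + s)) := by gcongr
  have p2 : e * (2 * s * (2 * s + t)) ≤ e * (2 * s * (2 * s + s)) := by gcongr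
  nlinarith

lemma steep_num {A b s t β c ε1 ε' e X : ℝ} (hs : 0 < s) (ht : 0 < t) (hβ : 0 < β)
    (hX2 : X ^ 2 ≤ s ^ 2 / 4 + t ^ 2 / 4 + c * s * t / 2 + 2 * ε' * s * t + 228 * e * s ^ 2)
    (hA : 0 ≤ A) (hAX : ((A - 2 * ε1) * s + b * t) / 2 - s ^ 2 ≤ A * X)
    (h1 : t ≤ β * s) (h2 : β * s ≤ 2 * t) (hε1 : ε1 ≤ β ^ 2) (hsβ : s ≤ β ^ 2) (hε' : ε' ≤ β)
    (he : 912 * e ≤ β ^ 2) :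
    b - 8 * β - A * (11 / 2 * β) ≤ A * c := by
  have q1 : s * X ≤ X ^ 2 + s ^ 2 / 4 := by nlinarith [sq_nonneg (X - s / 2)]
  have q2 : A * (s * X) ≤ A * (s ^ 2 / 2 + t ^ 2 / 4 + c * s * t / 2 + 2 * ε' * s * t + 228 * e * s ^ 2) :=
    mul_le_mul_of_nonneg_left (by linarith) hA
  have q3 := mul_le_mul_of_nonneg_left hAX hs.le
  have st : 0 < s * t := by positivity
  -- error estimates
  have r0 : β ^ 2 * s ^ 2 ≤ 2 * β * (s * t) := by
    have := mul_le_mul_of_nonneg_left h2 (show 0 ≤ β * s by positivity)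
    nlinarith
  have r1 : ε1 * s ^ 2 ≤ 2 * β * (s * t) := (mul_le_mul_of_nonneg_right hε1 (sq_nonneg s)).trans r0
  have r2 : s * s ^ 2 ≤ 2 * β * (s * t) := (mul_le_mul_of_nonneg_right hsβ (sq_nonneg s)).trans r0
  have r3 : 912 * e * s ^ 2 ≤ 2 * β * (s * t) := (mul_le_mul_of_nonneg_right he (sq_nonneg s)).trans r0
  have r4 : t ^ 2 ≤ β * (s * t) := by
    have := mul_le_mul_of_nonneg_left h1 ht.le
    nlinarith
  have r5 : ε' * (s * t) ≤ β * (s * t) := mul_le_mul_of_nonneg_right hε' st.le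
  have r6 : A * (t ^ 2 / 4 + 2 * ε' * s * t + 228 * e * s ^ 2) ≤ A * (11 / 4 * β * (s * t)) :=
    mul_le_mul_of_nonneg_left (by nlinarith) hA
  have fin : (b - 8 * β - A * (11 / 2 * β)) * (s * t) ≤ A * c * (s * t) := by nlinarith
  exact le_of_mul_le_mul_right fin st

lemma steep_fin {a b β c L : ℝ} (hβ : 0 < β) (hβ1 : β ≤ 1) (ha : 0 ≤ a) (haL : a ≤ L) (hc1 : |c| ≤ 1)
    (hA : b - 8 * β - (a + β ^ 2) * (11 / 2 * β) ≤ (a + β ^ 2) * c) : b - (20 + 20 * L) * β ≤ a * c := by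
  have b2 : β ^ 2 ≤ β := by nlinarith
  have b3 : β ^ 2 * β ≤ β := by nlinarith
  have b4 : a * β ≤ L * β := mul_le_mul_of_nonneg_right haL hβ.le
  have b5 : β ^ 2 * c ≤ β := by
    have := mul_le_mul_of_nonneg_left (abs_le.1 hc1).2 (sq_nonneg β); linarith
  have b6 : 0 ≤ L * β := mul_nonneg (ha.trans haL) hβ.le
  linarith

set_option maxHeartbeats 1000000 in
lemma steep (hX : IsAlexandrovSpace X k κ) (hr : |κ| * r ^ 2 ≤ 1 / 100) {f : X → ℝ} {L : ℝ}
    (hmid : ∀ x y m, dist x m = dist x y / 2 → dist m y = dist x y / 2 → (f x + f y) / 2 - dist x y ^ 2 / 4 ≤ f m)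
    {z : X} {w y : ℕ → X} (hw : Dy z w) (hy : Dy z y) (hw0 : 0 < dist z (w 0)) (hy0 : 0 < dist z (y 0))
    (hw0r : dist z (w 0) ≤ r) (hy0r : dist z (y 0) ≤ r) {a b β : ℝ} (hβ : 0 < β) (hβ1 : β ≤ 1)
    (ha : 0 ≤ a) (haL : a ≤ L)
    (hup : ∀ x, f x - f z ≤ (a + dist z x) * dist z x)
    (hwf : ∀ i, (a - β ^ 2) * dist z (w i) ≤ f (w i) - f z)
    (hyf : ∀ j, b * dist z (y j) ≤ f (y j) - f z) :
    ∃ c, |c| ≤ 1 ∧ (∀ i j, c * (sn κ (dist z (w i)) * sn κ (dist z (y j))) ≤ Q κ z (w i) (y j)) ∧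
      b - (20 + 20 * L) * β ≤ a * c := by
  have swp : ∀ i, 0 < sn κ (dist z (w i)) := fun i => sn_pos (hw.pos hw0 i) (loc_k hr dist_nonneg (by linarith [hw.le i]))
  have syp : ∀ i, 0 < sn κ (dist z (y i)) := fun i => sn_pos (hy.pos hy0 i) (loc_k hr dist_nonneg (by linarith [hy.le i]))
  let CC : ℕ → ℕ → ℝ := fun i j => Q κ z (w i) (y j) / (sn κ (dist z (w i)) * sn κ (dist z (y j)))
  have hCC : ∀ i j, CC i j * (sn κ (dist z (w i)) * sn κ (dist z (y j))) = Q κ z (w i) (y j) := fun i j => by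
    have := swp i; have := syp j; simp only [CC]; field_simp
  have habs : ∀ i j, |CC i j| ≤ 1 := fun i j => by
    have h1 := swp i; have h2 := syp j
    simp only [CC]
    rw [abs_div, abs_of_pos (mul_pos h1 h2), div_le_one (mul_pos h1 h2)]
    exact Q_abs hr _ _ _ (by linarith [hw.le i]) (by linarith [hy.le j])
  have m1 : ∀ j, Antitone (fun i => CC i j) := fun j => antitone_nat_of_succ_le fun i => by
    have h := shrink hX.curv hr (x := z) (y := w i) (z := w (i+1)) (o := y j) rfl (by linarith [(hw i).1, (hw i).2])
      (by linarith [hw.le i]) (by linarith [hy.le j])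
    have h1 := swp i; have h2 := syp j; have h3 := swp (i+1)
    simp only [CC]
    rw [div_le_div_iff₀ (by positivity) (by positivity)]
    have := mul_le_mul_of_nonneg_right h h2.le
    nlinarith
  have m2 : ∀ i, Antitone (fun j => CC i j) := fun i => antitone_nat_of_succ_le fun j => by
    have h := shrink hX.curv hr (x := z) (y := y j) (z := y (j+1)) (o := w i) rfl (by linarith [(hy j).1, (hy j).2])
      (by linarith [hy.le j]) (by linarith [hw.le i])
    have h1 := swp i; have h2 := syp j; have h3 := syp (j+1)
    simp only [CC]
    rw [Q_symm z (w i), Q_symm z (w i), div_le_div_iff₀ (by positivity) (by positivity)]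
    have := mul_le_mul_of_nonneg_right h h1.le
    nlinarith
  let c := ⨅ u : ℕ × ℕ, CC u.1 u.2
  have hbdd : BddBelow (range fun u : ℕ × ℕ => CC u.1 u.2) := ⟨-1, by
    rintro _ ⟨u, rfl⟩; exact (abs_le.1 (habs _ _)).1⟩
  have hcle : ∀ i j, c ≤ CC i j := fun i j => ciInf_le hbdd (i, j)
  have hc1 : |c| ≤ 1 := abs_le.2 ⟨le_ciInf fun u => (abs_le.1 (habs _ _)).1, (hcle 0 0).trans (abs_le.1 (habs _ _)).2⟩
  have hcQ : ∀ i j, c * (sn κ (dist z (w i)) * sn κ (dist z (y j))) ≤ Q κ z (w i) (y j) := fun i j => by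
    rw [← hCC i j]; exact mul_le_mul_of_nonneg_right (hcle i j) (mul_pos (swp i) (syp j)).le
  refine ⟨c, hc1, hcQ, ?_⟩
  obtain ⟨⟨i0, j0⟩, hij⟩ := exists_lt_of_ciInf_lt (show (⨅ u : ℕ × ℕ, CC u.1 u.2) < c + β by change c < c + β; linarith)
  simp only at hij
  have hsm : ∀ i ≥ i0, ∀ j ≥ j0, CC i j ≤ c + β := fun i hi j hj =>
    ((m1 j hi).trans (m2 i0 hj)).trans hij.le
  -- choose scale
  set e := β ^ 2 / 912 with he
  have e0 : 0 < e := by positivity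
  have e1 : e ≤ 1 / 100 := by rw [he]; nlinarith
  have htd := hw.tendsto
  have ev1 : ∀ᶠ i in Filter.atTop, dist z (w i) < β ^ 2 / 2 := htd.eventually (gt_mem_nhds (by positivity))
  have ev2 : ∀ᶠ i in Filter.atTop, dist z (w i) < dist z (y j0) := htd.eventually (gt_mem_nhds (hy.pos hy0 j0))
  have ev3 : ∀ᶠ i in Filter.atTop, |κ| * (3 * dist z (w i)) ^ 2 < e := by
    have : Filter.Tendsto (fun i => |κ| * (3 * dist z (w i)) ^ 2) Filter.atTop (nhds (|κ| * (3 * 0) ^ 2)) :=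
      ((htd.const_mul 3).pow 2).const_mul _
    exact this.eventually (gt_mem_nhds (by simpa using e0))
  obtain ⟨i, ⟨hi1, hi2, hi3⟩, hi4⟩ := (((Filter.tendsto_add_atTop_nat 1).eventually (ev1.and (ev2.and ev3))).and
    (Filter.eventually_ge_atTop i0)).exists
  set s := dist z (w (i + 1)) with hs
  have s0 : 0 < s := hw.pos hw0 _
  obtain ⟨j', hj1, hj2⟩ := (hy.shift j0).find (θ := β * s) (by positivity) (by simp only [add_zero]; nlinarith)
  set j := j0 + j' with hj
  set t := dist z (y j) with ht
  have t0 : 0 < t := hy.pos hy0 _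
  have hts : t ≤ s := hj1.trans (by nlinarith)
  obtain ⟨m, hm1, hm2⟩ := hX.midpoint (w (i+1)) (y j)
  have hq : Q κ z (w i) (y j) ≤ (c + β) * (sn κ (dist z (w i)) * sn κ (dist z (y j))) := by
    rw [← hCC i j]; exact mul_le_mul_of_nonneg_right (hsm i hi4 j (by omega)) (mul_pos (swp i) (syp j)).le
  have hz := mid_step hX.curv (z := z) (w := w (i+1)) (w' := w i) (y := y j) (m := m) (s := s) (t := t) (c := c) (ε' := β) (e := e)
    rfl (by linarith [(hw i).1]) (by linarith [(hw i).1, (hw i).2]) rfl hts hm1 hm2 hi3.le e1 hc1 hβ.le hβ1 (hcQ _ _) hq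
  have hf1 := hmid _ _ _ hm1 hm2
  have hf2 := hup m
  have hf3 := hwf (i + 1)
  have hf4 := hyf j
  have tri := dist_triangle_left (w (i+1)) (y j) z
  have hwy : dist (w (i+1)) (y j) ≤ 2 * s := by linarith
  have hwy2 : dist (w (i+1)) (y j) ^ 2 ≤ (2 * s) ^ 2 := pow_le_pow_left₀ dist_nonneg hwy 2
  -- dist z m ≤ 2 s
  have hzm : dist z m ≤ 2 * s := by linarith [dist_triangle z (w (i+1)) m]
  have hmm : dist z m * dist z m ≤ (2 * s) * (2 * s) := mul_self_le_mul_self dist_nonneg hzm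
  have hzm0 := dist_nonneg (x := z) (y := m)
  have hAX : ((a + β ^ 2 - 2 * β ^ 2) * s + b * t) / 2 - s ^ 2 ≤ (a + β ^ 2) * dist z m := by
    have h1 : (a + dist z m) * dist z m ≤ (a + β ^ 2) * dist z m :=
      mul_le_mul_of_nonneg_right (by linarith) hzm0
    linarith
  have hA := steep_num (A := a + β ^ 2) (b := b) (s := s) (t := t) (β := β) (c := c) (ε1 := β ^ 2) (ε' := β) (e := e) (X := dist z m)
    s0 t0 hβ hz (by positivity) hAX hj1 (by linarith) le_rfl (by linarith [sq_nonneg β]) le_rfl (by rw [he]; linarith)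
  exact steep_fin hβ hβ1 ha haL hc1 hA

end gstep
end Collapse

namespace Collapse
section gstep
variable {κ r : ℝ} {X : Type} [MetricSpace X] {e : ℝ} {k : ℕ}

lemma exists_small (K : ℝ) (hK : 0 ≤ K) {δ : ℝ} (hδ : 0 < δ) : ∃ e > 0, e ≤ 1 / 100 ∧ K * e ≤ δ := by
  refine ⟨min (1 / 100) (δ / (K + 1)), by positivity, min_le_left _ _, ?_⟩
  calc K * _ ≤ (K + 1) * (δ / (K + 1)) := mul_le_mul (by linarith) (min_le_right _ _) (by positivity) (by linarith)
    _ = δ := by field_simp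

lemma slope_Dy {f : X → ℝ}
    (hmid : ∀ x y m, dist x m = dist x y / 2 → dist m y = dist x y / 2 → (f x + f y) / 2 - dist x y ^ 2 / 4 ≤ f m)
    {z : X} {y : ℕ → X} (hy : Dy z y) {b : ℝ} (h0 : b * dist z (y 0) ≤ f (y 0) - f z - dist z (y 0) ^ 2) (j : ℕ) :
    b * dist z (y j) ≤ f (y j) - f z - dist z (y j) ^ 2 := by
  induction j with
  | zero => exact h0
  | succ j ih =>
    have := hmid _ _ _ (hy j).1 (hy j).2
    rw [(hy j).1]; linarith

lemma near_num {D h a L fz fY ε θ s : ℝ} (hs : s = h * a) (hh : 0 ≤ h) (haL : a ≤ L) (hL : 0 ≤ L)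
    (h1 : 2 * L * θ ≤ ε / 4) (h2 : L * s ≤ ε / 16) (hD : D ≤ θ) (hD0 : 0 ≤ D) (hs0 : 0 ≤ s)
    (hf : -(L * D) ≤ fz - fY) :
    (D + s) ^ 2 ≤ D ^ 2 + 2 * h * (fz - fY + D ^ 2 + ε) := by
  have p1 : a * D ≤ L * D := mul_le_mul_of_nonneg_right haL hD0
  have p2 : L * D ≤ L * θ := mul_le_mul_of_nonneg_left hD hL
  have p3 : a * s ≤ L * s := mul_le_mul_of_nonneg_right haL hs0
  have p4 := mul_le_mul_of_nonneg_left (show a * D + a * s / 2 ≤ fz - fY + D ^ 2 + ε by nlinarith) (show 0 ≤ 2 * h by linarith)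
  have e1 : (D + s) ^ 2 = D ^ 2 + 2 * h * (a * D + a * s / 2) := by rw [hs]; ring
  linarith

lemma far_num {d t s c e θ : ℝ} (h : d ^ 2 ≤ t ^ 2 + s ^ 2 - 2 * c * (s * t) + 20 * e * (s * (s + t)))
    (ht1 : θ / 2 < t) (hs : 0 ≤ s) (hse : s ≤ e * θ) (he : e ≤ 1 / 100) (he0 : 0 ≤ e) (hθ : 0 < θ) :
    d ≤ t - s * (c - 21 * e) := by
  have t0 : 0 < t := by linarith
  have a1 : s ≤ t := by nlinarith
  have a2 : s * s ≤ s * (2 * e * t) := mul_le_mul_of_nonneg_left (by nlinarith) hs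
  have a3 : e * (s * (s + t)) ≤ e * (s * (2 * t)) := by
    apply mul_le_mul_of_nonneg_left _ he0; apply mul_le_mul_of_nonneg_left _ hs; linarith
  have a4 : 2 * t * d ≤ d ^ 2 + t ^ 2 := by nlinarith [sq_nonneg (d - t)]
  have : (2 * t) * d ≤ (2 * t) * (t - s * (c - 21 * e)) := by nlinarith
  exact le_of_mul_le_mul_left this (by linarith)

lemma far_num2 {W D Dm h a L fz fY ε s c e b K : ℝ} (hs : s = h * a) (hh : 0 ≤ h) (ha : 0 ≤ a) (haL : a ≤ L)
    (hW0 : 0 ≤ W) (hW : W ≤ D - s * (c - 21 * e)) (hD0 : 0 ≤ D) (hDm : D ≤ Dm) (hs0 : 0 ≤ s)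
    (he0 : 0 ≤ e) (he : e ≤ 1 / 100) (hc : |c| ≤ 1)
    (hbc : b - K ≤ a * c) (hb : b * D = fY - fz - D ^ 2)
    (h1 : Dm * K ≤ ε / 4) (hK : 0 ≤ K) (h2 : 21 * L * Dm * e ≤ ε / 4) (h3 : 2 * L * s ≤ ε / 4) (hε : 0 ≤ ε) :
    W ^ 2 ≤ D ^ 2 + 2 * h * (fz - fY + D ^ 2 + ε) := by
  have w1 : W ^ 2 ≤ (D - s * (c - 21 * e)) ^ 2 := pow_le_pow_left₀ hW0 hW 2
  obtain ⟨c1, c2⟩ := abs_le.1 hc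
  have sq : (c - 21 * e) ^ 2 ≤ 4 := by nlinarith
  have p0 : D * (b - K) ≤ D * (a * c) := mul_le_mul_of_nonneg_left hbc hD0
  have p1 : D * K ≤ Dm * K := mul_le_mul_of_nonneg_right hDm hK
  have p2 : a * D * e ≤ L * Dm * e := by
    apply mul_le_mul_of_nonneg_right _ he0
    exact mul_le_mul haL hDm hD0 (ha.trans haL)
  have p3 : a * s * (c - 21 * e) ^ 2 ≤ L * s * 4 :=
    mul_le_mul (mul_le_mul_of_nonneg_right haL hs0) sq (sq_nonneg _) (mul_nonneg (ha.trans haL) hs0)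
  have p4 := mul_le_mul_of_nonneg_left (show -(D * (a * c)) + 21 * (a * D * e) + a * s * (c - 21 * e) ^ 2 / 2 ≤ fz - fY + D ^ 2 + ε by linarith) (show 0 ≤ 2 * h by linarith)
  have e1 : (D - s * (c - 21 * e)) ^ 2 = D ^ 2 + 2 * h * (-(D * (a * c)) + 21 * (a * D * e) + a * s * (c - 21 * e) ^ 2 / 2) := by rw [hs]; ring
  linarith

lemma grad_step (hX : IsAlexandrovSpace X k κ) {f : X → ℝ} {L C Dm : ℝ} (hL : 0 ≤ L)
    (hD : ∀ x y : X, dist x y ≤ Dm) (hf : ∀ x y, |f x - f y| ≤ L * dist x y) (hC : 0 ≤ C)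
    (hmid : ∀ x y m, dist x m = dist x y / 2 → dist m y = dist x y / 2 → (f x + f y) / 2 - dist x y ^ 2 / 4 ≤ f m) :
    ∀ ε > 0, ∀ z, ∀ h0 > 0, ∃ h, 0 < h ∧ h ≤ h0 ∧ ∃ z', Rel f L C ε z h z' := by
  intro ε hε z h0 hh0
  by_cases hcase : ∀ y, f y - f z ≤ dist z y ^ 2 + ε
  · refine ⟨h0, hh0, le_rfl, z, by simp; positivity, fun y => ?_⟩
    have := hcase y
    have : 0 ≤ 2 * h0 * (f z - f y + dist z y ^ 2 + ε) := mul_nonneg (by positivity) (by linarith)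
    have : 0 ≤ C * h0 ^ 2 := by positivity
    linarith
  push Not at hcase
  obtain ⟨ys, hys⟩ := hcase
  have hD0 : 0 ≤ Dm := dist_nonneg.trans (hD z z)
  have hysz : ys ≠ z := by rintro rfl; simp at hys; linarith
  have dpos : ∀ y, y ≠ z → 0 < dist z y := fun y hy => dist_pos.2 hy.symm
  let bf : X → ℝ := fun y => (f y - f z) / dist z y - dist z y
  have hbf : ∀ y, y ≠ z → bf y * dist z y = f y - f z - dist z y ^ 2 := fun y hy => by
    have := dpos y hy; simp only [bf]; field_simp
  have bdd : BddAbove (bf '' {y | y ≠ z}) := by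
    refine ⟨L, ?_⟩
    rintro _ ⟨y, hy, rfl⟩
    have h1 := dpos y hy
    have h2 := (abs_le.1 (hf y z)).2
    rw [dist_comm] at h2
    have : (f y - f z) / dist z y ≤ L := (div_le_iff₀ h1).2 h2
    simp only [bf]; linarith
  set a := sSup (bf '' {y | y ≠ z}) with ha
  have hle : ∀ y, y ≠ z → bf y ≤ a := fun y hy => le_csSup bdd ⟨y, hy, rfl⟩
  have hne : (bf '' {y | y ≠ z}).Nonempty := ⟨_, ys, hysz, rfl⟩
  have haL : a ≤ L := csSup_le hne (by
    rintro _ ⟨y, hy, rfl⟩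
    have h1 := dpos y hy
    have h2 := (abs_le.1 (hf y z)).2
    rw [dist_comm] at h2
    have : (f y - f z) / dist z y ≤ L := (div_le_iff₀ h1).2 h2
    simp only [bf]; linarith)
  have a0 : 0 < a := by
    have h1 := dpos ys hysz
    have h2 := hbf ys hysz
    have : 0 < bf ys := by
      by_contra hneg
      push Not at hneg
      have := mul_nonpos_of_nonpos_of_nonneg hneg h1.le
      linarith
    exact this.trans_le (hle ys hysz)
  have L0 : 0 < L := a0.trans_le haL
  have hup : ∀ x, f x - f z ≤ (a + dist z x) * dist z x := fun x => by
    by_cases hx : x = z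
    · subst hx; simp
    · have h1 := hbf x hx
      have := mul_le_mul_of_nonneg_right (hle x hx) (dpos x hx).le
      nlinarith
  -- parameters
  obtain ⟨β, hβ, hβ1, hβ2⟩ := exists_small (Dm * (20 + 20 * L)) (by positivity) (δ := ε / 4) (by positivity)
  obtain ⟨e, he, he1, he2⟩ := exists_small (21 * L * Dm) (by positivity) (δ := ε / 4) (by positivity)
  obtain ⟨r, hr0, hr⟩ := exists_loc κ
  obtain ⟨θ, hθ, hθr, hθL, hθe⟩ : ∃ θ > 0, θ ≤ r ∧ 2 * L * θ ≤ ε / 4 ∧ |κ| * (2 * θ) ^ 2 ≤ e := by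
    have t0 : Filter.Tendsto (fun θ : ℝ => θ) (nhdsWithin 0 (Ioi 0)) (nhds 0) := nhdsWithin_le_nhds
    have t1 := t0.eventually (gt_mem_nhds hr0)
    have t2 : Filter.Tendsto (fun θ : ℝ => 2 * L * θ) (nhdsWithin 0 (Ioi 0)) (nhds 0) := by simpa using t0.const_mul (2 * L)
    have t3 := t2.eventually (gt_mem_nhds (show 0 < ε / 4 by positivity))
    have t4 : Filter.Tendsto (fun θ : ℝ => |κ| * (2 * θ) ^ 2) (nhdsWithin 0 (Ioi 0)) (nhds 0) := by
      simpa using ((t0.const_mul 2).pow 2).const_mul |κ|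
    have t5 := t4.eventually (gt_mem_nhds he)
    obtain ⟨θ, h1, h2, h3, h4⟩ := (t1.and (t3.and (t5.and self_mem_nhdsWithin))).exists
    exact ⟨θ, h4, h1.le, h2.le, h3.le⟩
  obtain ⟨_, ⟨Wp, hWp, rfl⟩, hWb⟩ := exists_lt_of_lt_csSup hne (show a - β ^ 2 < a by have := pow_pos hβ 2; linarith)
  obtain ⟨w, hw0, hw⟩ := exists_Dy hX z Wp
  have hw0p : 0 < dist z (w 0) := hw0 ▸ dpos Wp hWp
  have hwf : ∀ i, (a - β ^ 2) * dist z (w i) ≤ f (w i) - f z := fun i => by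
    have h1 := slope_Dy hmid hw (b := a - β ^ 2) (by
      rw [hw0, ← hbf Wp hWp]; exact mul_le_mul_of_nonneg_right hWb.le (dpos Wp hWp).le) i
    have := sq_nonneg (dist z (w i))
    linarith
  obtain ⟨i, hi1, hi2, hi3, hi4⟩ : ∃ i, dist z (w i) ≤ θ ∧ dist z (w i) ≤ e * θ ∧ dist z (w i) ≤ h0 * a ∧
      16 * L * dist z (w i) ≤ ε := by
    have t0 := hw.tendsto
    have t1 := t0.eventually (gt_mem_nhds hθ)
    have t2 := t0.eventually (gt_mem_nhds (show 0 < e * θ by positivity))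
    have t3 := t0.eventually (gt_mem_nhds (show 0 < h0 * a by positivity))
    have t4 : Filter.Tendsto (fun i => 16 * L * dist z (w i)) Filter.atTop (nhds 0) := by simpa using t0.const_mul (16 * L)
    have t5 := t4.eventually (gt_mem_nhds hε)
    obtain ⟨i, h1, h2, h3, h4⟩ := (t1.and (t2.and (t3.and t5))).exists
    exact ⟨i, h1.le, h2.le, h3.le, h4.le⟩
  have s0 := hw.pos hw0p i
  set s := dist z (w i) with hs
  set h := s / a with hh
  have hsha : s = h * a := by rw [hh]; field_simp
  have hpos : 0 < h := by positivity
  refine ⟨h, hpos, by rw [hh, div_le_iff₀ a0]; exact hi3, w i, ?_, fun Y => ?_⟩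
  · rw [← hs, hsha, mul_comm]; exact mul_le_mul_of_nonneg_right haL hpos.le
  have hCh : 0 ≤ C * h ^ 2 := by positivity
  suffices dist (w i) Y ^ 2 ≤ dist z Y ^ 2 + 2 * h * (f z - f Y + dist z Y ^ 2 + ε) by linarith
  rcases le_or_gt (dist z Y) θ with hY | hY
  · refine le_trans ?_ (near_num (θ := θ) (s := s) hsha hpos.le haL hL hθL (by linarith) hY dist_nonneg s0.le ?_)
    · apply pow_le_pow_left₀ dist_nonneg
      have := dist_triangle_left (w i) Y z; linarith
    · exact (abs_le.1 (hf z Y)).1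
  · have hYz : Y ≠ z := by rintro rfl; simp at hY; linarith
    obtain ⟨y, hy0, hy⟩ := exists_Dy hX z Y
    obtain ⟨j, hj1, hj2⟩ := hy.find hθ (by rw [hy0]; exact hY)
    have hyp : 0 < dist z (y 0) := by rw [hy0]; exact dpos Y hYz
    obtain ⟨c, hc1, hc2, hc3⟩ := steep hX hr hmid (hw.shift i) (hy.shift j) (by simp only [add_zero]; exact s0)
      (by simp only [add_zero]; exact hy.pos hyp j) (by simp only [add_zero]; linarith) (by simp only [add_zero]; linarith)
      hβ (by linarith) a0.le haL hup (fun l => hwf _) (b := bf Y) (fun l => by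
        have h1 := slope_Dy hmid hy (b := bf Y) (by rw [hy0, hbf Y hYz]) (j + l)
        have := sq_nonneg (dist z (y (j + l)))
        linarith)
    have hc4 := hc2 0 0
    simp only [add_zero] at hc4
    have hF := flat_up (e := e) (c := c) (le_trans (by
      apply mul_le_mul_of_nonneg_left _ (abs_nonneg κ)
      apply pow_le_pow_left₀ (by positivity)
      linarith) hθe) he1 hc1 hc4
    have hF2 := far_num hF hj2 dist_nonneg hi2 he1 he.le hθ
    have hd0 := hy.dist0 j
    rw [hy0] at hd0
    have tri := dist_triangle (w i) (y j) Y
    exact far_num2 (Dm := Dm) (s := s) (c := c) (e := e) (b := bf Y) (K := (20 + 20 * L) * β) hsha hpos.le a0.le haL dist_nonneg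
      (by linarith) dist_nonneg (hD z Y) s0.le he.le he1 hc1 hc3 (hbf Y hYz) (by linarith) (by positivity) he2
      (by linarith) hε.le

/-- existence of the gradient flow -/
lemma grad_flow [CompactSpace X] (hX : IsAlexandrovSpace X k κ) {f : X → ℝ} {L Dm : ℝ} (hL : 0 ≤ L)
    (hD : ∀ x y : X, dist x y ≤ Dm) (hD0 : 0 ≤ Dm) (hf : ∀ x y, |f x - f y| ≤ L * dist x y)
    (hmid : ∀ x y m, dist x m = dist x y / 2 → dist m y = dist x y / 2 → (f x + f y) / 2 - dist x y ^ 2 / 4 ≤ f m) :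
    ∃ Φ : X × ℝ → X, Continuous Φ ∧ (∀ x, Φ (x, 0) = x) ∧
      ∀ x t, 0 ≤ t → Rel f L (L ^ 2 + 2 * Dm * L) 0 x t (Φ (x, t)) :=
  exists_flow hL hD hD0 hf rfl (grad_step hX hL hD hf (by positivity) hmid)

end gstep
end Collapse

namespace Collapse
section deform

lemma deform {M : Type} [MetricSpace M] {U : Set M} {Φ : M × ℝ → M} (hΦ : Continuous Φ) (h0 : ∀ x, Φ (x, 0) = x)
    {o : M} {r t0 l D : ℝ} (ht0 : 0 < t0) (hl : 0 < l) (hD : ∀ x y : M, dist x y ≤ D)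
    (hsub : closedBall o r ⊆ U) (hU : ∀ x ∈ U, ∀ t, 0 ≤ t → t ≤ t0 → Φ (x, t) ∈ U)
    (hdec : ∀ x ∈ U, r ≤ dist x o → ∀ t, 0 ≤ t → t ≤ t0 → dist (Φ (x, t)) o ≤ dist x o - l * t) :
    DeformRetractsOnto U (closedBall o r) := by
  let σ : M → ℝ := fun z => min t0 (max (dist z o - r) 0 / l)
  have hσc : Continuous σ := by fun_prop
  have hσ0 : ∀ z, 0 ≤ σ z := fun z => le_min ht0.le (by positivity)
  have hσ1 : ∀ z, σ z ≤ t0 := fun z => min_le_left _ _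
  let T : ℝ → M → M := fun s z => Φ (z, s * σ z)
  have hTU : ∀ s, 0 ≤ s → s ≤ 1 → ∀ z ∈ U, T s z ∈ U := fun s hs hs1 z hz =>
    hU z hz _ (mul_nonneg hs (hσ0 z)) (by nlinarith [hσ0 z, hσ1 z])
  have hfix : ∀ s, ∀ z ∈ closedBall o r, T s z = z := fun s z hz => by
    have : σ z = 0 := by
      simp only [σ]; rw [max_eq_right (by rw [mem_closedBall] at hz; linarith)]; simp [ht0.le]
    simp only [T]; rw [this, mul_zero, h0]
  have hstep : ∀ z ∈ U, dist (T 1 z) o ≤ max (dist z o - l * t0) r := fun z hz => by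
    rcases le_or_gt (dist z o) r with h | h
    · rw [hfix 1 z (mem_closedBall.2 h)]; exact le_max_of_le_right h
    · have h1 := hdec z hz h.le (1 * σ z) (by linarith [hσ0 z]) (by linarith [hσ1 z])
      refine h1.trans ?_
      rw [one_mul]
      simp only [σ]
      rw [max_eq_left (by linarith : (0:ℝ) ≤ dist z o - r)]
      rcases le_total t0 ((dist z o - r) / l) with h2 | h2
      · rw [min_eq_left h2]; exact le_max_left _ _
      · rw [min_eq_right h2, mul_div_cancel₀ _ hl.ne']; exact le_max_of_le_right (by linarith)
  have hiU : ∀ s, 0 ≤ s → s ≤ 1 → ∀ z ∈ U, ∀ j : ℕ, (T s)^[j] z ∈ U := fun s hs hs1 z hz j => by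
    induction j with
    | zero => exact hz
    | succ j ih => rw [Function.iterate_succ_apply']; exact hTU s hs hs1 _ ih
  have hid : ∀ z ∈ U, ∀ j : ℕ, dist ((T 1)^[j] z) o ≤ max (dist z o - j * (l * t0)) r := fun z hz j => by
    induction j with
    | zero => simp
    | succ j ih =>
      rw [Function.iterate_succ_apply']
      refine (hstep _ (hiU 1 zero_le_one le_rfl z hz j)).trans (max_le ?_ (le_max_right _ _))
      have hp : 0 < l * t0 := by positivity
      rcases le_max_iff.1 ih with h | h
      · refine le_max_of_le_left ?_; push_cast; linarith
      · refine le_max_of_le_right ?_; linarith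
  obtain ⟨N, hN⟩ := exists_nat_gt ((D - r) / (l * t0))
  have hN' : D - r < N * (l * t0) := (div_lt_iff₀ (by positivity)).1 hN
  have hcont : ∀ j : ℕ, Continuous fun u : M × ℝ => (T u.2)^[j] u.1 := fun j => by
    induction j with
    | zero => exact continuous_fst
    | succ j ih =>
      simp only [Function.iterate_succ_apply']
      exact hΦ.comp (ih.prodMk (continuous_snd.mul (hσc.comp ih)))
  refine ⟨hsub, ⟨fun u => (T (u.2 : ℝ))^[N] (u.1 : M), ?_⟩, ?_, ?_, ?_, ?_⟩
  · exact (hcont N).comp ((continuous_subtype_val.comp continuous_fst).prodMk (continuous_subtype_val.comp continuous_snd))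
  · intro x
    change (T ((0 : unitInterval) : ℝ))^[N] (x : M) = x
    have : T ((0 : unitInterval) : ℝ) = id := by funext z; simp [T, h0]
    rw [this]; simp
  · intro x
    change (T ((1 : unitInterval) : ℝ))^[N] (x : M) ∈ _
    rw [Set.Icc.coe_one, mem_closedBall]
    refine (hid x x.2 N).trans (max_le ?_ le_rfl)
    linarith [hD x o]
  · intro x t
    exact hiU t t.2.1 t.2.2 x x.2 N
  · intro x hx
    change (T ((1 : unitInterval) : ℝ))^[N] (x : M) = x
    exact Function.iterate_fixed (hfix _ _ hx) N

end deform
end Collapse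

namespace Collapse
section lift
variable {κ r : ℝ} {M : Type} [MetricSpace M] {n : ℕ}

/-- truncated modified distance function -/
def gg (κ r : ℝ) (b x : M) : ℝ := md κ (min (dist b x) (r / 4))

lemma gg_le (hr : |κ| * r ^ 2 ≤ 1 / 100) (hr0 : 0 < r) {b x : M} (h : dist b x ≤ r) : gg κ r b x ≤ md κ (dist b x) := by
  refine md_le_md (le_min dist_nonneg (by positivity)) (min_le_left _ _) ?_
  have h1 : min (dist b x) (r / 4) ≤ r / 4 := min_le_right _ _
  have h2 : 0 ≤ min (dist b x) (r / 4) := le_min dist_nonneg (by positivity)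
  have := loc_k hr (u := dist b x + min (dist b x) (r / 4)) (by positivity) (by linarith)
  have := sq_nonneg Real.pi; linarith

lemma gg_le' (hr : |κ| * r ^ 2 ≤ 1 / 100) (hr0 : 0 < r) (b x : M) : gg κ r b x ≤ md κ (r / 4) := by
  refine md_le_md (le_min dist_nonneg (by positivity)) (min_le_right _ _) ?_
  have h1 : min (dist b x) (r / 4) ≤ r / 4 := min_le_right _ _
  have h2 : 0 ≤ min (dist b x) (r / 4) := le_min dist_nonneg (by positivity)
  have := loc_k hr (u := r / 4 + min (dist b x) (r / 4)) (by positivity) (by linarith)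
  have := sq_nonneg Real.pi; linarith

lemma gg_eq {b x : M} (h : dist b x ≤ r / 4) : gg κ r b x = md κ (dist b x) := by
  unfold gg; rw [min_eq_left h]

lemma gg_lip (hr : |κ| * r ^ 2 ≤ 1 / 100) (hr0 : 0 < r) (b x y : M) : |gg κ r b x - gg κ r b y| ≤ 11 / 10 * r * dist x y := by
  refine (md_lip hr (le_min dist_nonneg (by positivity)) (le_min dist_nonneg (by positivity))
    ((min_le_right _ _).trans (by linarith)) ((min_le_right _ _).trans (by linarith))).trans ?_
  refine mul_le_mul_of_nonneg_left ?_ (by positivity)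
  refine (abs_min_sub_min_le_max _ _ _ _).trans ?_
  rw [sub_self, abs_zero]
  refine max_le ?_ dist_nonneg
  rw [dist_comm b x, dist_comm b y]; exact abs_dist_sub_le x y b

lemma gg_mid (hM : CurvGE M κ) (hr : |κ| * r ^ 2 ≤ 1 / 100) (hr0 : 0 < r) (b : M) {x y m : M} (h1 : dist x m = dist x y / 2)
    (h2 : dist m y = dist x y / 2) :
    (gg κ r b x + gg κ r b y) / 2 - dist x y ^ 2 / 4 ≤ gg κ r b m := by
  rcases le_or_gt (r / 4) (dist b m) with h | h
  · have : gg κ r b m = md κ (r / 4) := by unfold gg; rw [min_eq_right h]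
    have := gg_le' hr hr0 b x; have := gg_le' hr hr0 b y; have := sq_nonneg (dist x y); linarith
  · rw [gg_eq h.le]
    rcases le_or_gt (dist x y) (3 / 2 * r) with hxy | hxy
    · have tx := dist_triangle_right x b m
      have ty := dist_triangle_left y b m
      rw [dist_comm m b] at ty
      have hx : dist x b ≤ r := by linarith
      have hy : dist y b ≤ r := by linarith
      have := md_mid' hM hr h1 h2 hx hy (by rw [dist_comm]; linarith)
      have a1 := gg_le hr hr0 (b := b) (x := x) (by rwa [dist_comm])
      have a2 := gg_le hr hr0 (b := b) (x := y) (by rwa [dist_comm])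
      rw [dist_comm x b, dist_comm y b, dist_comm m b] at this
      linarith
    · have a1 := gg_le' hr hr0 b x
      have a2 := gg_le' hr hr0 b y
      have a3 := (md_loc (κ := κ) (u := r / 4) hr (by positivity) (by linarith)).2
      have a4 := md_nonneg κ (dist b m)
      nlinarith

/-- minimum of truncated functions -/
def FF (κ r : ℝ) (B : Finset M) (hB : B.Nonempty) (o x : M) : ℝ := B.inf' hB fun b => gg κ r b x - md κ (dist b o)

variable {B : Finset M} (hB : B.Nonempty) {o : M}

lemma FF_le {b : M} (hb : b ∈ B) (x : M) : FF κ r B hB o x ≤ gg κ r b x - md κ (dist b o) :=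
  Finset.inf'_le (f := fun b => gg κ r b x - md κ (dist b o)) hb

lemma FF_ex (x : M) : ∃ b ∈ B, FF κ r B hB o x = gg κ r b x - md κ (dist b o) :=
  Finset.exists_mem_eq_inf' hB _

lemma FF_lip (hr : |κ| * r ^ 2 ≤ 1 / 100) (hr0 : 0 < r) (x y : M) :
    |FF κ r B hB o x - FF κ r B hB o y| ≤ 11 / 10 * r * dist x y := by
  obtain ⟨b, hb, h⟩ := FF_ex (κ := κ) (r := r) hB (o := o) x
  obtain ⟨b', hb', h'⟩ := FF_ex (κ := κ) (r := r) hB (o := o) y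
  have h1 := FF_le (κ := κ) (r := r) hB (o := o) hb y
  have h2 := FF_le (κ := κ) (r := r) hB (o := o) hb' x
  have l1 := abs_le.1 (gg_lip hr hr0 b x y)
  have l2 := abs_le.1 (gg_lip hr hr0 b' x y)
  rw [abs_le]; constructor <;> linarith [l1.1, l1.2, l2.1, l2.2]

lemma FF_mid (hM : CurvGE M κ) (hr : |κ| * r ^ 2 ≤ 1 / 100) (hr0 : 0 < r) (x y m : M) (h1 : dist x m = dist x y / 2)
    (h2 : dist m y = dist x y / 2) :
    (FF κ r B hB o x + FF κ r B hB o y) / 2 - dist x y ^ 2 / 4 ≤ FF κ r B hB o m := by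
  obtain ⟨b, hb, h⟩ := FF_ex (κ := κ) (r := r) hB (o := o) m
  have := gg_mid hM hr hr0 b h1 h2
  have := FF_le (κ := κ) (r := r) hB (o := o) hb x
  have := FF_le (κ := κ) (r := r) hB (o := o) hb y
  linarith

lemma FF_zero (h : ∀ b ∈ B, dist b o ≤ r / 4) : FF κ r B hB o o = 0 := by
  obtain ⟨b, hb, h'⟩ := FF_ex (κ := κ) (r := r) hB (o := o) o
  rw [h', gg_eq (h b hb), sub_self]

lemma dec_num {d dt t c C r1 : ℝ} (hc : 0 < c) (hr1 : 0 < r1) (hd : r1 ≤ d) (hdt : 0 ≤ dt) (ht : 0 ≤ t)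
    (h : dt ^ 2 ≤ d ^ 2 + 2 * t * (-(c / 2 * d)) + C * t ^ 2) (h1 : C * t ≤ c * r1 / 2) (h2 : c * t ≤ r1) :
    dt ≤ d - c / 4 * t := by
  have a1 : C * t * t ≤ c * d / 2 * t := mul_le_mul_of_nonneg_right (by nlinarith) ht
  have : dt ^ 2 ≤ (d - c / 4 * t) ^ 2 := by nlinarith [sq_nonneg (c * t)]
  exact le_of_sq_le_sq this (by linarith)

lemma lift_deform [CompactSpace M] {B : Finset M} (hB : B.Nonempty) {o : M} (hM : IsAlexandrovSpace M n κ) (hr : |κ| * r ^ 2 ≤ 1 / 100) (hr0 : 0 < r)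
    {P : M} {R c δ r1 ρ : ℝ} (hc : 0 < c) (hR : 0 < R) (hRc : R ≤ c / 8) (hr1 : 0 < r1)
    (hBo : ∀ b ∈ B, dist b o ≤ r / 4)
    (hkey : ∀ x, dist x P < R → ∃ b ∈ B, dist b x ≤ r / 4 ∧ md κ (dist b x) - md κ (dist b o) ≤ -(c * dist x o) + δ)
    (hoP : dist o P ≤ ρ) (hρ : 11 / 10 * r * ρ ≤ c * R / 32) (hρ2 : ρ ≤ R / 4) (hδ1 : δ ≤ c * R / 32) (hδ2 : δ ≤ c * r1 / 4)
    (hr1R : r1 ≤ R / 4) : DeformRetractsOnto (ball P R) (closedBall o r1) := by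
  obtain ⟨D, hD⟩ : ∃ D, ∀ x y : M, dist x y ≤ D := by
    obtain ⟨D, hD⟩ := Metric.isBounded_iff.1 (isCompact_univ (X := M)).isBounded
    exact ⟨D, fun x y => hD (mem_univ x) (mem_univ y)⟩
  have hD0 : 0 ≤ D := dist_nonneg.trans (hD P P)
  set L := 11 / 10 * r with hL
  have L0 : 0 < L := by positivity
  obtain ⟨Φ, hΦ, hΦ0, hΦR⟩ := grad_flow hM (f := FF κ r B hB o) L0.le hD hD0 (fun x y => FF_lip hB hr hr0 x y)
    (FF_mid hB hM.curv hr hr0)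
  set C := L ^ 2 + 2 * D * L with hC
  have C0 : 0 ≤ C := by positivity
  obtain ⟨t0, ht0, ht1, ht2, ht3, ht4⟩ : ∃ t0 > 0, C * t0 ≤ c * r1 / 2 ∧ c * t0 ≤ r1 ∧ L * t0 ≤ R / 2 ∧ C * t0 ≤ c * R / 8 := by
    obtain ⟨t, h1, -, h2⟩ := exists_small (C + c + L) (by positivity) (δ := min (min (c * r1 / 2) r1) (min (R / 2) (c * R / 8)))
      (by positivity)
    have e1 : (C + c + L) * t = C * t + c * t + L * t := by ring
    have p1 : 0 ≤ C * t := by positivity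
    have p2 : 0 ≤ c * t := by positivity
    have p3 : 0 ≤ L * t := by positivity
    rw [le_min_iff, le_min_iff, le_min_iff] at h2
    obtain ⟨⟨q1, q2⟩, q3, q4⟩ := h2
    exact ⟨t, h1, by linarith, by linarith, by linarith, by linarith⟩
  have hF : ∀ x, dist x P < R → FF κ r B hB o x ≤ -(c * dist x o) + δ := fun x hx => by
    obtain ⟨b, hb, h1, h2⟩ := hkey x hx
    have := FF_le (κ := κ) (r := r) hB (o := o) hb x
    rw [gg_eq h1] at this; linarith
  have hF0 := FF_zero (κ := κ) hB hBo
  refine deform (l := c / 4) hΦ hΦ0 ht0 (by positivity) hD ?_ ?_ ?_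
  · intro x hx
    rw [mem_closedBall] at hx; rw [mem_ball]
    linarith [dist_triangle x o P]
  · intro x hx t h0 h1
    rw [mem_ball] at hx ⊢
    rcases le_or_gt (R / 2) (dist x P) with h | h
    · have e := (hΦR x t h0).e P
      have f1 := hF x hx
      have f2 := (abs_le.1 (FF_lip (κ := κ) (r := r) hB (o := o) hr hr0 P o)).1
      rw [hF0, ← hL, dist_comm P o] at f2
      have f3 : L * dist o P ≤ c * R / 32 := (mul_le_mul_of_nonneg_left hoP L0.le).trans hρ
      have f4 : R / 4 ≤ dist x o := by linarith [dist_triangle x o P]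
      have f5 : c * (R / 4) ≤ c * dist x o := mul_le_mul_of_nonneg_left f4 hc.le
      have f6 : dist x P ^ 2 ≤ R * R := by nlinarith [dist_nonneg (x := x) (y := P)]
      have f7 : R * R ≤ c / 8 * R := mul_le_mul_of_nonneg_right hRc hR.le
      have f8 := mul_le_mul_of_nonneg_left (show FF κ r B hB o x - FF κ r B hB o P + dist x P ^ 2 + 0 ≤ -(c * R / 16) by linarith)
        (show 0 ≤ 2 * t by linarith)
      have f9 : C * t * t ≤ c * R / 8 * t := mul_le_mul_of_nonneg_right ((mul_le_mul_of_nonneg_left h1 C0).trans ht4) h0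
      have : dist (Φ (x, t)) P ^ 2 ≤ dist x P ^ 2 := by nlinarith
      exact (le_of_sq_le_sq this dist_nonneg).trans_lt hx
    · have d := (hΦR x t h0).d
      have : L * t ≤ L * t0 := mul_le_mul_of_nonneg_left h1 L0.le
      linarith [dist_triangle_left (Φ (x, t)) P x]
  · intro x hx hxo t h0 h1
    rw [mem_ball] at hx
    have e := (hΦR x t h0).e o
    have f1 := hF x hx
    have d1 : dist x o ≤ c / 4 := by linarith [dist_triangle_right x o P]
    have f2 : dist x o ^ 2 ≤ c / 4 * dist x o := by nlinarith [dist_nonneg (x := x) (y := o)]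
    have f3 : c * r1 ≤ c * dist x o := mul_le_mul_of_nonneg_left hxo hc.le
    have f8 := mul_le_mul_of_nonneg_left (show FF κ r B hB o x - FF κ r B hB o o + dist x o ^ 2 + 0 ≤ -(c / 2 * dist x o) by rw [hF0]; linarith)
        (show 0 ≤ 2 * t by linarith)
    refine dec_num (C := C) hc hr1 hxo dist_nonneg h0 (by linarith) ?_ ?_
    · exact (mul_le_mul_of_nonneg_left h1 C0).trans ht1
    · exact (mul_le_mul_of_nonneg_left h1 hc.le).trans ht2

end lift
end Collapse

namespace Collapse
section drn
variable {κ r : ℝ} {X : Type} [MetricSpace X] {n : ℕ}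

lemma lift_key {M : Type} [MetricSpace M] (hr : |κ| * r ^ 2 ≤ 1 / 100) (hr0 : 0 < r) {p q : X} {A : Finset X} {c R μ : ℝ}
    (hc : 0 < c) (hA : ∀ a ∈ A, dist p a ≤ r / 16)
    (hkey : ∀ x, dist x p ≤ c → ∃ a ∈ A, md κ (dist a x) - md κ (dist a q) ≤ -(c * dist x q))
    {θ : M → X} {η : X → M} (h : IsApproxPair μ θ η) (hμ : 0 < μ) (hRc : R ≤ c / 8) (hRr : R ≤ r / 16) (hqp : dist q p ≤ r / 16)
    (hμ1 : μ ≤ r / 64) (hμ2 : μ ≤ c / 8) :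
    (∀ a ∈ A, dist (η a) (η q) ≤ r / 4) ∧
    ∀ x, dist x (η p) < R → ∃ a ∈ A, dist (η a) x ≤ r / 4 ∧
      md κ (dist (η a) x) - md κ (dist (η a) (η q)) ≤ -(c * dist x (η q)) + (2 * c + 4 * r) * μ := by
  have h1 : ∀ a ∈ A, dist (η a) (η q) ≤ r / 4 := by
    intro a ha
    have := (abs_lt.1 (h.dist_eta a q)).2
    have := hA a ha
    linarith [dist_triangle_left a q p, dist_comm p q]
  have key : ∀ (a : X) (x : M), |dist (η a) x - dist a (θ x)| ≤ 2 * μ := by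
    intro a x
    have e1 := abs_lt.1 (h.dist_theta (η a) x)
    have e2 := h.comp a
    have e3 := abs_le.1 (abs_dist_sub_le (θ (η a)) a (θ x))
    rw [abs_le]; constructor <;> linarith [e1.1, e1.2, e3.1, e3.2]
  refine ⟨h1, fun x hx => ?_⟩
  have k1 := abs_le.1 (key p x)
  rw [dist_comm] at hx
  have hθ : dist (θ x) p < R + 2 * μ := by rw [dist_comm]; linarith [k1.1]
  obtain ⟨a, ha, hax⟩ := hkey (θ x) (by linarith)
  have k2 := key a x
  have k3 := abs_le.1 (key q x)
  have k4 := h.dist_eta a q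
  have hap := hA a ha
  have d1 : dist a (θ x) ≤ r / 16 + (R + 2 * μ) := by
    linarith [dist_triangle_left a (θ x) p, dist_comm (θ x) p]
  have d2 : dist (η a) x ≤ r / 4 := by linarith [(abs_le.1 k2).2]
  have d3 : dist a q ≤ r / 4 := by linarith [dist_triangle_left a q p, dist_comm p q]
  refine ⟨a, ha, d2, ?_⟩
  have m1 := (md_lip hr (u := dist (η a) x) (v := dist a (θ x)) dist_nonneg dist_nonneg (by linarith) (by linarith)).trans
    (mul_le_mul_of_nonneg_left k2 (by positivity))
  have m2 := (md_lip hr (u := dist (η a) (η q)) (v := dist a q) dist_nonneg dist_nonneg (by linarith [h1 a ha]) (by linarith)).trans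
    (mul_le_mul_of_nonneg_left k4.le (by positivity))
  have m3 : c * (dist x (η q) - 2 * μ) ≤ c * dist (θ x) q := mul_le_mul_of_nonneg_left (by
    rw [dist_comm x, dist_comm (θ x)]; linarith [k3.2]) hc.le
  have m4 : 0 ≤ r * μ := by positivity
  nlinarith [(abs_le.1 m1).2, (abs_le.1 m2).1]

lemma drn_of_key [CompactSpace X] (hr : |κ| * r ^ 2 ≤ 1 / 100) (hr0 : 0 < r) {E : Set X} {p : X}
    (h : ∃ A : Finset X, A.Nonempty ∧ (∀ a ∈ A, dist p a ≤ r / 16) ∧ ∃ c > 0, ∀ q ∈ E, ∀ x, dist q p ≤ c → dist x p ≤ c →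
      ∃ a ∈ A, md κ (dist a x) - md κ (dist a q) ≤ -(c * dist x q)) : IsGoodPointDRN n κ E p := by
  classical
  obtain ⟨A, hA, hA1, c, hc, hkey⟩ := h
  intro R hR
  set R' := min R (min (c / 8) (r / 16)) with hR'
  have R0 : 0 < R' := by positivity
  have R1 : R' ≤ R := min_le_left _ _
  have R2 : R' ≤ c / 8 := (min_le_right _ _).trans (min_le_left _ _)
  have R3 : R' ≤ r / 16 := (min_le_right _ _).trans (min_le_right _ _)
  obtain ⟨ρ, ρ0, -, hρ⟩ := exists_small (4 * r + 8) (by positivity) (δ := min (c * R' / 32) R') (by positivity)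
  rw [le_min_iff] at hρ
  have ρ1 : 11 / 10 * r * (2 * ρ) ≤ c * R' / 32 := by nlinarith [hρ.1, mul_pos hr0 ρ0]
  have ρ2 : 2 * ρ ≤ R' / 4 := by nlinarith [hρ.2, mul_pos hr0 ρ0]
  refine ⟨ρ, ρ0, fun q₁ hq₁ q₂ hq₂ => ⟨R' / 4, by positivity, fun r₁ r₂ hr₁ hr₁' hr₂ hr₂' => ?_⟩⟩
  obtain ⟨μ₀, μ0, -, hμ₀⟩ := exists_small (2 * c + 4 * r + 1) (by positivity)
    (δ := min (min (min (c * R' / 32) (c * r₁ / 4)) (c * r₂ / 4)) (min ρ (min (r / 64) (c / 8)))) (by positivity)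
  simp only [le_min_iff] at hμ₀
  obtain ⟨⟨⟨b1, b2⟩, b3⟩, b4, b5, b6⟩ := hμ₀
  refine ⟨μ₀, μ0, fun μ hμ hμ' M _ hM θ η hap => ?_⟩
  have hP : 0 < (2 * c + 4 * r) * μ := by positivity
  have hm : (2 * c + 4 * r) * μ + μ ≤ (2 * c + 4 * r + 1) * μ₀ := by nlinarith
  have : CompactSpace M := by
    have := hM.proper
    obtain ⟨D, hD⟩ := Metric.isBounded_iff.1 (isCompact_univ (X := X)).isBounded
    have hb : Bornology.IsBounded (univ : Set M) := Metric.isBounded_iff.2 ⟨D + μ, fun x _ y _ => by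
      have := (abs_lt.1 (hap.dist_theta x y)).1
      have := hD (mem_univ (θ x)) (mem_univ (θ y))
      linarith⟩
    exact ⟨Metric.isCompact_of_isClosed_isBounded isClosed_univ hb⟩
  have main : ∀ q ∈ ball p ρ ∩ E, ∀ r1, 0 < r1 → r1 ≤ R' / 4 → (2 * c + 4 * r) * μ ≤ c * r1 / 4 →
      DeformRetractsOnto (ball (η p) R') (closedBall (η q) r1) := by
    intro q hq r1 h1 h2 h3
    have hqp : dist q p < ρ := hq.1
    obtain ⟨k1, k2⟩ := lift_key hr hr0 hc hA1 (fun x hx => hkey q hq.2 x (by linarith) hx) hap hμ R2 R3 (by linarith)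
      (by linarith) (by linarith)
    refine lift_deform (hA.image η) hM hr hr0 (ρ := 2 * ρ) (δ := (2 * c + 4 * r) * μ) hc R0 R2 h1 ?_ ?_ ?_ ρ1 ρ2 (by linarith) h3 h2
    · intro b hb
      obtain ⟨a, ha, rfl⟩ := Finset.mem_image.1 hb
      exact k1 a ha
    · intro x hx
      obtain ⟨a, ha, h⟩ := k2 x hx
      exact ⟨η a, Finset.mem_image_of_mem _ ha, h⟩
    · have := (abs_lt.1 (hap.dist_eta q p)).2
      linarith
  exact ⟨ball (η p) R', ball_subset_ball (by linarith), ball_subset_ball R1, main q₁ hq₁ r₁ hr₁ hr₁' (by linarith),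
    main q₂ hq₂ r₂ hr₂ hr₂' (by linarith)⟩

end drn
end Collapse

namespace Collapse
section diam
variable {s T : ℝ} {X : Type} [MetricSpace X]

lemma sT_lt (hs : 0 < s) (hT : s * T = Real.pi) {u : ℝ} (h0 : 0 ≤ u) (h : u < T) : s ^ 2 * u ^ 2 < Real.pi ^ 2 := by
  rw [← mul_pow, ← hT]
  exact pow_lt_pow_left₀ (mul_lt_mul_of_pos_left h hs) (by positivity) two_ne_zero

lemma sT_le2 (hs : 0 < s) (hT : s * T = Real.pi) {u : ℝ} (h0 : 0 ≤ u) (h : u ≤ 2 * T) : s ^ 2 * u ^ 2 ≤ 4 * Real.pi ^ 2 := by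
  have : 4 * Real.pi ^ 2 = (s * (2 * T)) ^ 2 := by rw [← hT]; ring
  rw [← mul_pow, this]
  exact pow_le_pow_left₀ (by positivity) (mul_le_mul_of_nonneg_left h hs.le) _

lemma sT_lt2 (hs : 0 < s) (hT : s * T = Real.pi) {u : ℝ} (h0 : 0 ≤ u) (h : u < 2 * T) : s ^ 2 * u ^ 2 < 4 * Real.pi ^ 2 := by
  have : 4 * Real.pi ^ 2 = (s * (2 * T)) ^ 2 := by rw [← hT]; ring
  rw [← mul_pow, this]
  exact pow_lt_pow_left₀ (mul_lt_mul_of_pos_left h hs) (by positivity) two_ne_zero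

lemma opp (hX : CurvGE X (s ^ 2)) (hs : 0 < s) (hT : s * T = Real.pi) {x y z o : X} (hxy : dist x y = T)
    (h : dist x z + dist z y = T) (hA : dist x z ≤ 3 / 4 * T) (hB : dist z y ≤ 3 / 4 * T) (ho : dist z o ≤ T / 8) :
    dist x o + dist y o = T := by
  have T0 : 0 < T := by have := Real.pi_pos; rw [← hT] at this; exact pos_of_mul_pos_right this hs.le
  have t1 := dist_triangle x z o
  have t2 := dist_triangle_left y o z
  have t3 := dist_triangle_right x y o
  have hA0 := dist_nonneg (x := x) (y := z)
  have hB0 := dist_nonneg (x := z) (y := y)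
  have hO0 := dist_nonneg (x := z) (y := o)
  have hx0 := dist_nonneg (x := x) (y := o)
  have hy0 := dist_nonneg (x := y) (y := o)
  have l := LF hX (o := o) rfl rfl (hxy.trans h.symm) (sT_lt hs hT hA0 (by linarith)) (sT_lt hs hT hB0 (by linarith))
    (sT_lt hs hT hO0 (by linarith)) (sT_le2 hs hT (by positivity) (by linarith)) (sT_le2 hs hT (by positivity) (by linarith))
  have eB : dist z y = T - dist x z := by linarith
  rw [h, eB] at l
  have s1 : sn (s ^ 2) T = 0 := by rw [sn_pos_k hs, hT]; simp
  have s2 : sn (s ^ 2) (T - dist x z) = sn (s ^ 2) (dist x z) := by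
    rw [sn_pos_k hs, sn_pos_k hs, mul_sub, hT, Real.sin_pi_sub]
  have m : ∀ u, md (s ^ 2) (T - u) = 2 / s ^ 2 - md (s ^ 2) u := fun u => by
    rw [md_pos_k hs, md_pos_k hs, mul_sub, hT, Real.cos_pi_sub]; ring
  have p : 0 < sn (s ^ 2) (dist x z) := sn_pos (by linarith) (sT_lt hs hT hA0 (by linarith))
  rw [s1, s2, m] at l
  have l2 : md (s ^ 2) (dist x o) ≤ 2 / s ^ 2 - md (s ^ 2) (dist y o) := by
    by_contra hc
    push Not at hc
    nlinarith [mul_lt_mul_of_pos_left hc p]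
  rw [← m] at l2
  by_contra hne
  have hlt : T - dist y o < dist x o := lt_of_le_of_ne (by linarith) (fun h => hne (by linarith))
  have t4 := dist_triangle_left z y o
  have := md_lt_md (κ := s ^ 2) (show 0 ≤ T - dist y o by linarith) hlt (sT_lt2 hs hT (by linarith) (by
    linarith [dist_triangle z o y, dist_comm y o]))
  linarith

lemma lin1 (hX : CurvGE X (s ^ 2)) (hs : 0 < s) (hT : s * T = Real.pi) {x y o o' : X} (hxy : T < dist x y)
    (h : dist x o + dist o y = dist x y) (h' : dist x o' + dist o' y = dist x y)
    (hA : dist x o ≤ 3 / 4 * T) (hB : dist o y ≤ 3 / 4 * T) (ho : dist o o' ≤ T / 8) :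
    dist o o' ≤ |dist x o - dist x o'| := by
  have T0 : 0 < T := by have := Real.pi_pos; rw [← hT] at this; exact pos_of_mul_pos_right this hs.le
  have t1 := dist_triangle x o o'
  have t2 := dist_triangle_left y o' o
  have hA0 := dist_nonneg (x := x) (y := o)
  have hB0 := dist_nonneg (x := o) (y := y)
  have hO0 := dist_nonneg (x := o) (y := o')
  have hx0 := dist_nonneg (x := x) (y := o')
  have hy0 := dist_nonneg (x := y) (y := o')
  have l := LF hX (o := o') rfl rfl h.symm (sT_lt hs hT hA0 (by linarith)) (sT_lt hs hT hB0 (by linarith))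
    (sT_lt hs hT hO0 (by linarith)) (sT_le2 hs hT (by positivity) (by linarith)) (sT_le2 hs hT (by positivity) (by linarith))
  obtain ⟨τ, hτ⟩ : ∃ τ, dist x o' = dist x o + τ := ⟨dist x o' - dist x o, by ring⟩
  have hτ' : dist y o' = dist o y - τ := by rw [dist_comm y o']; linarith
  rw [hτ, hτ', md_add, md_sub] at l
  have neg : sn (s ^ 2) (dist x o + dist o y) < 0 := by
    rw [sn_pos_k hs]
    refine div_neg_of_neg_of_pos ?_ hs
    have e : s * (dist x o + dist o y) = (s * (dist x o + dist o y) - Real.pi) + Real.pi := by ring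
    rw [e, Real.sin_add_pi, neg_lt_zero]
    apply Real.sin_pos_of_pos_of_lt_pi
    · rw [← hT, ← mul_sub, h]; exact mul_pos hs (by linarith)
    · rw [← hT]; nlinarith
  have key : md (s ^ 2) (dist o o') ≤ md (s ^ 2) τ := by
    by_contra hc
    push Not at hc
    have a := mul_lt_mul_of_neg_right hc neg
    rw [sn_add] at a l
    have c1 := cs_eq (s ^ 2) (dist x o)
    have c2 := cs_eq (s ^ 2) (dist o y)
    have c3 := cs_eq (s ^ 2) τ
    rw [c1, c2] at a l
    rw [c3] at l
    nlinarith
  have key' : md (s ^ 2) (dist o o') ≤ md (s ^ 2) |τ| := by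
    rcases abs_choice τ with h | h <;> rw [h]
    · exact key
    · rwa [md_neg]
  have hτ'' : |dist x o - dist x o'| = |τ| := by rw [hτ, abs_sub_comm]; congr 1; ring
  rw [hτ'']
  by_contra hc
  push Not at hc
  have := md_lt_md (κ := s ^ 2) (abs_nonneg τ) hc (sT_lt2 hs hT (by positivity) (by linarith))
  linarith

lemma diam_le {κ : ℝ} [CompactSpace X] {n : ℕ} (hM : IsAlexandrovSpace X n κ) (hn : 2 ≤ n) (u w : X) :
    κ * dist u w ^ 2 ≤ Real.pi ^ 2 := by
  have hpi := Real.pi_pos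
  have triv : κ ≤ 0 → κ * dist u w ^ 2 ≤ Real.pi ^ 2 := fun h => by
    have := mul_nonpos_of_nonpos_of_nonneg h (sq_nonneg (dist u w)); nlinarith
  rcases sgn_cases κ with h | ⟨s, hs, rfl⟩ | ⟨s, hs, h⟩
  · exact triv h.le
  swap
  · exact triv (by rw [h]; nlinarith)
  by_contra hc
  push Not at hc
  obtain ⟨T, hT⟩ : ∃ T, s * T = Real.pi := ⟨Real.pi / s, by field_simp⟩
  have T0 : 0 < T := by have := Real.pi_pos; rw [← hT] at this; exact pos_of_mul_pos_right this hs.le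
  have hD : T < dist u w := by
    by_contra h
    push Not at h
    rw [← mul_pow, ← hT] at hc
    exact absurd (pow_le_pow_left₀ (by positivity) (mul_le_mul_of_nonneg_left h hs.le) 2) (not_le.2 hc)
  set ε := min (dist u w - T) (T / 8) with hε
  have e0 : 0 < ε := lt_min (by linarith) (by linarith)
  have e1 : ε ≤ dist u w - T := min_le_left _ _
  have e2 : ε ≤ T / 8 := min_le_right _ _
  obtain ⟨v', hv', -⟩ := exists_btw hM u w (A := T + ε) (by linarith) (by linarith)
  obtain ⟨u', hu', huv'⟩ := exists_btw hM u v' (A := ε) (by linarith) (by linarith)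
  obtain ⟨v, hv, hvv'⟩ := exists_btw hM u' v' (A := T - ε) (by linarith) (by linarith)
  obtain ⟨z, hz, hzv⟩ := exists_btw hM u' v (A := (T - ε) / 2) (by linarith) (by linarith)
  have huv : dist u v = T := le_antisymm (by linarith [dist_triangle u u' v]) (by linarith [dist_triangle u v v'])
  have huz : dist u z = (T + ε) / 2 := le_antisymm (by linarith [dist_triangle u u' z]) (by linarith [dist_triangle u z v])
  have hzv' : dist z v' = (T + ε) / 2 := le_antisymm (by linarith [dist_triangle z v v']) (by linarith [dist_triangle u' z v'])
  have line : ∀ o, dist z o ≤ T / 16 → dist u o + dist o v' = dist u v' := by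
    intro o ho
    have a1 := opp hM.curv hs hT (x := u) (y := v) (z := z) (o := o) huv (by linarith) (by linarith) (by linarith) (by linarith)
    have a2 := opp hM.curv hs hT (x := u') (y := v') (z := z) (o := o) (by linarith) (by linarith) (by linarith) (by linarith) (by linarith)
    have b1 := dist_triangle u u' o
    have b2 := dist_triangle_left v' o v
    have b3 := dist_triangle u o v'
    rw [dist_comm o v'] at b3 ⊢
    refine le_antisymm ?_ b3
    linarith
  have hb := dim_ball hM z (T / 16) (by positivity)
  have h1 : dimH (ball z (T / 16)) ≤ dimH ((fun o => dist u o) '' ball z (T / 16)) := by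
    refine le_dimH_image_of_anti one_pos fun a ha b hb => ?_
    rw [mem_ball'] at ha hb
    rw [one_mul, Real.dist_eq]
    have ta := dist_triangle u z a
    have ta' := dist_triangle_left a v' z
    refine lin1 hM.curv hs hT (y := v') (by linarith) (line a ha.le) (line b hb.le) (by linarith) (by linarith) ?_
    linarith [dist_triangle_left a b z]
  have h2 : dimH ((fun o => dist u o) '' ball z (T / 16)) ≤ 1 := (dimH_mono (subset_univ _)).trans (by rw [Real.dimH_univ])
  have h3 := (hb.trans h1).trans h2
  have h4 : n ≤ 1 := by exact_mod_cast h3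
  omega

end diam
end Collapse

namespace Collapse
section star
variable {κ s : ℝ} {X : Type} [MetricSpace X]

/-- cosine of the comparison angle at `p` -/
def CC (κ : ℝ) (p a b : X) : ℝ := Real.cos (cmpAngle κ (dist p a) (dist p b) (dist a b))

lemma kmono {u v c : ℝ} (h0 : 0 ≤ u) (h : u ≤ v) (hc : 0 < c) (hv : κ * v ^ 2 < c) : κ * u ^ 2 < c := by
  rcases le_or_gt κ 0 with hk | hk
  · exact (mul_nonpos_of_nonpos_of_nonneg hk (sq_nonneg u)).trans_lt hc
  · exact (mul_le_mul_of_nonneg_left (pow_le_pow_left₀ h0 h 2) hk.le).trans_lt hv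

lemma kmono' {u v c : ℝ} (h0 : 0 ≤ u) (h : u ≤ v) (hc : 0 < c) (hv : κ * v ^ 2 ≤ c) : κ * u ^ 2 ≤ c := by
  rcases le_or_gt κ 0 with hk | hk
  · exact (mul_nonpos_of_nonpos_of_nonneg hk (sq_nonneg u)).trans hc.le
  · exact (mul_le_mul_of_nonneg_left (pow_le_pow_left₀ h0 h 2) hk.le).trans hv

lemma Q_eq_cs (p a b : X) : Q κ p a b = md κ (dist p a) * cs κ (dist p b) + md κ (dist p b) - md κ (dist a b) := by
  unfold Q; rw [cs_eq]; ring

lemma CC_eq (p a b : X) : CC κ p a b = Real.cos (Real.arccos (Q κ p a b / (sn κ (dist p a) * sn κ (dist p b)))) := by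
  unfold CC; rw [cmpAngle_eq, Q_eq_cs]

lemma CC_ge (p a b : X) {y : ℝ} (h1 : y ≤ 1) (h2 : y ≤ Q κ p a b / (sn κ (dist p a) * sn κ (dist p b))) : y ≤ CC κ p a b := by
  rw [CC_eq]
  set x := Q κ p a b / (sn κ (dist p a) * sn κ (dist p b))
  rcases le_or_gt x (-1) with h | h
  · rw [Real.arccos_of_le_neg_one h, Real.cos_pi]; linarith
  · rcases le_or_gt x 1 with h' | h'
    · rwa [Real.cos_arccos h.le h']
    · rw [Real.arccos_of_one_le h'.le, Real.cos_zero]; exact h1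

lemma CC_junk (p a b : X) (h : sn κ (dist p a) = 0 ∨ sn κ (dist p b) = 0) : CC κ p a b = 0 := by
  rw [CC_eq]
  have : sn κ (dist p a) * sn κ (dist p b) = 0 := by rcases h with h | h <;> simp [h]
  rw [this, div_zero, Real.arccos_zero, Real.cos_pi_div_two]

/-- reference points with no degeneration -/
structure Good (κ s : ℝ) (p a : X) : Prop where
  le : s ≤ dist p a
  k : κ * (dist p a + s) ^ 2 < Real.pi ^ 2

lemma four_pi {u : ℝ} (h : κ * u ^ 2 < Real.pi ^ 2) : κ * (2 * u) ^ 2 < 4 * Real.pi ^ 2 := by nlinarith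

lemma Q_le_sn {p a b : X} (hs : 0 < s) (ha : dist p a = s) (hb : Good κ s p b) : Q κ p a b ≤ sn κ s * sn κ (dist p b) := by
  rw [Q_eq_cs, ha]
  have h := md_sub κ s (dist p b)
  have : md κ (s - dist p b) ≤ md κ (dist a b) := by
    have h1 : md κ (s - dist p b) = md κ (dist p b - s) := by rw [← md_neg]; congr 1; ring
    rw [h1]
    have t1 := dist_triangle p a b
    have t2 := dist_triangle_left a b p
    have := hb.le
    refine md_le_md (by linarith) (by linarith) (kmono (by positivity) ?_ (by positivity) (four_pi hb.k)).le
    linarith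
  linarith

lemma exists_per [CompactSpace X] {k : ℕ} (hX : IsAlexandrovSpace X k κ) {a a' b : X} {c T : ℝ} (h1 : c + dist a' b ≤ T)
    (h2 : T < c + dist a' a + dist a b) : ∃ z, dist a' z + dist z a = dist a' a ∧ c + dist a' z + dist z b = T := by
  let S : Set X := {z | dist a' z + dist z a = dist a' a ∧ c + dist a' z + dist z b ≤ T}
  have hS : IsClosed S := by
    simp only [S, Set.ofPred_and]
    refine (isClosed_eq ?_ ?_).inter (isClosed_le ?_ ?_) <;> fun_prop
  have hne : S.Nonempty := ⟨a', by simp [S]; exact h1⟩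
  obtain ⟨z, hz, hmax⟩ := hS.isCompact.exists_isMaxOn hne (f := fun z => dist a' z) (by fun_prop)
  obtain ⟨hz1, hz2⟩ := hz
  refine ⟨z, hz1, le_antisymm hz2 ?_⟩
  by_contra hc
  push Not at hc
  have hza : 0 < dist z a := by
    rw [dist_pos]; rintro rfl; linarith
  set δ := min (dist z a) ((T - (c + dist a' z + dist z b)) / 2) with hδ
  have d0 : 0 < δ := lt_min hza (by linarith)
  have d1 : δ ≤ dist z a := min_le_left _ _
  have d2 : δ ≤ (T - (c + dist a' z + dist z b)) / 2 := min_le_right _ _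
  obtain ⟨y, hy1, hy2⟩ := exists_btw hX z a d0.le d1
  have t1 := dist_triangle a' z y
  have t2 := dist_triangle a' y a
  have t3 := dist_triangle_left y b z
  have hyS : y ∈ S := ⟨by linarith, by linarith⟩
  have := hmax hyS
  simp only [Set.mem_ofPred_eq] at this
  linarith

lemma star1 [CompactSpace X] {k : ℕ} (hX : IsAlexandrovSpace X k κ) {p a a' b : X} (hs : 0 < s)
    (ha : Good κ s p a) (hb : Good κ s p b) (h1 : dist p a' = s) (h2 : dist a' a = dist p a - s) :
    Q κ p a' b ≤ sn κ s * sn κ (dist p b) * CC κ p a b := by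
  have hpi := Real.pi_pos
  have hp2 : 0 < Real.pi ^ 2 := by positivity
  have hal := ha.le
  have hbl := hb.le
  have sb : 0 < sn κ (dist p b) := sn_pos (by linarith) (kmono dist_nonneg (by linarith) hp2 hb.k)
  have sa : 0 < sn κ (dist p a) := sn_pos (by linarith) (kmono dist_nonneg (by linarith) hp2 ha.k)
  have ss : 0 < sn κ s := sn_pos hs (kmono hs.le (by linarith [dist_nonneg (x := p) (y := a)]) hp2 ha.k)
  have hP : 0 < sn κ s * sn κ (dist p b) := by positivity
  have ta := dist_triangle_left a' b p
  have gen : ∀ a1, dist p a1 = s + dist a' a1 → dist a' a1 ≤ dist p a → dist p a1 ≤ dist p a →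
      κ * (s + dist a' a1 + dist a1 b + dist p b) ^ 2 ≤ 4 * Real.pi ^ 2 →
      sn κ (dist p a1) * Q κ p a' b ≤ sn κ s * Q κ p a1 b := by
    intro a1 e1 e2 e3 e4
    rw [e1]
    refine shrink' hX.curv h1 rfl e1 (kmono hs.le (by linarith) hp2 ha.k) (kmono dist_nonneg (by linarith) hp2 ha.k)
      (kmono dist_nonneg (by linarith) hp2 hb.k) ?_ ?_
    · exact (kmono (by positivity) (by linarith) (by positivity) (four_pi hb.k)).le
    · exact kmono' (by positivity) (by linarith) (by positivity) e4
  rw [mul_comm, ← div_le_iff₀ hP]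
  rcases le_or_gt (κ * (s + dist a' a + dist a b + dist p b) ^ 2) (4 * Real.pi ^ 2) with h | h
  · have g := gen a (by linarith) (by linarith) le_rfl h
    apply CC_ge
    · rw [div_le_one hP]; exact Q_le_sn hs h1 hb
    · rw [div_le_div_iff₀ hP (by positivity)]
      have := mul_le_mul_of_nonneg_right g sb.le
      linarith
  · have hneg : Q κ p a' b / (sn κ s * sn κ (dist p b)) ≤ -1 := by
      rcases le_or_gt κ 0 with hk | hk
      · have := mul_nonpos_of_nonpos_of_nonneg hk (sq_nonneg (s + dist a' a + dist a b + dist p b)); nlinarith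
      obtain ⟨σ, hσ, rfl⟩ : ∃ σ : ℝ, 0 < σ ∧ κ = σ ^ 2 := ⟨√κ, Real.sqrt_pos.2 hk, (Real.sq_sqrt hk.le).symm⟩
      obtain ⟨T, hT⟩ : ∃ T, σ * T = Real.pi := ⟨Real.pi / σ, by field_simp⟩
      have c1 : s + dist p b + dist a' b ≤ 2 * T := by
        by_contra hc
        push Not at hc
        have : T < dist p b + s := by linarith
        have T0 : 0 < T := by rw [← hT] at hpi; exact pos_of_mul_pos_right hpi hσ.le
        have := pow_lt_pow_left₀ (mul_lt_mul_of_pos_left this hσ) (by positivity) two_ne_zero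
        have hk := hb.k
        rw [← mul_pow, ← hT] at hk
        linarith
      have c2 : 2 * T < s + dist p b + dist a' a + dist a b := by
        by_contra hc
        push Not at hc
        have := sT_le2 hσ hT (u := s + dist a' a + dist a b + dist p b) (by positivity) (by linarith)
        linarith
      obtain ⟨a1, z1, z2⟩ := exists_per hX c1 c2
      have t1 := dist_triangle p a' a1
      have t2 := dist_triangle p a1 a
      have e1 : dist p a1 = s + dist a' a1 := le_antisymm (by linarith) (by linarith)
      have n1 := dist_nonneg (x := a1) (y := a)
      have g := gen a1 e1 (by linarith) (by linarith) (sT_le2 hσ hT (by positivity) (by linarith))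
      have e2 : dist a1 b = 2 * T - (dist p a1 + dist p b) := by linarith
      have e3 : md (σ ^ 2) (dist a1 b) = md (σ ^ 2) (dist p a1 + dist p b) := by
        rw [e2, md_pos_k hσ, md_pos_k hσ]
        have : σ * (2 * T - (dist p a1 + dist p b)) = 2 * Real.pi - σ * (dist p a1 + dist p b) := by rw [← hT]; ring
        rw [this, Real.cos_two_pi_sub]
      have e4 : Q (σ ^ 2) p a1 b = -(sn (σ ^ 2) (dist p a1) * sn (σ ^ 2) (dist p b)) := by
        rw [Q_eq_cs, e3, md_add]; ring
      rw [e4] at g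
      have s1 : 0 < sn (σ ^ 2) (dist p a1) := sn_pos (by rw [e1]; positivity)
        (kmono dist_nonneg (by linarith) hp2 ha.k)
      rw [div_le_iff₀ hP]
      by_contra hc
      push Not at hc
      nlinarith [mul_lt_mul_of_pos_left hc s1]
    exact hneg.trans (Real.neg_one_le_cos _)

lemma star2 [CompactSpace X] {k : ℕ} (hX : IsAlexandrovSpace X k κ) {p a a' b b' : X} (hs : 0 < s)
    (ha : Good κ s p a) (hb : Good κ s p b) (h1 : dist p a' = s) (h2 : dist a' a = dist p a - s)
    (h3 : dist p b' = s) (h4 : dist b' b = dist p b - s) :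
    Q κ p a' b' ≤ sn κ s ^ 2 * CC κ p a b := by
  have hp2 : 0 < Real.pi ^ 2 := by have := Real.pi_pos; positivity
  have hbl := hb.le
  have sb : 0 < sn κ (dist p b) := sn_pos (by linarith) (kmono dist_nonneg (by linarith) hp2 hb.k)
  have ss : 0 < sn κ s := sn_pos hs (kmono hs.le (by linarith) hp2 hb.k)
  have h := star1 hX hs ha hb h1 h2
  have t1 := dist_triangle_left b' a' p
  have t2 := dist_triangle_left b a' p
  have g := shrink' hX.curv (o := a') h3 h4 (by ring) (kmono hs.le (by linarith) hp2 hb.k)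
    (kmono (by linarith) (by linarith) hp2 hb.k) (kmono dist_nonneg (by linarith) hp2 hb.k)
    (kmono (by positivity) (by linarith) (by positivity) (four_pi hb.k)).le
    (kmono (by linarith [dist_nonneg (x := b') (y := a'), dist_nonneg (x := b) (y := a')]) (by linarith) (by positivity) (four_pi hb.k)).le
  rw [show s + (dist p b - s) = dist p b by ring, Q_symm p b' a', Q_symm p b a'] at g
  have := mul_le_mul_of_nonneg_left h ss.le
  by_contra hc
  push Not at hc
  nlinarith [mul_lt_mul_of_pos_left hc sb]

end star
end Collapse

namespace Collapse
section base
variable {κ s : ℝ} {X : Type} [MetricSpace X]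

open Classical in
/-- filtered and shrunk list -/
def shr (κ : ℝ) (p : X) (st : X → X) (W : List (ℝ × X)) : List (ℝ × X) :=
  (W.filter fun w => decide (sn κ (dist p w.2) ≠ 0)).map fun w => (w.1, st w.2)

lemma shr_nil (p : X) (st : X → X) : shr κ p st [] = [] := rfl

lemma shr_cons_good {p : X} {st : X → X} {w : ℝ × X} (h : sn κ (dist p w.2) ≠ 0) (W : List (ℝ × X)) :
    shr κ p st (w :: W) = (w.1, st w.2) :: shr κ p st W := by
  simp [shr, h]

lemma shr_cons_bad {p : X} {st : X → X} {w : ℝ × X} (h : sn κ (dist p w.2) = 0) (W : List (ℝ × X)) :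
    shr κ p st (w :: W) = shr κ p st W := by
  simp [shr, h]

lemma mem_shr {p : X} {st : X → X} {W : List (ℝ × X)} {v : ℝ × X} (h : v ∈ shr κ p st W) :
    ∃ w ∈ W, sn κ (dist p w.2) ≠ 0 ∧ v = (w.1, st w.2) := by
  unfold shr at h
  rw [List.mem_map] at h
  obtain ⟨w, hw, rfl⟩ := h
  rw [List.mem_filter] at hw
  exact ⟨w, hw.1, by simpa using hw.2, rfl⟩

lemma QL_shr_le [CompactSpace X] {k : ℕ} (hX : IsAlexandrovSpace X k κ) {p : X} (hs : 0 < s) {st : X → X} {b : X}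
    (hst : ∀ a, Good κ s p a → dist p (st a) = s ∧ dist (st a) a = dist p a - s) (hb : Good κ s p b) (W : List (ℝ × X))
    (hW : ∀ w ∈ W, 0 < w.1 ∧ (sn κ (dist p w.2) ≠ 0 → Good κ s p w.2)) :
    QL κ p (shr κ p st W) (st b) ≤ sn κ s ^ 2 * (W.map fun w => w.1 * CC κ p w.2 b).sum := by
  induction W with
  | nil => simp [shr_nil, QL]
  | cons w W ih =>
    have ih := ih fun w' h => hW w' (List.mem_cons_of_mem _ h)
    have hw := hW w List.mem_cons_self
    rw [List.map_cons, List.sum_cons]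
    by_cases h : sn κ (dist p w.2) = 0
    · rw [shr_cons_bad h, CC_junk p w.2 b (Or.inl h)]; linarith
    · rw [shr_cons_good h, QL_cons]
      have g := hw.2 h
      have := mul_le_mul_of_nonneg_left (star2 hX hs g hb (hst _ g).1 (hst _ g).2 (hst b hb).1 (hst b hb).2) hw.1.le
      simp only
      linarith

lemma Gam_shr_le [CompactSpace X] {k : ℕ} (hX : IsAlexandrovSpace X k κ) {p : X} (hs : 0 < s) {st : X → X}
    (hst : ∀ a, Good κ s p a → dist p (st a) = s ∧ dist (st a) a = dist p a - s) (W V : List (ℝ × X))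
    (hW : ∀ w ∈ W, 0 < w.1 ∧ (sn κ (dist p w.2) ≠ 0 → Good κ s p w.2))
    (hV : ∀ w ∈ V, 0 < w.1 ∧ (sn κ (dist p w.2) ≠ 0 → Good κ s p w.2)) :
    Gam κ p (shr κ p st W) (shr κ p st V) ≤ sn κ s ^ 2 * (V.map fun v => v.1 * (W.map fun w => w.1 * CC κ p w.2 v.2).sum).sum := by
  induction V with
  | nil => simp [shr_nil, Gam]
  | cons v V ih =>
    have ih := ih fun w' h => hV w' (List.mem_cons_of_mem _ h)
    have hv := hV v List.mem_cons_self
    rw [List.map_cons, List.sum_cons]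
    by_cases h : sn κ (dist p v.2) = 0
    · have : (W.map fun w => w.1 * CC κ p w.2 v.2).sum = 0 := by
        apply List.sum_eq_zero
        intro x hx
        rw [List.mem_map] at hx
        obtain ⟨w, -, rfl⟩ := hx
        rw [CC_junk p w.2 v.2 (Or.inr h), mul_zero]
      rw [shr_cons_bad h, this]; linarith
    · rw [shr_cons_good h, Gam_cons]
      have := mul_le_mul_of_nonneg_left (QL_shr_le hX hs hst (hv.2 h) W hW) hv.1.le
      simp only
      linarith

lemma deriv_pos_of {φ : ℝ → ℝ} (h1 : ContDiff ℝ (⊤ : ℕ∞) φ) (h2 : StrictMono φ) (h3 : ConcaveOn ℝ Set.univ φ) (x : ℝ) :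
    0 < deriv φ x := by
  have hd : DifferentiableAt ℝ φ x := (h1.differentiable (by simp)).differentiableAt
  have h := h3.slope_le_deriv (mem_univ x) (mem_univ (x + 1)) (by linarith) hd
  refine lt_of_lt_of_le ?_ h
  rw [slope_def_field]
  have := h2 (show x < x + 1 by linarith)
  apply div_pos <;> linarith

open Filter Topology in
lemma good_event {p a : X} (hd : κ * dist p a ^ 2 ≤ Real.pi ^ 2) (h : sn κ (dist p a) ≠ 0) : ∀ᶠ s in 𝓝[>] (0 : ℝ), Good κ s p a := by
  have h0 : 0 < dist p a := by
    rcases dist_nonneg.lt_or_eq (a := (0 : ℝ)) (b := dist p a) with h' | h'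
    · exact h'
    · rw [← h', sn_zero] at h; exact absurd rfl h
  have hlt : κ * dist p a ^ 2 < Real.pi ^ 2 := by
    refine lt_of_le_of_ne hd fun he => h ?_
    have hpi := Real.pi_pos
    have hk : 0 < κ := by
      by_contra hc
      push Not at hc
      have := mul_nonpos_of_nonpos_of_nonneg hc (sq_nonneg (dist p a))
      nlinarith
    obtain ⟨σ, hσ, rfl⟩ : ∃ σ : ℝ, 0 < σ ∧ κ = σ ^ 2 := ⟨√κ, Real.sqrt_pos.2 hk, (Real.sq_sqrt hk.le).symm⟩
    rw [← mul_pow] at he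
    have := (pow_left_inj₀ (by positivity) hpi.le two_ne_zero).1 he
    rw [sn_pos_k hσ, this, Real.sin_pi, zero_div]
  have e1 : ∀ᶠ s in 𝓝 (0 : ℝ), s < dist p a := Iio_mem_nhds h0
  have e2 : ∀ᶠ s in 𝓝 (0 : ℝ), κ * (dist p a + s) ^ 2 < Real.pi ^ 2 := by
    have : Continuous fun s : ℝ => κ * (dist p a + s) ^ 2 := by fun_prop
    refine this.continuousAt.eventually_lt continuousAt_const ?_
    simpa using hlt
  filter_upwards [nhdsWithin_le_nhds e1, nhdsWithin_le_nhds e2] with s h1 h2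
  exact ⟨h1.le, h2⟩

open Filter Topology in
lemma base_sys [CompactSpace X] {k m : ℕ} (hX : IsAlexandrovSpace X k κ) {r : ℝ} (hr0 : 0 < r)
    (hdiam : ∀ x y : X, κ * dist x y ^ 2 ≤ Real.pi ^ 2) {p : X} (d : AdmissibleData X m) (hd : d.RegularAt κ p) :
    ∃ S : Fin (m + 1) → List (ℝ × X), IsSys κ r p S ∧ ∀ i, S i ≠ [] := by
  obtain ⟨h1, w, hwp, hw⟩ := hd
  have hpw : 0 < dist p w := dist_pos.2 hwp.symm
  obtain ⟨s, hs, hsr, hsw, hgw, hg⟩ : ∃ s : ℝ, 0 < s ∧ s < r ∧ s < dist p w ∧ (sn κ (dist p w) ≠ 0 → Good κ s p w) ∧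
      ∀ i α, sn κ (dist p (d.pt i α)) ≠ 0 → Good κ s p (d.pt i α) := by
    have E1 : ∀ᶠ s in 𝓝[>] (0 : ℝ), 0 < s := self_mem_nhdsWithin
    have E2 : ∀ᶠ s in 𝓝[>] (0 : ℝ), s < r := nhdsWithin_le_nhds (Iio_mem_nhds hr0)
    have E3 : ∀ᶠ s in 𝓝[>] (0 : ℝ), s < dist p w := nhdsWithin_le_nhds (Iio_mem_nhds hpw)
    have E4 : ∀ a, ∀ᶠ s in 𝓝[>] (0 : ℝ), (sn κ (dist p a) ≠ 0 → Good κ s p a) := fun a => by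
      by_cases h : sn κ (dist p a) = 0
      · exact Eventually.of_forall fun s h' => absurd h h'
      · filter_upwards [good_event (hdiam p a) h] with s hs _ using hs
    have E5 : ∀ᶠ s in 𝓝[>] (0 : ℝ), ∀ i α, sn κ (dist p (d.pt i α)) ≠ 0 → Good κ s p (d.pt i α) :=
      eventually_all.2 fun i => eventually_all.2 fun α => E4 _
    obtain ⟨s, a1, a2, a3, a4, a5⟩ := (E1.and (E2.and (E3.and ((E4 w).and E5)))).exists
    exact ⟨s, a1, a2, a3, a4, a5⟩
  have hst : ∀ a : X, ∃ a', s ≤ dist p a → dist p a' = s ∧ dist a' a = dist p a - s := fun a => by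
    by_cases h : s ≤ dist p a
    · obtain ⟨z, hz⟩ := exists_btw hX p a hs.le h
      exact ⟨z, fun _ => hz⟩
    · exact ⟨a, fun h' => absurd h' h⟩
  choose st hst using hst
  let W : Fin m → List (ℝ × X) := fun i => List.ofFn fun α => (deriv (d.φ i α) (dist (d.pt i α) p), d.pt i α)
  have hW : ∀ i, ∀ w ∈ W i, 0 < w.1 ∧ (sn κ (dist p w.2) ≠ 0 → Good κ s p w.2) := by
    intro i w hw
    rw [List.mem_ofFn] at hw
    obtain ⟨α, rfl⟩ := hw
    exact ⟨deriv_pos_of (d.smooth i α) (d.mono i α) (d.conc i α) _, hg i α⟩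
  have hst' : ∀ a, Good κ s p a → dist p (st a) = s ∧ dist (st a) a = dist p a - s := fun a ha => hst a ha.le
  have sumW : ∀ i (F : ℝ × X → ℝ), ((W i).map F).sum = ∑ α, F (deriv (d.φ i α) (dist (d.pt i α) p), d.pt i α) := by
    intro i F
    simp only [W, List.map_ofFn, List.sum_ofFn, Function.comp]
  have sgood : ∀ a, Good κ s p a → 0 < sn κ s := fun a ha =>
    sn_pos hs (kmono hs.le (by linarith [dist_nonneg (x := p) (y := a)]) (by have := Real.pi_pos; positivity) ha.k)
  have hwgood : ∀ _ : Fin m, Good κ s p w := fun i => by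
    apply hgw
    intro h0
    have := hw i
    refine absurd this (not_lt.2 (Finset.sum_nonneg fun α _ => ?_))
    have e := CC_junk (κ := κ) p (d.pt i α) w (Or.inr h0)
    unfold CC at e
    rw [e, mul_zero]
  have hQ : ∀ i, QL κ p (shr κ p st (W i)) (st w) < 0 := fun i => by
    have h := QL_shr_le hX hs hst' (hwgood i) (W i) (hW i)
    rw [sumW] at h
    refine h.trans_lt (mul_neg_of_pos_of_neg (pow_pos (sgood _ (hwgood i)) 2) (hw i))
  have hS : IsSys κ r p (fun i => shr κ p st (W i)) := by
    constructor
    · intro i v hv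
      obtain ⟨w', hw', hne, rfl⟩ := mem_shr hv
      obtain ⟨c1, c2⟩ := hW i w' hw'
      have c3 := (hst' _ (c2 hne)).1
      refine ⟨c1, fun h => ?_, by simp only [c3]; exact hsr.le⟩
      simp only at h
      rw [← h, dist_self] at c3
      linarith
    · intro i j hij
      have h := Gam_shr_le hX hs hst' (W i) (W j) (hW i) (hW j)
      refine h.trans_lt (mul_neg_of_pos_of_neg (pow_pos (sgood _ (hwgood i)) 2) ?_)
      rw [sumW]
      simp only [sumW]
      refine lt_of_eq_of_lt ?_ (h1 i j hij)
      simp only [Finset.mul_sum]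
      rw [Finset.sum_comm]
      refine Finset.sum_congr rfl fun α _ => Finset.sum_congr rfl fun β _ => ?_
      unfold CC; ring
  have hpw' := hst w hsw.le
  refine ⟨Fin.snoc (fun i => shr κ p st (W i)) [(1, st w)], sys_snoc hS (fun h => ?_) (by rw [hpw'.1]; exact hsr.le) hQ, ?_⟩
  · have := hpw'.1
    rw [← h, dist_self] at this
    linarith
  · intro i
    refine Fin.lastCases ?_ (fun i => ?_) i
    · rw [Fin.snoc_last]; simp
    · rw [Fin.snoc_castSucc]
      intro h
      have := hQ i
      rw [h] at this
      simp [QL] at this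

theorem main_thm (n k m : ℕ) (κ : ℝ) (hk : 1 ≤ k) (hkn : k < n)
    (X : Type) [MetricSpace X] [CompactSpace X] (hX : IsAlexandrovSpace X k κ)
    (E : Set X) (hE : IsPrimitiveExtremal κ E) (hdim : dimH E = m)
    (p : X) (f : X → Fin m → ℝ) (W : Set X) (hreg : IsRegAdmissibleOn κ f W {p}) :
    IsGoodPointDRN n κ E p := by
  by_cases hdiam : ∀ x y : X, κ * dist x y ^ 2 ≤ Real.pi ^ 2
  · obtain ⟨d, H, L, -, -, hd⟩ := hreg
    obtain ⟨r, hr0, hr⟩ := exists_loc κ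
    obtain ⟨S, hS, hne⟩ := base_sys hX (r := r / 32) (by positivity) hdiam d (hd p rfl)
    exact drn_of_key hr hr0 (key_A hX hk hr hr0 hE.1 hdim hS hne)
  · push Not at hdiam
    obtain ⟨x, y, hxy⟩ := hdiam
    have hk0 : 0 < κ := by
      by_contra hc
      push Not at hc
      have := mul_nonpos_of_nonpos_of_nonneg hc (sq_nonneg (dist x y))
      nlinarith [Real.pi_pos]
    obtain ⟨μ₀, hμ₀, hμ₁⟩ : ∃ μ₀ > 0, Real.pi ^ 2 < κ * (dist x y - μ₀) ^ 2 ∧ μ₀ < dist x y := by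
      have hc : Continuous fun t : ℝ => κ * (dist x y - t) ^ 2 := by fun_prop
      have e1 : ∀ᶠ t in nhds (0 : ℝ), Real.pi ^ 2 < κ * (dist x y - t) ^ 2 :=
        continuousAt_const.eventually_lt hc.continuousAt (by simpa using hxy)
      have hxy0 : 0 < dist x y := by
        rcases dist_nonneg.lt_or_eq (a := (0 : ℝ)) (b := dist x y) with h' | h'
        · exact h'
        · rw [← h'] at hxy; nlinarith [Real.pi_pos]
      have e2 : ∀ᶠ t in nhds (0 : ℝ), t < dist x y := Iio_mem_nhds hxy0
      have e3 : ∀ᶠ t in nhdsWithin (0 : ℝ) (Ioi 0), 0 < t := self_mem_nhdsWithin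
      have e4 : ∀ᶠ t in nhdsWithin (0 : ℝ) (Ioi 0), Real.pi ^ 2 < κ * (dist x y - t) ^ 2 := nhdsWithin_le_nhds e1
      have e5 : ∀ᶠ t in nhdsWithin (0 : ℝ) (Ioi 0), t < dist x y := nhdsWithin_le_nhds e2
      obtain ⟨t, a, b, c⟩ := (e3.and (e4.and e5)).exists
      exact ⟨t, a, b, c⟩
    intro R _
    refine ⟨1, one_pos, fun q₁ _ q₂ _ => ⟨1, one_pos, fun r₁ r₂ _ _ _ _ => ⟨μ₀, hμ₀, fun μ hμ hμ' M _ hM θ η hap => ?_⟩⟩⟩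
    exfalso
    have : CompactSpace M := by
      have := hM.proper
      obtain ⟨D, hD⟩ := Metric.isBounded_iff.1 (isCompact_univ (X := X)).isBounded
      have hb : Bornology.IsBounded (univ : Set M) := Metric.isBounded_iff.2 ⟨D + μ, fun x _ y _ => by
        have := (abs_lt.1 (hap.dist_theta x y)).1
        have := hD (mem_univ (θ x)) (mem_univ (θ y))
        linarith⟩
      exact ⟨Metric.isCompact_of_isClosed_isBounded isClosed_univ hb⟩
    have h := diam_le hM (by omega) (η x) (η y)
    have h2 := (abs_lt.1 (hap.dist_eta x y)).1
    have h3 : κ * (dist x y - μ₀) ^ 2 ≤ κ * dist (η x) (η y) ^ 2 :=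
      mul_le_mul_of_nonneg_left (pow_le_pow_left₀ (by linarith [hμ₁.2]) (by linarith) 2) hk0.le
    linarith [hμ₁.1]

end base
end Collapse

namespace Collapse

/-- Let `E` be an `m`-dimensional primitive extremal subset of `X` and let
`p ∈ E` be a regular point of an admissible map `f : X → ℝ^m`. Then `p` is a good point of `E`,
i.e. `p` satisfies condition (DRN). -/
theorem regular_point_is_good (n k m : ℕ) (κ : ℝ) (hk : 1 ≤ k) (hkn : k < n)
    (X : Type) [MetricSpace X] [CompactSpace X] (hX : IsAlexandrovSpace X k κ)
    (E : Set X) (hE : IsPrimitiveExtremal κ E) (hdim : dimH E = m)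
    (p : X) (hpE : p ∈ E)
    (f : X → Fin m → ℝ) (W : Set X) (hW : IsOpen W) (hpW : p ∈ W)
    (hreg : IsRegAdmissibleOn κ f W {p}) :
    IsGoodPointDRN n κ E p := by
  exact main_thm n k m κ hk hkn X hX E hE hdim p f W hreg

end Collapse
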